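/- Suppose n·p_n → λ > 1. Let μ_λ ∈ (0,1) be the unique solution in (0,1) of μ·e^{−μ} = λ·e^{−λ}, and define c(λ) = 1/(λ−1) + 2/log(1/μ_λ) and d(λ) = λ/(λ−1) + 2/log(1/μ_λ). Then for every ε > 0, with probability tending to 1 as n→∞, there exist vertices i*, j* in the largest connected component (giant component) of G_n(p_n) such that the weight of the minimal-weight path between them satisfies W_n(i*, j*) ≥ (1−ε)·c(λ)·log n and its number of edges satisfies H_n(i*, j*) ≥ (1−ε)·d(λ)·log n. -/

import Mathlib

open MeasureTheory ProbabilityTheory Filter Real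
open scoped ENNReal NNReal
noncomputable section
def expDist : Measure ℝ :=
  volume.withDensity (fun x => if 0 ≤ x then ENNReal.ofReal (Real.exp (-x)) else 0)
def bernoulliDist (p : ℝ) : Measure Bool :=
  ENNReal.ofReal p • Measure.dirac true + ENNReal.ofReal (1 - p) • Measure.dirac false
def theGraph {n : ℕ} (Z : Sym2 (Fin n) → Bool × ℝ) : SimpleGraph (Fin n) where
  Adj a b := a ≠ b ∧ (Z s(a, b)).1 = true
  symm := by
    constructor
    intro a b h
    refine ⟨h.1.symm, ?_⟩
    rw [Sym2.eq_swap]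
    exact h.2
  loopless := by constructor; intro a h; exact h.1 rfl
def effWeight {n : ℕ} (Z : Sym2 (Fin n) → Bool × ℝ) (a b : Fin n) : ℝ≥0∞ :=
  if a ≠ b ∧ (Z s(a, b)).1 = true then ENNReal.ofReal (Z s(a, b)).2 else ⊤
def walkWeight {n : ℕ} (w : Fin n → Fin n → ℝ≥0∞) {k : ℕ} (q : Fin (k + 1) → Fin n) : ℝ≥0∞ :=
  ∑ t : Fin k, w (q t.castSucc) (q t.succ)
def minWeight {n : ℕ} (w : Fin n → Fin n → ℝ≥0∞) (i j : Fin n) : ℝ≥0∞ :=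
  ⨅ (k : ℕ) (q : Fin (k + 1) → Fin n) (_ : q 0 = i ∧ q (Fin.last k) = j), walkWeight w q
def hopCount {n : ℕ} (w : Fin n → Fin n → ℝ≥0∞) (i j : Fin n) : ℕ :=
  sInf {k : ℕ | ∃ q : Fin (k + 1) → Fin n,
    q 0 = i ∧ q (Fin.last k) = j ∧ walkWeight w q = minWeight w i j}
def inLargestComponent {n : ℕ} (G : SimpleGraph (Fin n)) (v : Fin n) : Prop :=
  ∀ u : Fin n, (G.connectedComponentMk u).supp.ncard ≤ (G.connectedComponentMk v).supp.ncard
set_option linter.all false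
theorem mll {a b c : ℝ} (h : b ≤ c) (k : 0 ≤ a) : a * b ≤ a * c := mul_le_mul_of_nonneg_left h k
theorem mlr {a b c : ℝ} (h : b ≤ c) (k : 0 ≤ a) : b * a ≤ c * a := mul_le_mul_of_nonneg_right h k
section
open Finset
lemma exp_lint (g : ℝ → ℝ≥0∞) (hg : Measurable g) :
    ∫⁻ x, g x ∂expDist = ∫⁻ x in Set.Ioi 0, ENNReal.ofReal (Real.exp (-x)) * g x := by
  have hm : Measurable fun x : ℝ => if 0 ≤ x then ENNReal.ofReal (Real.exp (-x)) else 0 :=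
    Measurable.ite measurableSet_Ici (by fun_prop) measurable_const
  rw [expDist, lintegral_withDensity_eq_lintegral_mul _ hm hg, restrict_Ioi_eq_restrict_Ici,
    ← lintegral_indicator measurableSet_Ici]
  congr 1; ext x
  by_cases h : 0 ≤ x <;> simp [Set.indicator, h]
lemma exp_laplace (a : ℝ) (ha' : 0 < 1 + a) :
    ∫⁻ x, ENNReal.ofReal (Real.exp (-(a * x))) ∂expDist = ENNReal.ofReal (1 / (1 + a)) := by
  rw [exp_lint _ (by fun_prop)]
  have h1 : ∀ x : ℝ, ENNReal.ofReal (Real.exp (-x)) * ENNReal.ofReal (Real.exp (-(a * x)))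
      = ENNReal.ofReal (Real.exp (-(1 + a) * x)) := by
    intro x; rw [← ENNReal.ofReal_mul (Real.exp_pos _).le, ← Real.exp_add]; ring_nf
  simp_rw [h1]
  rw [← ofReal_integral_eq_lintegral_ofReal (integrableOn_exp_mul_Ioi (by linarith) 0)
    (ae_of_all _ fun x => (Real.exp_pos _).le), integral_exp_mul_Ioi (by linarith)]
  congr 1; simp; rw [div_eq_iff (by linarith)]; field_simp; ring
instance : IsProbabilityMeasure expDist := ⟨by
  have := exp_laplace 0 (by norm_num); simpa using this⟩
lemma exp_Iic (x : ℝ) (hx : 0 ≤ x) : expDist (Set.Iic x) = ENNReal.ofReal (1 - Real.exp (-x)) := by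
  have h : expDist (Set.Ioi x) = ENNReal.ofReal (Real.exp (-x)) := by
    rw [← lintegral_indicator_one measurableSet_Ioi,
      exp_lint _ (measurable_one.indicator measurableSet_Ioi), ← integral_exp_neg_Ioi,
      ofReal_integral_eq_lintegral_ofReal (integrableOn_exp_neg_Ioi x)
        (ae_of_all _ fun x => (Real.exp_pos _).le)]
    rw [← lintegral_indicator measurableSet_Ioi, ← lintegral_indicator measurableSet_Ioi]
    congr 1; ext y
    by_cases h : x < y
    · simp [Set.indicator, h, hx.trans_lt h]
    · simp [Set.indicator, h]
  have h2 := prob_compl_eq_one_sub (μ := expDist) (measurableSet_Ioi (a := x))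
  rw [Set.compl_Ioi, h, ← ENNReal.ofReal_one, ← ENNReal.ofReal_sub _ (Real.exp_pos _).le] at h2
  exact h2
section
variable {p : ℝ} [hp : Fact (0 ≤ p ∧ p ≤ 1)]
instance bern_prob : IsProbabilityMeasure (bernoulliDist p) := ⟨by
  simp only [bernoulliDist, Measure.coe_add, Measure.coe_smul, Pi.add_apply, Pi.smul_apply,
    measure_univ, smul_eq_mul, mul_one]
  rw [← ENNReal.ofReal_add hp.out.1 (by linarith [hp.out.2])]; simp⟩
def BE (p : ℝ) : Measure (Bool × ℝ) := (bernoulliDist p).prod expDist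
instance : IsProbabilityMeasure (BE p) := by
  unfold BE; infer_instance
lemma BE_prod (B : Set ℝ) :
    (BE p).real {z | z.1 = true ∧ z.2 ∈ B} = p * expDist.real B := by
  have : {z : Bool × ℝ | z.1 = true ∧ z.2 ∈ B} = {true} ×ˢ B := by ext; simp
  rw [this, BE, measureReal_prod_prod]
  congr 1
  simp [bernoulliDist, Measure.real, hp.out.1]
lemma BE_true : (BE p).real {z | z.1 = true} = p := by
  have := BE_prod (p := p) Set.univ
  simpa using this
lemma BE_compl {B : Set (Bool × ℝ)} (hB : MeasurableSet B) :
    (BE p).real Bᶜ = 1 - (BE p).real B := probReal_compl_eq_one_sub hB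
lemma meas_true : MeasurableSet {z : Bool × ℝ | z.1 = true} :=
  measurable_fst (measurableSet_singleton true)
lemma meas_le (x : ℝ) : MeasurableSet {z : Bool × ℝ | z.1 = true ∧ z.2 ≤ x} :=
  meas_true.inter (measurable_snd measurableSet_Iic)
lemma BE_false : (BE p).real {z | ¬ z.1 = true} = 1 - p := by
  have := BE_compl (p := p) meas_true
  rwa [BE_true] at this
lemma BE_le {x : ℝ} (hx : 0 ≤ x) :
    (BE p).real {z | z.1 = true ∧ z.2 ≤ x} = p * (1 - Real.exp (-x)) := by
  have := BE_prod (p := p) (Set.Iic x)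
  simp only [Set.mem_Iic] at this
  rw [this, Measure.real, exp_Iic x hx, ENNReal.toReal_ofReal]
  have : Real.exp (-x) ≤ 1 := Real.exp_le_one_iff.2 (by linarith)
  linarith
abbrev Cfg (V : Type) := Sym2 V → Bool × ℝ
end
variable {V : Type} [Fintype V] [DecidableEq V]
def PP (V : Type) [Fintype V] (p : ℝ) : Measure (Cfg V) :=
  Measure.pi fun _ => BE p
instance {p : ℝ} [hp : Fact (0 ≤ p ∧ p ≤ 1)] : IsProbabilityMeasure (PP V p) := by
  unfold PP; infer_instance
def pr (p : ℝ) (A : Set (Cfg V)) : ℝ := (PP V p).real A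
def Det (T : Set (Sym2 V)) (A : Set (Cfg V)) : Prop :=
  MeasurableSet A ∧ ∀ c c' : Cfg V, (∀ e ∈ T, c e = c' e) → c ∈ A → c' ∈ A
lemma Det.mono {T T' : Set (Sym2 V)} {A : Set (Cfg V)} (h : Det T A) (hT : T ⊆ T') : Det T' A :=
  ⟨h.1, fun c c' hc => h.2 c c' fun e he => hc e (hT he)⟩
lemma Det.inter {T : Set (Sym2 V)} {A B : Set (Cfg V)} (h : Det T A) (h' : Det T B) :
    Det T (A ∩ B) :=
  ⟨h.1.inter h'.1, fun c c' hc hA => ⟨h.2 c c' hc hA.1, h'.2 c c' hc hA.2⟩⟩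
lemma Det.inter2 {T T' : Set (Sym2 V)} {A B : Set (Cfg V)} (h : Det T A) (h' : Det T' B) :
    Det (T ∪ T') (A ∩ B) :=
  (h.mono Set.subset_union_left).inter (h'.mono Set.subset_union_right)
lemma Det.compl {T : Set (Sym2 V)} {A : Set (Cfg V)} (h : Det T A) : Det T Aᶜ :=
  ⟨h.1.compl, fun c c' hc hA hA' => hA (h.2 c' c (fun e he => (hc e he).symm) hA')⟩
lemma Det.iUnion {ι : Type*} [Countable ι] {T : Set (Sym2 V)} {A : ι → Set (Cfg V)}
    (h : ∀ i, Det T (A i)) : Det T (⋃ i, A i) :=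
  ⟨MeasurableSet.iUnion fun i => (h i).1, fun c c' hc hA => by
    obtain ⟨i, hi⟩ := Set.mem_iUnion.1 hA
    exact Set.mem_iUnion.2 ⟨i, (h i).2 c c' hc hi⟩⟩
lemma det_disc {α : Type*} [Finite α] [MeasurableSpace α] [MeasurableSingletonClass α]
    (g : Bool × ℝ → α) (hg : Measurable g)
    {T : Set (Sym2 V)} (Q : (Sym2 V → α) → Prop)
    (hQ : ∀ b b' : Sym2 V → α, (∀ e ∈ T, b e = b' e) → Q b → Q b') :
    Det T {c | Q fun e => g (c e)} := by
  refine ⟨?_, fun c c' hc h => hQ _ _ (fun e he => by rw [hc e he]) h⟩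
  have hm : Measurable fun (c : Cfg V) (e : Sym2 V) => g (c e) :=
    measurable_pi_lambda _ fun e => hg.comp (measurable_pi_apply e)
  exact hm (Set.toFinite {b | Q b}).measurableSet
lemma det_edge {B : Set (Bool × ℝ)} (hB : MeasurableSet B) (e : Sym2 V) :
    Det {e} {c | c e ∈ B} :=
  ⟨measurable_pi_apply e hB, fun c c' hc h => by
    rw [Set.mem_ofPred_eq, ← hc e rfl]; exact h⟩
section
variable {p : ℝ} [hp : Fact (0 ≤ p ∧ p ≤ 1)]
lemma pr_nonneg (A : Set (Cfg V)) : 0 ≤ pr p A := measureReal_nonneg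
lemma pr_mono {A B : Set (Cfg V)} (h : A ⊆ B) : pr p A ≤ pr p B :=
  measureReal_mono h (measure_ne_top _ _)
lemma pr_le_one (A : Set (Cfg V)) : pr p A ≤ 1 := measureReal_le_one
lemma pr_indep {T T' : Set (Sym2 V)} {A B : Set (Cfg V)} (hA : Det T A) (hB : Det T' B)
    (hT : Disjoint T T') : pr p (A ∩ B) = pr p A * pr p B := by
  classical
  have hi : iIndepFun (fun (e : Sym2 V) (c : Cfg V) => c e) (PP V p) :=
    iIndepFun_pi (X := fun _ => id) (fun _ => aemeasurable_id)
  have h := hi.indepFun_finset T.toFinset T'.toFinset (by simpa using hT)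
    (fun e => measurable_pi_apply e)
  have key : ∀ (T : Set (Sym2 V)) (A : Set (Cfg V)), Det T A →
      ∃ A' : Set (T.toFinset → Bool × ℝ), MeasurableSet A' ∧
        A = (fun (c : Cfg V) (e : T.toFinset) => c e) ⁻¹' A' := by
    intro T A hA
    let ext : (T.toFinset → Bool × ℝ) → Cfg V := fun x e =>
      if h : e ∈ T.toFinset then x ⟨e, h⟩ else (false, 0)
    have hm : Measurable ext := by
      refine measurable_pi_lambda _ fun e => ?_
      by_cases h : e ∈ T.toFinset
      · simp only [ext, h, dif_pos]; exact measurable_pi_apply _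
      · simp only [ext, h]; exact measurable_const
    refine ⟨ext ⁻¹' A, hm hA.1, ?_⟩
    ext c
    have he : ∀ e ∈ T, c e = ext (fun e : T.toFinset => c e) e := by
      intro e he; simp [ext, he]
    exact ⟨hA.2 _ _ he, hA.2 _ _ fun e h => (he e h).symm⟩
  obtain ⟨A', hA', rfl⟩ := key T A hA
  obtain ⟨B', hB', rfl⟩ := key T' B hB
  have := h.measure_inter_preimage_eq_mul _ _ hA' hB'
  simp only [pr, Measure.real, this, ENNReal.toReal_mul]
lemma pr_edges (T : Finset (Sym2 V)) (B : Sym2 V → Set (Bool × ℝ)) :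
    pr p {c | ∀ e ∈ T, c e ∈ B e} = ∏ e ∈ T, (BE p).real (B e) := by
  classical
  have : {c | ∀ e ∈ T, c e ∈ B e} = Set.univ.pi fun e => if e ∈ T then B e else Set.univ := by
    ext c; simp only [Set.mem_ofPred_eq, Set.mem_pi, Set.mem_univ, true_imp_iff]
    refine forall_congr' fun e => ?_
    by_cases h : e ∈ T <;> simp [h]
  rw [pr, PP, this, Measure.real, Measure.pi_pi, ENNReal.toReal_prod,
    ← prod_subset (subset_univ T)]
  · exact prod_congr rfl fun e he => by simp [he, Measure.real]
  · intro e _ he; simp [he]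
lemma pr_union_le (A B : Set (Cfg V)) : pr p (A ∪ B) ≤ pr p A + pr p B := measureReal_union_le _ _
lemma pr_biUnion_le {ι : Type*} (s : Finset ι) (A : ι → Set (Cfg V)) :
    pr p (⋃ i ∈ s, A i) ≤ ∑ i ∈ s, pr p (A i) := measureReal_biUnion_finset_le s A
lemma pr_biUnion {ι : Type*} (s : Finset ι) (A : ι → Set (Cfg V)) (hA : ∀ i ∈ s, MeasurableSet (A i))
    (hd : (s : Set ι).PairwiseDisjoint A) : pr p (⋃ i ∈ s, A i) = ∑ i ∈ s, pr p (A i) :=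
  measureReal_biUnion_finset hd hA
lemma sum_pr_le {ι : Type*} (s : Finset ι) (A : ι → Set (Cfg V)) (hA : ∀ i ∈ s, MeasurableSet (A i))
    (hd : (s : Set ι).PairwiseDisjoint A) (B : Set (Cfg V)) (hB : ∀ i ∈ s, A i ⊆ B) :
    ∑ i ∈ s, pr p (A i) ≤ pr p B := by
  rw [← pr_biUnion s A hA hd]; exact pr_mono (Set.iUnion₂_subset hB)
end
end
section
open Finset
variable {V : Type} [Fintype V] [DecidableEq V]
def bb (c : Cfg V) : Sym2 V → Bool := fun e => (c e).1
def adj (b : Sym2 V → Bool) (x y : V) : Prop := x ≠ y ∧ b s(x, y) = true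
lemma adj.symm {b : Sym2 V → Bool} {x y : V} (h : adj b x y) : adj b y x :=
  ⟨h.1.symm, by rw [Sym2.eq_swap]; exact h.2⟩
def EE (A B : Finset V) : Set (Sym2 V) := {e | ∃ x ∈ A, ∃ y ∈ B, x ≠ y ∧ e = s(x, y)}
lemma EE_mono {A B A' B' : Finset V} (h : A ⊆ A') (h' : B ⊆ B') : EE A B ⊆ EE A' B' := by
  rintro e ⟨x, hx, y, hy, hh⟩; exact ⟨x, h hx, y, h' hy, hh⟩
lemma EE_disj {A B C D : Finset V}
    (h1 : ∀ x y, x ∈ A → y ∈ B → x ∈ C → y ∈ D → x = y)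
    (h2 : ∀ x y, x ∈ A → y ∈ B → x ∈ D → y ∈ C → x = y) : Disjoint (EE A B) (EE C D) := by
  rw [Set.disjoint_left]
  rintro e ⟨x, hx, y, hy, hn, rfl⟩ ⟨x', hx', y', hy', hn', he⟩
  rcases Sym2.eq_iff.1 he with ⟨rfl, rfl⟩ | ⟨rfl, rfl⟩
  · exact hn (h1 _ _ hx hy hx' hy')
  · exact hn (h2 _ _ hx hy hy' hx')
lemma det_b {T : Set (Sym2 V)} (Q : (Sym2 V → Bool) → Prop)
    (hQ : ∀ b b' : Sym2 V → Bool, (∀ e ∈ T, b e = b' e) → Q b → Q b') :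
    Det T {c | Q (bb c)} := det_disc Prod.fst measurable_fst Q hQ
def NoE (b : Sym2 V → Bool) (A B : Finset V) : Prop := ∀ x ∈ A, ∀ y ∈ B, ¬ adj b x y
def Conn (b : Sym2 V → Bool) (A T : Finset V) : Prop :=
  ∀ X, X ⊆ T → X.Nonempty → ∃ x ∈ X, ∃ y ∈ (A ∪ T) \ X, adj b x y
def Cl (b : Sym2 V → Bool) (A U T : Finset V) : Prop :=
  T ⊆ U ∧ Conn b A T ∧ NoE b (A ∪ T) (U \ T)
lemma adj_congr {A B : Finset V} {b b' : Sym2 V → Bool} (h : ∀ e ∈ EE A B, b e = b' e)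
    {x y : V} (hx : x ∈ A) (hy : y ∈ B) (ha : adj b x y) : adj b' x y :=
  ⟨ha.1, by rw [← h _ ⟨x, hx, y, hy, ha.1, rfl⟩]; exact ha.2⟩
lemma det_NoE (A B : Finset V) : Det (EE A B) {c | NoE (bb c) A B} :=
  det_b (fun b => NoE b A B) fun b b' hb h x hx y hy ha =>
    h x hx y hy (adj_congr (fun e he => (hb e he).symm) hx hy ha)
lemma det_Conn (A T : Finset V) : Det (EE T (A ∪ T)) {c | Conn (bb c) A T} :=
  det_b (fun b => Conn b A T) fun b b' hb h X hX hne => by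
    obtain ⟨x, hx, y, hy, ha⟩ := h X hX hne
    exact ⟨x, hx, y, hy, adj_congr hb (hX hx) (mem_sdiff.1 hy).1 ha⟩
lemma cl_unique {b : Sym2 V → Bool} {A U T T' : Finset V} (h : Cl b A U T) (h' : Cl b A U T') :
    T = T' := by
  have key : ∀ T T', Cl b A U T → Cl b A U T' → T ⊆ T' := by
    intro T T' h h'
    by_contra hcon
    obtain ⟨x, hx, y, hy, ha⟩ := h.2.1 (T \ T') sdiff_subset
      (sdiff_nonempty.2 hcon)
    simp only [Finset.mem_union, Finset.mem_sdiff] at hx hy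
    refine h'.2.2 y ?_ x ?_ ha.symm
    · simp only [Finset.mem_union]; tauto
    · exact mem_sdiff.2 ⟨h.1 hx.1, hx.2⟩
  exact Finset.Subset.antisymm (key _ _ h h') (key _ _ h' h)
lemma pr_pairs {p : ℝ} [hp : Fact (0 ≤ p ∧ p ≤ 1)] (D : Finset (V × V))
    (hD : ∀ d ∈ D, ∀ d' ∈ D, s(d.1, d.2) = s(d'.1, d'.2) → d = d') (B : V × V → Set (Bool × ℝ)) :
    pr p {c | ∀ d ∈ D, c s(d.1, d.2) ∈ B d} = ∏ d ∈ D, (BE p).real (B d) := by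
  classical
  have hinj : Set.InjOn (fun d : V × V => s(d.1, d.2)) D := fun d hd d' hd' h => hD d hd d' hd' h
  let B' : Sym2 V → Set (Bool × ℝ) := fun e => ⋂ d ∈ D.filter (fun d => s(d.1, d.2) = e), B d
  have hB' : ∀ d ∈ D, B' s(d.1, d.2) = B d := by
    intro d hd
    ext z
    simp only [B', Set.mem_iInter, mem_filter]
    exact ⟨fun h => h d ⟨hd, rfl⟩, fun h d' hd' => by rwa [hD d' hd'.1 d hd hd'.2]⟩
  have := pr_edges (p := p) (D.image fun d : V × V => s(d.1, d.2)) B'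
  rw [prod_image hinj] at this
  rw [prod_congr rfl fun d hd => by rw [hB' d hd]] at this
  rw [← this]
  congr 1; ext c
  simp only [Set.mem_ofPred_eq, mem_image, forall_exists_index, and_imp,
    forall_apply_eq_imp_iff₂]
  exact forall₂_congr fun d hd => by rw [hB' d hd]
lemma pair_inj {A B : Finset V} (h : Disjoint A B) : ∀ d ∈ A ×ˢ B, ∀ d' ∈ A ×ˢ B,
    s(d.1, d.2) = s(d'.1, d'.2) → d = d' := by
  rintro ⟨x, y⟩ hd ⟨x', y'⟩ hd' he
  simp only [mem_product] at hd hd'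
  rcases Sym2.eq_iff.1 he with ⟨h1, h2⟩ | ⟨h1, h2⟩
  · simp_all
  · simp only at h1; subst h1; exact absurd hd'.2 (disjoint_left.1 h hd.1)
section
variable {p : ℝ} [hp : Fact (0 ≤ p ∧ p ≤ 1)]
lemma pr_NoE {A B : Finset V} (h : Disjoint A B) :
    pr p {c | NoE (bb c) A B} = (1 - p) ^ (A.card * B.card) := by
  have := pr_pairs (p := p) (A ×ˢ B) (pair_inj h) (fun _ => {z | ¬ z.1 = true})
  rw [prod_const, BE_false, card_product] at this
  rw [← this]; congr 1; ext c
  simp only [Set.mem_ofPred_eq, Prod.forall, mem_product, NoE, adj, bb]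
  constructor
  · exact fun H x y hxy h1 => H x hxy.1 y hxy.2 ⟨fun he => disjoint_left.1 h hxy.1 (he ▸ hxy.2), h1⟩
  · exact fun H x hx y hy ha => H x y ⟨hx, hy⟩ ha.2
def Nb (b : Sym2 V → Bool) (a : V) (T N : Finset V) : Prop := ∀ y ∈ T, y ∈ N ↔ adj b a y
lemma det_Nb (a : V) (T N : Finset V) : Det (EE {a} T) {c | Nb (bb c) a T N} :=
  det_b (fun b => Nb b a T N) fun b b' hb h y hy => by
    rw [h y hy]
    exact ⟨adj_congr hb (mem_singleton_self a) hy,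
      adj_congr (fun e he => (hb e he).symm) (mem_singleton_self a) hy⟩
lemma pr_Nb {a : V} {T N : Finset V} (ha : a ∉ T) (hN : N ⊆ T) :
    pr p {c | Nb (bb c) a T N} = p ^ N.card * (1 - p) ^ (T.card - N.card) := by
  have := pr_pairs (p := p) ({a} ×ˢ T) (pair_inj (by simpa using ha))
    (fun d => if d.2 ∈ N then {z | z.1 = true} else {z | ¬ z.1 = true})
  rw [prod_product, prod_singleton] at this
  have h2 : ∏ x ∈ T, (BE p).real (if (a, x).2 ∈ N then {z | z.1 = true} else {z | ¬ z.1 = true})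
      = p ^ N.card * (1 - p) ^ (T.card - N.card) := by
    rw [← prod_sdiff hN, mul_comm, ← card_sdiff_of_subset hN, ← prod_const, ← prod_const]
    congr 1
    · exact prod_congr rfl fun x hx => by simp only [hx, if_true, BE_true]
    · exact prod_congr rfl fun x hx => by
        simp only [(mem_sdiff.1 hx).2, if_false, BE_false]
  rw [h2] at this
  rw [← this]; congr 1; ext c
  simp only [Set.mem_ofPred_eq, Prod.forall, mem_product, Nb, adj, bb, mem_singleton]
  constructor
  · rintro H x y ⟨rfl, hy⟩
    have := H y hy
    by_cases hyN : y ∈ N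
    · simp only [hyN, if_true]; exact (this.1 hyN).2
    · simp only [hyN, if_false]; exact fun h' => hyN (this.2 ⟨fun he => ha (he ▸ hy), h'⟩)
  · intro H y hy
    have := H a y ⟨rfl, hy⟩
    by_cases hyN : y ∈ N
    · simp only [hyN, if_true] at this; exact ⟨fun _ => ⟨fun he => ha (he ▸ hy), this⟩, fun _ => hyN⟩
    · simp only [hyN, if_false] at this; exact ⟨fun h => absurd h hyN, fun h => absurd h.2 this⟩
lemma sum_pow_card (T : Finset V) (x y : ℝ) :
    ∑ N ∈ T.powerset, x ^ N.card * y ^ (T.card - N.card) = (x + y) ^ T.card :=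
  (sum_pow_mul_eq_add_pow x y T)
lemma exists_Nb (b : Sym2 V → Bool) (a : V) (T : Finset V) : ∃ N ∈ T.powerset, Nb b a T N := by
  classical
  exact ⟨T.filter (adj b a), by simp, fun y hy => by simp [hy]⟩
lemma Nb_unique {b : Sym2 V → Bool} {a : V} {T N N' : Finset V} (hN : N ⊆ T) (hN' : N' ⊆ T)
    (h : Nb b a T N) (h' : Nb b a T N') : N = N' := by
  ext y
  constructor
  · exact fun hy => (h' y (hN hy)).2 ((h y (hN hy)).1 hy)
  · exact fun hy => (h y (hN' hy)).2 ((h' y (hN' hy)).1 hy)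
lemma conn_step {b : Sym2 V → Bool} {A T N : Finset V} {a : V}
    (hN : Nb b a T N) (h : Conn b A T) : Conn b (A.erase a ∪ N) (T \ N) := by
  intro X hX hne
  obtain ⟨x, hx, y, hy, ha⟩ := h X (hX.trans sdiff_subset) hne
  have hxT := mem_sdiff.1 (hX hx)
  refine ⟨x, hx, y, ?_, ha⟩
  have : y ≠ a := by rintro rfl; exact hxT.2 ((hN x hxT.1).2 ha.symm)
  simp only [Finset.mem_union, Finset.mem_sdiff, Finset.mem_erase] at hy ⊢
  tauto
theorem pr_Conn_le : ∀ (m : ℕ) (A T : Finset V), Disjoint A T → A.card + T.card = m →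
    pr p {c | Conn (bb c) A T} ≤ (1 - (1 - p) ^ m) ^ T.card := by
  intro m
  induction m with
  | zero =>
    intro A T _ h
    have : T.card = 0 := by omega
    rw [this, pow_zero]; exact pr_le_one _
  | succ m ih =>
    intro A T hd h
    have hp0 := hp.out.1
    have hp1 := hp.out.2
    rcases A.eq_empty_or_nonempty with rfl | ⟨a, ha⟩
    · have : {c | Conn (bb c) ∅ T} = ∅ := by
        ext c
        simp only [Set.mem_ofPred_eq, Set.mem_empty_iff_false, iff_false]
        intro hc
        obtain ⟨x, hx, y, hy, _⟩ := hc T subset_rfl (Finset.card_pos.1 (by simp at h; omega))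
        simp at hy
      rw [this, pr, measureReal_empty]
      have : (1 - p) ^ (m + 1) ≤ 1 := pow_le_one₀ (by linarith) (by linarith)
      exact pow_nonneg (by linarith) _
    · have haT : a ∉ T := disjoint_left.1 hd ha
      have hsub : {c | Conn (bb c) A T} ⊆ ⋃ N ∈ T.powerset,
          ({c | Nb (bb c) a T N} ∩ {c | Conn (bb c) (A.erase a ∪ N) (T \ N)}) := by
        intro c hc
        obtain ⟨N, hN, hN'⟩ := exists_Nb (bb c) a T
        exact Set.mem_iUnion₂.2 ⟨N, hN, hN', conn_step hN' hc⟩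
      refine (pr_mono hsub).trans ((pr_biUnion_le _ _).trans ?_)
      have : ∀ N ∈ T.powerset, pr p ({c | Nb (bb c) a T N} ∩
          {c | Conn (bb c) (A.erase a ∪ N) (T \ N)}) ≤
          p ^ N.card * ((1 - p) * (1 - (1 - p) ^ m)) ^ (T.card - N.card) := by
        intro N hN
        rw [mem_powerset] at hN
        have hdisj : Disjoint (A.erase a ∪ N) (T \ N) := by
          rw [disjoint_left] at hd ⊢
          intro x hx
          simp only [Finset.mem_union, Finset.mem_sdiff, Finset.mem_erase] at hx ⊢
          have := @hd x
          tauto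
        rw [pr_indep (det_Nb a T N) (det_Conn _ _), pr_Nb haT hN, mul_pow, mul_assoc,
          ← card_sdiff_of_subset hN]
        · gcongr
          refine ih _ _ hdisj ?_
          rw [card_union_of_disjoint, card_erase_of_mem ha,
            card_sdiff_of_subset hN]
          · have := card_le_card hN
            have := card_pos.2 ⟨a, ha⟩
            omega
          · rw [disjoint_left] at hd ⊢
            exact fun x hx hx' => hd (mem_of_mem_erase hx) (hN hx')
        · apply EE_disj <;> intro x y hx hy hx' hy' <;> simp at hx hy hx' hy' <;> subst hx
          · exact absurd hx'.1 haT
          · have := hy'.1; tauto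
      refine (sum_le_sum this).trans ?_
      rw [sum_pow_card]
      apply le_of_eq; congr 1; ring
lemma det_Cl (A U T : Finset V) : Det (EE (A ∪ T) U ∪ EE T A) {c | Cl (bb c) A U T} := by
  by_cases hT : T ⊆ U
  · have : {c | Cl (bb c) A U T} =
        {c | Conn (bb c) A T} ∩ {c | NoE (bb c) (A ∪ T) (U \ T)} := by
      ext c; simp [Cl, hT]
    rw [this]
    refine ((det_Conn A T).mono ?_).inter (((det_NoE _ _)).mono ?_)
    · rintro e ⟨x, hx, y, hy, hn, rfl⟩
      rcases mem_union.1 hy with hy | hy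
      · exact Or.inr ⟨x, hx, y, hy, hn, rfl⟩
      · exact Or.inl ⟨x, mem_union_right _ hx, y, hT hy, hn, rfl⟩
    · exact (EE_mono subset_rfl sdiff_subset).trans Set.subset_union_left
  · have : {c | Cl (bb c) A U T} = ∅ := by ext c; simp [Cl, hT]
    rw [this]; exact ⟨MeasurableSet.empty, by simp⟩
lemma pr_Cl {A U T : Finset V} (hT : T ⊆ U) (hd : Disjoint A U) :
    pr p {c | Cl (bb c) A U T} =
      pr p {c | Conn (bb c) A T} * (1 - p) ^ ((A.card + T.card) * (U.card - T.card)) := by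
  have : {c | Cl (bb c) A U T} =
      {c | Conn (bb c) A T} ∩ {c | NoE (bb c) (A ∪ T) (U \ T)} := by
    ext c; simp [Cl, hT]
  have hAT : Disjoint A T := hd.mono_right hT
  rw [disjoint_left] at hd
  rw [this, pr_indep (det_Conn _ _) (det_NoE _ _), pr_NoE, card_union_of_disjoint hAT,
    card_sdiff_of_subset hT]
  · rw [disjoint_left]; intro x hx hx'; simp at hx hx'
    have := @hd x; have := @hT x; tauto
  · apply EE_disj <;> intro x y hx hy hx' hy' <;> simp at hx hy hx' hy' <;> exfalso
    · have := @hd y; tauto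
    · tauto
theorem cluster_le {A U : Finset V} (hd : Disjoint A U) (j : ℕ) {s : ℝ} (hs : 0 < s) :
    pr p {c | ∃ T, T.card = j ∧ Cl (bb c) A U T} * s ^ j ≤
      ((1 - p) ^ (A.card + j) + (1 - (1 - p) ^ (A.card + j)) * s) ^ U.card := by
  have hp0 := hp.out.1
  have hp1 := hp.out.2
  have h0 : 0 ≤ (1 - p) ^ (A.card + j) := pow_nonneg (by linarith) _
  have h1 : (1 - p) ^ (A.card + j) ≤ 1 := pow_le_one₀ (by linarith) (by linarith)
  have h2 : {c | ∃ T, T.card = j ∧ Cl (bb c) A U T} ⊆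
      ⋃ T ∈ U.powersetCard j, {c | Cl (bb c) A U T} := by
    rintro c ⟨T, hT, hc⟩
    exact Set.mem_iUnion₂.2 ⟨T, mem_powersetCard.2 ⟨hc.1, hT⟩, hc⟩
  have h3 := (pr_mono (p := p) h2).trans (pr_biUnion_le _ _)
  have h4 : ∀ T ∈ U.powersetCard j, pr p {c | Cl (bb c) A U T} ≤
      (1 - (1 - p) ^ (A.card + j)) ^ j * ((1 - p) ^ (A.card + j)) ^ (U.card - j) := by
    intro T hT
    obtain ⟨hT, hj⟩ := mem_powersetCard.1 hT
    rw [pr_Cl hT hd, pow_mul, hj]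
    gcongr
    exact (pr_Conn_le _ A T (hd.mono_right hT) rfl).trans (by rw [hj])
  have h5 := h3.trans (sum_le_sum h4)
  rw [sum_const, card_powersetCard, nsmul_eq_mul] at h5
  refine (mlr h5 (pow_nonneg hs.le j)).trans ?_
  set z := (1 - p) ^ (A.card + j)
  by_cases hj : j ≤ U.card
  · rw [add_comm z, add_pow]
    refine le_trans (le_of_eq ?_) (single_le_sum (f := fun i => ((1 - z) * s) ^ i * z ^ (U.card - i) * (U.card.choose i))
      (fun i _ => by have : 0 ≤ 1 - z := by linarith
                     positivity) (mem_range.2 (Nat.lt_succ_of_le hj)))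
    simp only [mul_pow]; ring
  · rw [Nat.choose_eq_zero_of_lt (by omega)]; simp
    have : 0 ≤ 1 - z := by linarith
    positivity
end
end
section
open Finset
lemma exp_chord {L x y : ℝ} (hx : 0 ≤ x) (hxy : x ≤ y) (hy : 0 < y) :
    x * (1 - exp (-(L * y))) ≤ y * (1 - exp (-(L * x))) := by
  have h := convexOn_exp.2 (Set.mem_univ 0) (Set.mem_univ (-(L * y))) 
    (show (0:ℝ) ≤ 1 - x / y by rw [sub_nonneg, div_le_one hy]; exact hxy) (show (0:ℝ) ≤ x / y by positivity) (by ring)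
  simp only [smul_eq_mul, mul_zero, zero_add, exp_zero, mul_one] at h
  have h1 : x / y * -(L * y) = -(L * x) := by field_simp
  rw [h1] at h
  have h2 := mll h hy.le
  have h3 : y * (1 - x / y + x / y * exp (-(L * y))) = y - x + x * exp (-(L * y)) := by
    field_simp
  linarith
lemma exp_chord_lt {L x y : ℝ} (hL : 0 < L) (hx : 0 < x) (hxy : x < y) :
    x * (1 - exp (-(L * y))) < y * (1 - exp (-(L * x))) := by
  have hy := hx.trans hxy
  have h := strictConvexOn_exp.2 (Set.mem_univ 0) (Set.mem_univ (-(L * y)))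
    (by have := mul_pos hL hy; linarith) 
    (show (0:ℝ) < 1 - x / y by rw [sub_pos, div_lt_one hy]; exact hxy) (show (0:ℝ) < x / y by positivity) (by ring)
  simp only [smul_eq_mul, mul_zero, zero_add, exp_zero, mul_one] at h
  have h1 : x / y * -(L * y) = -(L * x) := by field_simp
  rw [h1] at h
  have h2 := mul_lt_mul_of_pos_left h hy
  have h3 : y * (1 - x / y + x / y * exp (-(L * y))) = y - x + x * exp (-(L * y)) := by
    field_simp
  linarith
lemma one_sub_ge_exp {p : ℝ} (h : p < 1) : exp (-(p / (1 - p))) ≤ 1 - p := by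
  have h1 : (0 : ℝ) < 1 - p := by linarith
  have := add_one_le_exp (p / (1 - p))
  have h2 : p / (1 - p) + 1 = 1 / (1 - p) := by field_simp; ring
  rw [h2] at this
  rw [exp_neg, inv_le_comm₀ (exp_pos _) h1]
  simpa using this
lemma one_sub_pow_le {p : ℝ} (h : p ≤ 1) (k : ℕ) : (1 - p) ^ k ≤ exp (-(p * k)) := by
  have := one_sub_le_exp_neg p
  calc (1 - p) ^ k ≤ exp (-p) ^ k := by gcongr
    _ = _ := by rw [← exp_nat_mul]; ring_nf
lemma one_sub_pow_ge {p : ℝ} (h : p < 1) (k : ℕ) : exp (-(p / (1 - p) * k)) ≤ (1 - p) ^ k := by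
  calc _ = exp (-(p / (1 - p))) ^ k := by rw [← exp_nat_mul]; ring_nf
    _ ≤ _ := by gcongr; exact one_sub_ge_exp h
variable {V : Type} [Fintype V] [DecidableEq V]
section
variable {p : ℝ} [hp : Fact (0 ≤ p ∧ p ≤ 1)]
lemma cluster_low {A U : Finset V} (hd : Disjoint A U) (j k : ℕ) (hk : A.card + j = k) {c : ℝ}
    (hc : 0 < c) (hz : (1 + c) * k ≤ U.card * (1 - (1 - p) ^ k)) :
    pr p {c | ∃ T, T.card = j ∧ Cl (bb c) A U T} ≤ exp (-((c - log (1 + c)) * k)) := by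
  have hp0 := hp.out.1
  have hp1 := hp.out.2
  have h := cluster_le (p := p) hd j (s := 1 / (1 + c)) (by positivity)
  rw [hk] at h
  set z := 1 - (1 - p) ^ k with hzdef
  set Q := pr p {c | ∃ T, T.card = j ∧ Cl (bb c) A U T}
  have h1 : (1 - p) ^ k + z * (1 / (1 + c)) ≤ exp (-(z * (c / (1 + c)))) := by
    have := one_sub_le_exp_neg (z * (c / (1 + c)))
    refine le_trans (le_of_eq ?_) this
    rw [hzdef]; field_simp; ring
  have h0 : 0 ≤ (1 - p) ^ k + z * (1 / (1 + c)) := by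
    have : 0 ≤ (1 - p) ^ k := pow_nonneg (by linarith) _
    have : (1 - p) ^ k ≤ 1 := pow_le_one₀ (by linarith) (by linarith)
    have : 0 ≤ z := by rw [hzdef]; linarith
    positivity
  have h2 : Q * (1 / (1 + c)) ^ j ≤ exp (-(c * k)) := by
    refine h.trans ((pow_le_pow_left₀ h0 h1 _).trans ?_)
    rw [← exp_nat_mul]
    apply exp_le_exp.2
    have : (c / (1 + c)) * ((1 + c) * k) ≤ (c / (1 + c)) * (U.card * z) := by gcongr
    have h3 : (c / (1 + c)) * ((1 + c) * k) = c * k := by field_simp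
    linarith
  have h3 : Q ≤ (1 + c) ^ j * exp (-(c * k)) := by
    rw [one_div, inv_pow, ← div_eq_mul_inv, div_le_iff₀ (by positivity)] at h2
    linarith
  have h4 : (1 + c) ^ j ≤ exp (log (1 + c) * k) := by
    calc (1 + c) ^ j ≤ (1 + c) ^ k := by gcongr; linarith; omega
      _ = _ := by rw [mul_comm, exp_nat_mul, exp_log (by positivity)]
  calc Q ≤ _ := h3
    _ ≤ exp (log (1 + c) * k) * exp (-(c * k)) := by gcongr
    _ = _ := by rw [← exp_add]; ring_nf
lemma cluster_high {A U : Finset V} (hd : Disjoint A U) (j k : ℕ) (hk : A.card + j = k) {c : ℝ}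
    (hc : 0 < c) (hc1 : c < 1) (hz : U.card * (1 - (1 - p) ^ k) ≤ (1 - c) * k) :
    pr p {c | ∃ T, T.card = j ∧ Cl (bb c) A U T} ≤
      ((1 - c) ^ A.card)⁻¹ * exp (-((-log (1 - c) - c) * k)) := by
  have hp0 := hp.out.1
  have hp1 := hp.out.2
  have hc' : 0 < 1 - c := by linarith
  have h := cluster_le (p := p) hd j (s := 1 / (1 - c)) (by positivity)
  rw [hk] at h
  set z := 1 - (1 - p) ^ k with hzdef
  set Q := pr p {c | ∃ T, T.card = j ∧ Cl (bb c) A U T}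
  have h1 : (1 - p) ^ k + z * (1 / (1 - c)) ≤ exp (z * (c / (1 - c))) := by
    have := add_one_le_exp (z * (c / (1 - c)))
    refine le_trans (le_of_eq ?_) this
    rw [hzdef]; field_simp; ring
  have h0 : 0 ≤ (1 - p) ^ k + z * (1 / (1 - c)) := by
    have : 0 ≤ (1 - p) ^ k := pow_nonneg (by linarith) _
    have : (1 - p) ^ k ≤ 1 := pow_le_one₀ (by linarith) (by linarith)
    have : 0 ≤ z := by rw [hzdef]; linarith
    positivity
  have h2 : Q * (1 / (1 - c)) ^ j ≤ exp (c * k) := by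
    refine h.trans ((pow_le_pow_left₀ h0 h1 _).trans ?_)
    rw [← exp_nat_mul]
    apply exp_le_exp.2
    have : (c / (1 - c)) * (U.card * z) ≤ (c / (1 - c)) * ((1 - c) * k) := by gcongr
    have h3 : (c / (1 - c)) * ((1 - c) * k) = c * k := by field_simp
    linarith
  have h3 : Q ≤ (1 - c) ^ j * exp (c * k) := by
    rw [one_div, inv_pow, ← div_eq_mul_inv, div_le_iff₀ (by positivity)] at h2
    linarith
  have h4 : (1 - c) ^ j = ((1 - c) ^ A.card)⁻¹ * exp (log (1 - c) * k) := by
    rw [mul_comm (log _), exp_nat_mul, exp_log hc', ← hk, pow_add]; field_simp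
  calc Q ≤ _ := h3
    _ = ((1 - c) ^ A.card)⁻¹ * (exp (log (1 - c) * k) * exp (c * k)) := by rw [h4]; ring
    _ = _ := by rw [← exp_add]; ring_nf
end
def reachS {N : ℕ} (c : Cfg (Fin N)) (A : Finset (Fin N)) : Finset (Fin N) := by
  classical exact univ.filter fun v => ∃ a ∈ A, (theGraph c).Reachable a v
lemma mem_reachS {N : ℕ} {c : Cfg (Fin N)} {A : Finset (Fin N)} {v : Fin N} :
    v ∈ reachS c A ↔ ∃ a ∈ A, (theGraph c).Reachable a v := by
  classical
  simp [reachS]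
lemma sub_reachS {N : ℕ} {c : Cfg (Fin N)} {A : Finset (Fin N)} : A ⊆ reachS c A :=
  fun a ha => mem_reachS.2 ⟨a, ha, SimpleGraph.Reachable.refl a⟩
lemma adj_iff {N : ℕ} {c : Cfg (Fin N)} {x y : Fin N} : adj (bb c) x y ↔ (theGraph c).Adj x y := Iff.rfl
lemma cl_reachS {N : ℕ} (c : Cfg (Fin N)) (A : Finset (Fin N)) :
    Cl (bb c) A (univ \ A) (reachS c A \ A) := by
  refine ⟨sdiff_subset_sdiff (subset_univ _) subset_rfl, ?_, ?_⟩
  · rintro X hX ⟨x, hx⟩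
    obtain ⟨h1, h2⟩ := mem_sdiff.1 (hX hx)
    obtain ⟨a, ha, ⟨w⟩⟩ := mem_reachS.1 h1
    have haX : a ∉ X := fun h => (mem_sdiff.1 (hX h)).2 ha
    obtain ⟨d, hd, h3, h4⟩ := w.reverse.exists_boundary_dart (X : Set (Fin N)) hx haX
    refine ⟨d.fst, h3, d.snd, ?_, adj_iff.2 d.adj⟩
    obtain ⟨a', ha', hr⟩ := mem_reachS.1 (mem_sdiff.1 (hX h3)).1
    have : d.snd ∈ reachS c A := mem_reachS.2 ⟨a', ha', hr.trans d.adj.reachable⟩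
    simp only [Finset.mem_sdiff, Finset.mem_union]
    exact ⟨by tauto, h4⟩
  · intro x hx y hy ha
    have hx' : x ∈ reachS c A := by
      rcases mem_union.1 hx with h | h
      · exact sub_reachS h
      · exact (mem_sdiff.1 h).1
    simp only [Finset.mem_sdiff, Finset.mem_univ, true_and, not_and, not_not] at hy
    obtain ⟨a, h1, h2⟩ := mem_reachS.1 hx'
    have : y ∈ reachS c A := mem_reachS.2 ⟨a, h1, h2.trans (adj_iff.1 ha).reachable⟩
    exact hy.1 (hy.2 this)
lemma reachS_card_sub {N : ℕ} (A : Finset (Fin N)) (k j : ℕ) (hk : A.card + j = k) :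
    {c : Cfg (Fin N) | (reachS c A).card = k} ⊆
      {c | ∃ T, T.card = j ∧ Cl (bb c) A (univ \ A) T} := by
  intro c hc
  refine ⟨_, ?_, cl_reachS c A⟩
  have := card_sdiff_of_subset (sub_reachS (c := c) (A := A))
  have h : (reachS c A).card = k := hc
  omega
lemma supp_ncard {N : ℕ} (c : Cfg (Fin N)) (u : Fin N) :
    ((theGraph c).connectedComponentMk u).supp.ncard = (reachS c {u}).card := by
  rw [← Set.ncard_coe_finset]
  congr 1; ext v
  simp only [SimpleGraph.ConnectedComponent.mem_supp_iff, SimpleGraph.ConnectedComponent.eq,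
    mem_coe, mem_reachS, mem_singleton, exists_eq_left]
  exact ⟨fun h => h.symm, fun h => h.symm⟩
lemma reachS_pair {N : ℕ} {c : Cfg (Fin N)} {u v : Fin N} (h : ¬ (theGraph c).Reachable u v) :
    (reachS c {u, v}).card = (reachS c {u}).card + (reachS c {v}).card := by
  rw [← card_union_of_disjoint]
  · congr 1; ext x; simp [mem_reachS]
  · rw [disjoint_left]; intro x; simp only [mem_reachS, mem_singleton, exists_eq_left]
    exact fun h1 h2 => h (h1.trans h2.symm)
lemma p_tendsto {p : ℕ → ℝ} {lam : ℝ}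
    (hlim : Tendsto (fun n : ℕ => ((n : ℝ) + 2) * p n) atTop (nhds lam)) :
    Tendsto p atTop (nhds 0) := by
  have h : Tendsto (fun n : ℕ => ((n : ℝ) + 2)⁻¹) atTop (nhds 0) :=
    (tendsto_natCast_atTop_atTop.atTop_add tendsto_const_nhds).inv_tendsto_atTop
  have := h.mul hlim
  rw [zero_mul] at this
  refine this.congr fun n => ?_
  have : (n : ℝ) + 2 ≠ 0 := by positivity
  field_simp
lemma N_tendsto : Tendsto (fun n : ℕ => (n : ℝ) + 2) atTop atTop :=
  tendsto_natCast_atTop_atTop.atTop_add tendsto_const_nhds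
lemma zeta_fix {lam mu : ℝ} (hlam : 1 < lam)
    (hdual : mu * Real.exp (-mu) = lam * Real.exp (-lam)) : exp (-(lam * (1 - mu / lam))) = mu / lam := by
  have h0 : (0:ℝ) < lam := by linarith
  have : -(lam * (1 - mu / lam)) = -lam + mu := by field_simp; ring
  rw [this, exp_add, eq_div_iff h0.ne']
  have h2 : exp (-mu) * exp mu = 1 := by rw [← exp_add]; simp
  calc exp (-lam) * exp mu * lam = (lam * exp (-lam)) * exp mu := by ring
    _ = mu * (exp (-mu) * exp mu) := by rw [← hdual]; ring
    _ = mu := by rw [h2, mul_one]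
set_option maxHeartbeats 1000000 in
theorem unique_giant (p : ℕ → ℝ) [hp : ∀ n, Fact (0 ≤ p n ∧ p n ≤ 1)]
    (lam : ℝ) (hlam : 1 < lam)
    (hlim : Tendsto (fun n : ℕ => ((n : ℝ) + 2) * p n) atTop (nhds lam))
    (mu : ℝ) (hmu : mu ∈ Set.Ioo (0 : ℝ) 1)
    (hdual : mu * Real.exp (-mu) = lam * Real.exp (-lam)) (δ : ℝ) (hδ : 0 < δ) :
    Tendsto (fun n => pr (p n) {c : Cfg (Fin (n + 2)) | ∃ u v, ¬ (theGraph c).Reachable u v ∧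
      δ * ((n : ℝ) + 2) ≤ (reachS c {u}).card ∧ δ * ((n : ℝ) + 2) ≤ (reachS c {v}).card})
      atTop (nhds 0) := by
  have h0 : (0:ℝ) < lam := by linarith
  obtain ⟨ζ, hζ⟩ : ∃ ζ, ζ = 1 - mu / lam := ⟨_, rfl⟩
  have hζ0 : 0 < ζ := by rw [hζ, sub_pos, div_lt_one h0]; linarith [hmu.2]
  have hfix : 1 - exp (-(lam * ζ)) = ζ := by rw [hζ, zeta_fix hlam hdual]
  obtain ⟨x0, hx0⟩ : ∃ x0, x0 = 3 / 4 * ζ := ⟨_, rfl⟩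
  obtain ⟨x1, hx1⟩ : ∃ x1, x1 = 3 / 2 * ζ := ⟨_, rfl⟩
  have hx0p : 0 < x0 := by rw [hx0]; positivity
  have hx1p : 0 < x1 := by rw [hx1]; positivity
  have f0 : x0 < 1 - exp (-(lam * x0)) := by
    have := exp_chord_lt h0 hx0p (by linarith : x0 < ζ)
    rw [hfix] at this; nlinarith
  have f1 : 1 - exp (-(lam * x1)) < x1 := by
    have := exp_chord_lt h0 hζ0 (by linarith : ζ < x1)
    rw [hfix] at this; nlinarith
  obtain ⟨c, hc0, hc1, hcl, hcu⟩ : ∃ c : ℝ, 0 < c ∧ c < 1 ∧ (1 + c) * x0 < 1 - exp (-(lam * x0)) ∧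
      1 - exp (-(lam * x1)) < (1 - c) * x1 := by
    have t1 : ∀ᶠ c in nhdsWithin (0:ℝ) (Set.Ioi 0), (1 + c) * x0 < 1 - exp (-(lam * x0)) :=
      Filter.Eventually.filter_mono nhdsWithin_le_nhds
        (ContinuousAt.eventually_lt (by fun_prop) (by fun_prop) (by simpa using f0))
    have t2 : ∀ᶠ c in nhdsWithin (0:ℝ) (Set.Ioi 0), 1 - exp (-(lam * x1)) < (1 - c) * x1 :=
      Filter.Eventually.filter_mono nhdsWithin_le_nhds
        (ContinuousAt.eventually_lt (by fun_prop) (by fun_prop) (by simpa using f1))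
    have t3 : ∀ᶠ c in nhdsWithin (0:ℝ) (Set.Ioi 0), c < 1 :=
      Filter.Eventually.filter_mono nhdsWithin_le_nhds
        (ContinuousAt.eventually_lt (by fun_prop) (by fun_prop) (by simp))
    obtain ⟨c, hc⟩ := (t1.and (t2.and (t3.and self_mem_nhdsWithin))).exists
    exact ⟨c, hc.2.2.2, hc.2.2.1, hc.1, hc.2.1⟩
  have hpt := p_tendsto hlim
  have e0 : ∀ᶠ n in atTop, p n < 1 := hpt.eventually_lt_const (by norm_num)
  have e1 : ∀ᶠ n : ℕ in atTop, (1 + c) * x0 <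
      (1 - exp (-((((n:ℝ) + 2) * p n) * x0))) * (1 - ((n:ℝ) + 2)⁻¹) := by
    have : Tendsto (fun n : ℕ => (1 - exp (-((((n:ℝ) + 2) * p n) * x0))) * (1 - ((n:ℝ) + 2)⁻¹))
        atTop (nhds ((1 - exp (-(lam * x0))) * (1 - 0))) :=
      ((tendsto_const_nhds.sub ((continuous_exp.tendsto _).comp (hlim.mul_const x0).neg))).mul
        (tendsto_const_nhds.sub N_tendsto.inv_tendsto_atTop)
    exact this.eventually_const_lt (by simpa using hcl)
  have e2 : ∀ᶠ n : ℕ in atTop, 1 - exp (-((((n:ℝ) + 2) * p n / (1 - p n)) * x1)) < (1 - c) * x1 := by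
    have h1 : Tendsto (fun n : ℕ => ((n:ℝ) + 2) * p n / (1 - p n)) atTop (nhds (lam / (1 - 0))) :=
      hlim.div (tendsto_const_nhds.sub hpt) (by norm_num)
    rw [sub_zero, div_one] at h1
    have : Tendsto (fun n : ℕ => (1 - exp (-((((n:ℝ) + 2) * p n / (1 - p n)) * x1))))
        atTop (nhds ((1 - exp (-(lam * x1))))) :=
      (tendsto_const_nhds.sub ((continuous_exp.tendsto _).comp (h1.mul_const x1).neg))
    exact this.eventually_lt_const hcu
  obtain ⟨a1, ha1⟩ : ∃ a1, a1 = c - log (1 + c) := ⟨_, rfl⟩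
  obtain ⟨a2, ha2⟩ : ∃ a2, a2 = -log (1 - c) - c := ⟨_, rfl⟩
  have ha1p : 0 < a1 := by
    have := log_lt_sub_one_of_pos (by linarith : 0 < 1 + c) (by linarith); rw [ha1]; linarith
  have ha2p : 0 < a2 := by
    have := log_lt_sub_one_of_pos (by linarith : 0 < 1 - c) (by linarith); rw [ha2]; linarith
  obtain ⟨a, ha0, haa1, haa2⟩ : ∃ a, 0 < a ∧ a ≤ a1 * δ ∧ a ≤ a2 * x1 :=
    ⟨min (a1 * δ) (a2 * x1), by positivity, min_le_left _ _, min_le_right _ _⟩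
  obtain ⟨D, hD⟩ : ∃ D, D = 1 + ((1 - c) ^ 2)⁻¹ := ⟨_, rfl⟩
  have hDp : 1 ≤ D := by rw [hD]; have : 0 < ((1 - c) ^ 2)⁻¹ := by
                           have : 0 < 1 - c := by linarith
                           positivity
                         linarith
  have hlimit : Tendsto (fun n : ℕ => 2 * D * (2 * ((n:ℝ) + 2)) ^ 3 * exp (-(a * ((n:ℝ) + 2))))
      atTop (nhds 0) := by
    have h1 := (tendsto_pow_mul_exp_neg_atTop_nhds_zero 3).comp (N_tendsto.const_mul_atTop ha0)
    have h2 := h1.const_mul (16 * D / a ^ 3)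
    rw [mul_zero] at h2
    refine h2.congr fun n => ?_
    simp only [Function.comp]
    field_simp; ring
  refine squeeze_zero' (Eventually.of_forall fun n => pr_nonneg _) ?_ hlimit
  filter_upwards [e0, e1, e2] with n h3 h4 h5
  have hN : (0:ℝ) < (n:ℝ) + 2 := by positivity
  have hpn := (hp n).out
  have hlow : ∀ (u : Fin (n+2)) (k : ℕ), δ * ((n:ℝ)+2) ≤ k → (k:ℝ) ≤ x0 * ((n:ℝ)+2) →
      pr (p n) {c : Cfg (Fin (n+2)) | (reachS c {u}).card = k} ≤ exp (-(a * ((n:ℝ)+2))) := by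
    intro u k hk1 hk2
    have hk : 1 ≤ k := by
      have : (0:ℝ) < k := lt_of_lt_of_le (by positivity) hk1
      exact_mod_cast this
    refine (pr_mono (reachS_card_sub {u} k (k - 1) (by simp; omega))).trans ?_
    refine (cluster_low (disjoint_sdiff) (k-1) k (by simp; omega) hc0 ?_).trans ?_
    · rw [card_sdiff_of_subset (subset_univ _)]
      simp only [card_univ, Fintype.card_fin, card_singleton]
      have hpk := one_sub_pow_le hpn.2 k
      have hch := exp_chord (L := ((n:ℝ)+2) * p n) (x := k / ((n:ℝ)+2)) (y := x0) (by positivity)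
        (by rw [div_le_iff₀ hN]; exact hk2) hx0p
      have hL : ((n:ℝ)+2) * p n * (k / ((n:ℝ)+2)) = p n * k := by field_simp
      rw [hL] at hch
      have hcast : ((n + 2 - 1 : ℕ) : ℝ) = (n:ℝ) + 1 := by
        rw [show n + 2 - 1 = n + 1 by omega]; push_cast; ring
      rw [hcast]
      have h6 : ((n:ℝ)+1) * (1 - exp (-(p n * k))) ≤ ((n:ℝ)+1) * (1 - (1 - p n) ^ k) := by gcongr
      refine le_trans ?_ h6
      have h7 : ((1 + c) * x0) * k ≤ (1 - exp (-((((n:ℝ) + 2) * p n) * x0))) * (1 - ((n:ℝ) + 2)⁻¹) * k := by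
        gcongr
      have h8 : (1 - exp (-((((n:ℝ) + 2) * p n) * x0))) * (1 - ((n:ℝ) + 2)⁻¹) * k
        = (k / ((n:ℝ)+2) * (1 - exp (-(((n:ℝ)+2) * p n * x0)))) * (n + 1) := by
        field_simp; ring
      have h9 := mlr hch (by positivity : (0:ℝ) ≤ (n:ℝ) + 1)
      rw [h8] at h7
      have h10 : x0 * ((1 + c) * k) ≤ x0 * (((n:ℝ)+1) * (1 - exp (-(p n * k)))) := by linarith
      exact le_of_mul_le_mul_left h10 hx0p
    · rw [← ha1]; apply exp_le_exp.2; apply neg_le_neg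
      calc a * ((n:ℝ)+2) ≤ a1 * δ * ((n:ℝ)+2) := by gcongr
        _ = a1 * (δ * ((n:ℝ)+2)) := by ring
        _ ≤ _ := by gcongr
  have hhigh : ∀ (u v : Fin (n+2)) (k : ℕ), u ≠ v → x1 * ((n:ℝ)+2) ≤ k → 2 ≤ k →
      pr (p n) {c : Cfg (Fin (n+2)) | (reachS c {u, v}).card = k} ≤ D * exp (-(a * ((n:ℝ)+2))) := by
    intro u v k huv hk1 hk
    refine (pr_mono (reachS_card_sub {u, v} k (k - 2) (by rw [card_pair huv]; omega))).trans ?_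
    refine (cluster_high (disjoint_sdiff) (k-2) k (by rw [card_pair huv]; omega) hc0 hc1 ?_).trans ?_
    · have hpk := one_sub_pow_ge h3 k
      have hch := exp_chord (L := ((n:ℝ)+2) * p n / (1 - p n)) (x := x1) (y := k / ((n:ℝ)+2)) hx1p.le
        (by rw [le_div_iff₀ hN]; exact hk1) (by positivity)
      have h1p : 1 - p n ≠ 0 := by linarith
      have hL : ((n:ℝ)+2) * p n / (1 - p n) * (k / ((n:ℝ)+2)) = p n / (1 - p n) * k := by field_simp
      rw [hL] at hch
      have hz0 : 0 ≤ 1 - (1 - p n) ^ k := by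
        rw [sub_nonneg]; exact pow_le_one₀ (by linarith) (by linarith)
      have hcard : ((univ \ ({u, v} : Finset (Fin (n+2)))).card : ℝ) ≤ (n:ℝ) + 2 := by
        have := card_le_univ (univ \ ({u, v} : Finset (Fin (n+2))))
        simp only [Fintype.card_fin] at this
        exact_mod_cast this
      have h6 : (k:ℝ) / ((n:ℝ)+2) * (1 - exp (-(((n:ℝ) + 2) * p n / (1 - p n) * x1))) ≤ k / ((n:ℝ)+2) * ((1 - c) * x1) := by
        gcongr
      have h7 : x1 * (1 - (1 - p n) ^ k) ≤ x1 * (1 - exp (-(p n / (1 - p n) * k))) := by gcongr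
      have h8 : (1 - (1 - p n) ^ k) ≤ k / ((n:ℝ)+2) * (1 - c) :=
        le_of_mul_le_mul_left (by linarith : x1 * (1 - (1 - p n) ^ k) ≤ x1 * (k / ((n:ℝ)+2) * (1 - c))) hx1p
      calc _ ≤ ((n:ℝ)+2) * (k / ((n:ℝ)+2) * (1 - c)) := by gcongr
        _ = _ := by field_simp
    · rw [← ha2, card_pair huv]
      have : exp (-(a2 * k)) ≤ exp (-(a * ((n:ℝ)+2))) := by
        apply exp_le_exp.2; apply neg_le_neg
        calc a * ((n:ℝ)+2) ≤ a2 * x1 * ((n:ℝ)+2) := by gcongr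
          _ = a2 * (x1 * ((n:ℝ)+2)) := by ring
          _ ≤ _ := by gcongr
      gcongr
      rw [hD]; linarith
  classical
  let I1 := (univ : Finset (Fin (n+2))) ×ˢ (range (n + 3)).filter
    (fun k : ℕ => δ * ((n:ℝ)+2) ≤ (k:ℝ) ∧ (k:ℝ) ≤ x0 * ((n:ℝ)+2))
  let I2 := (univ.filter fun d : Fin (n+2) × Fin (n+2) => d.1 ≠ d.2) ×ˢ (range (n + 3)).filter
    (fun k : ℕ => x1 * ((n:ℝ)+2) ≤ (k:ℝ) ∧ 2 ≤ k)
  have hsub : {c : Cfg (Fin (n + 2)) | ∃ u v, ¬ (theGraph c).Reachable u v ∧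
      δ * ((n : ℝ) + 2) ≤ (reachS c {u}).card ∧ δ * ((n : ℝ) + 2) ≤ (reachS c {v}).card} ⊆
      (⋃ i ∈ I1, {c | (reachS c {i.1}).card = i.2}) ∪
      (⋃ i ∈ I2, {c | (reachS c {i.1.1, i.1.2}).card = i.2}) := by
    rintro c ⟨u, v, hr, hu, hv⟩
    have hcard : ∀ A, (reachS c A).card < n + 3 := fun A => by
      have := card_le_univ (reachS c A)
      simp only [Fintype.card_fin] at this; omega
    by_cases hu' : ((reachS c {u}).card : ℝ) ≤ x0 * ((n:ℝ)+2)
    · exact Or.inl (Set.mem_iUnion₂.2 ⟨(u, (reachS c {u}).card), by simp [I1, hcard, hu, hu'], rfl⟩)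
    by_cases hv' : ((reachS c {v}).card : ℝ) ≤ x0 * ((n:ℝ)+2)
    · exact Or.inl (Set.mem_iUnion₂.2 ⟨(v, (reachS c {v}).card), by simp [I1, hcard, hv, hv'], rfl⟩)
    have huv : u ≠ v := by rintro rfl; exact hr (SimpleGraph.Reachable.refl u)
    have h2 : 2 ≤ (reachS c {u, v}).card := by
      have := card_le_card (sub_reachS (c := c) (A := {u, v})); rwa [card_pair huv] at this
    refine Or.inr (Set.mem_iUnion₂.2 ⟨((u, v), (reachS c {u, v}).card), ?_, rfl⟩)
    simp only [I2, mem_product, mem_filter, mem_univ, true_and, ne_eq, huv,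
      not_false_eq_true, mem_range, hcard, h2, and_true]
    rw [reachS_pair hr]; push_cast
    push Not at hu' hv'
    have : x1 = 2 * x0 := by rw [hx0, hx1]; ring
    rw [this]; linarith
  refine (pr_mono hsub).trans ((pr_union_le _ _).trans ?_)
  obtain ⟨X, hX⟩ : ∃ X, X = exp (-(a * ((n:ℝ)+2))) := ⟨_, rfl⟩
  rw [← hX] at hlow hhigh ⊢
  have hXp : 0 ≤ X := by rw [hX]; positivity
  have b1 : pr (p n) (⋃ i ∈ I1, {c : Cfg (Fin (n+2)) | (reachS c {i.1}).card = i.2}) ≤ I1.card * X := by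
    refine (pr_biUnion_le _ _).trans ?_
    rw [← nsmul_eq_mul]
    refine sum_le_card_nsmul _ _ _ fun i hi => ?_
    simp only [I1, mem_product, mem_filter] at hi
    exact hlow _ _ hi.2.2.1 hi.2.2.2
  have b2 : pr (p n) (⋃ i ∈ I2, {c : Cfg (Fin (n+2)) | (reachS c {i.1.1, i.1.2}).card = i.2}) ≤ I2.card * (D * X) := by
    refine (pr_biUnion_le _ _).trans ?_
    rw [← nsmul_eq_mul]
    refine sum_le_card_nsmul _ _ _ fun i hi => ?_
    simp only [I2, mem_product, mem_filter] at hi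
    exact hhigh _ _ _ hi.1.2 hi.2.2.1 hi.2.2.2
  have c1 : (I1.card : ℝ) ≤ (2 * ((n:ℝ)+2))^3 := by
    have : I1.card ≤ (2 * (n + 2)) ^ 3 := by
      rw [card_product, pow_succ, sq]
      refine Nat.mul_le_mul ?_ ((card_filter_le _ _).trans (by simp; omega))
      simp only [card_univ, Fintype.card_fin]
      exact (show n + 2 ≤ 2 * (n + 2) * 1 by omega).trans (by gcongr; omega)
    exact_mod_cast this
  have c2 : (I2.card : ℝ) ≤ (2 * ((n:ℝ)+2))^3 := by
    have : I2.card ≤ (2 * (n + 2)) ^ 3 := by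
      rw [card_product, pow_succ, sq]
      refine Nat.mul_le_mul ((card_filter_le _ _).trans ?_) ((card_filter_le _ _).trans (by simp; omega))
      simp only [card_univ, Fintype.card_prod, Fintype.card_fin]
      gcongr <;> omega
    exact_mod_cast this
  have d1 : (I1.card : ℝ) * X ≤ (2 * ((n:ℝ)+2))^3 * (D * X) := by
    gcongr; exact le_mul_of_one_le_left hXp hDp
  have d2 : (I2.card : ℝ) * (D * X) ≤ (2 * ((n:ℝ)+2))^3 * (D * X) := by gcongr
  linarith
end
section
open Finset
variable {V : Type} [Fintype V] [DecidableEq V]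
lemma EE_comm (A B : Finset V) : EE A B = EE B A := by
  ext e; constructor <;> rintro ⟨x, hx, y, hy, hn, rfl⟩ <;>
    exact ⟨y, hy, x, hx, hn.symm, Sym2.eq_swap⟩
def Peel (b : Sym2 V → Bool) (M : ℕ) : List V → Finset V → Prop
  | [], _ => True
  | v :: vs, U => ∃ T, T ⊆ U ∧ T.card ≤ M ∧ Cl b {v} U T ∧ NoE b T vs.toFinset ∧ Peel b M vs (U \ T)
lemma Det.ofEmpty {T : Set (Sym2 V)} : Det T (∅ : Set (Cfg V)) := ⟨MeasurableSet.empty, by simp⟩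
lemma Det.univ' {T : Set (Sym2 V)} : Det T (Set.univ : Set (Cfg V)) := ⟨MeasurableSet.univ, by simp⟩
lemma Det.biUnion {ι : Type*} (s : Finset ι) {T : Set (Sym2 V)} {A : ι → Set (Cfg V)}
    (h : ∀ i ∈ s, Det T (A i)) : Det T (⋃ i ∈ s, A i) :=
  ⟨s.measurableSet_biUnion fun i hi => (h i hi).1, fun c c' hc hA => by
    obtain ⟨i, hi, hi'⟩ := Set.mem_iUnion₂.1 hA
    exact Set.mem_iUnion₂.2 ⟨i, hi, (h i hi).2 c c' hc hi'⟩⟩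
lemma peel_eq (M : ℕ) (v : V) (vs : List V) (U : Finset V) :
    {c | Peel (bb c) M (v :: vs) U} = ⋃ T ∈ U.powerset.filter (fun T => T.card ≤ M),
      ({c | Cl (bb c) {v} U T} ∩ ({c | NoE (bb c) T vs.toFinset} ∩ {c | Peel (bb c) M vs (U \ T)})) := by
  ext c
  simp only [Peel, Set.mem_ofPred_eq, Set.mem_iUnion, mem_filter, mem_powerset,
    Set.mem_inter_iff, exists_prop]
  exact ⟨fun ⟨T, h1, h2, h3⟩ => ⟨T, ⟨h1, h2⟩, h3⟩, fun ⟨T, ⟨h1, h2⟩, h3⟩ => ⟨T, h1, h2, h3⟩⟩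
lemma det_Peel (M : ℕ) : ∀ (vs : List V) (U : Finset V),
    Det (EE (vs.toFinset ∪ U) U) {c | Peel (bb c) M vs U}
  | [], U => by simp only [Peel]; exact Det.univ'
  | v :: vs, U => by
    rw [peel_eq]
    refine Det.biUnion _ fun T hT => ?_
    have hT := mem_powerset.1 (mem_filter.1 hT).1
    refine ((det_Cl {v} U T).mono ?_).inter (((det_NoE _ _).mono ?_).inter ((det_Peel M vs _).mono ?_))
    · refine Set.union_subset (EE_mono ?_ subset_rfl) ?_
      · exact union_subset_union (by simp) hT
      · rw [EE_comm]; exact EE_mono (by simp) hT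
    · rw [EE_comm]
      exact EE_mono (by intro x hx; simp at hx ⊢; tauto) hT
    · refine EE_mono ?_ sdiff_subset
      intro x hx; simp at hx ⊢; tauto
section
variable {p : ℝ} [hp : Fact (0 ≤ p ∧ p ≤ 1)]
lemma pr_small_eq (M : ℕ) (v : V) (U : Finset V) :
    pr p {c | ∃ T, T.card ≤ M ∧ Cl (bb c) {v} U T} =
      ∑ T ∈ U.powerset.filter (fun T => T.card ≤ M), pr p {c | Cl (bb c) {v} U T} := by
  rw [← pr_biUnion]
  · congr 1; ext c
    simp only [Set.mem_ofPred_eq, Set.mem_iUnion, mem_filter, mem_powerset, exists_prop]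
    exact ⟨fun ⟨T, h1, h2⟩ => ⟨T, ⟨h2.1, h1⟩, h2⟩, fun ⟨T, ⟨h1, h2⟩, h3⟩ => ⟨T, h2, h3⟩⟩
  · exact fun T _ => (det_Cl _ _ _).1
  · intro T _ T' _ hne
    exact Set.disjoint_left.2 fun c h h' => hne (cl_unique h h')
lemma pr_Peel (M : ℕ) {x : ℝ} (hx0 : 0 ≤ x)
    (hx : ∀ (U : Finset V) (v : V), v ∉ U → x ≤ pr p {c | ∃ T, T.card ≤ M ∧ Cl (bb c) {v} U T}) :
    ∀ (L : ℕ) (vs : List V) (U : Finset V), vs.length ≤ L → vs.Nodup → Disjoint vs.toFinset U →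
      (x * (1 - p) ^ (M * L)) ^ vs.length ≤ pr p {c | Peel (bb c) M vs U}
  | L, [], U, _, _, _ => by simp [Peel, pr]
  | L, v :: vs, U, hL, hnd, hd => by
    have hp0 := hp.out.1
    have hp1 : 0 ≤ 1 - p := by linarith [hp.out.2]
    rw [List.nodup_cons] at hnd
    rw [disjoint_left] at hd
    have hvU : v ∉ U := hd (by simp)
    have hvs : ∀ y ∈ vs, y ∉ U := fun y hy => hd (by simp [hy])
    have hlen : vs.length + 1 ≤ L := by simpa using hL
    rw [peel_eq, pr_biUnion]
    · have : ∀ T ∈ U.powerset.filter (fun T => T.card ≤ M),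
          pr p {c | Cl (bb c) {v} U T} * ((1 - p) ^ (M * L) * (x * (1 - p) ^ (M * L)) ^ vs.length) ≤
          pr p ({c | Cl (bb c) {v} U T} ∩ ({c | NoE (bb c) T vs.toFinset} ∩ {c | Peel (bb c) M vs (U \ T)})) := by
        intro T hT
        obtain ⟨hTU, hTM⟩ := mem_filter.1 hT
        rw [mem_powerset] at hTU
        have hdT : Disjoint T vs.toFinset := by
          rw [disjoint_left]; intro y hy hy'; exact hvs y (by simpa using hy') (hTU hy)
        rw [pr_indep (det_Cl _ _ _) ((det_NoE _ _).inter2 (det_Peel _ _ _)),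
          pr_indep (det_NoE _ _) (det_Peel _ _ _), pr_NoE hdT]
        · refine mll (mul_le_mul ?_ ?_ (by positivity) (by positivity)) (pr_nonneg _)
          · refine pow_le_pow_of_le_one hp1 (by linarith) (Nat.mul_le_mul hTM ?_)
            exact (List.toFinset_card_le vs).trans (by omega)
          · refine pr_Peel M hx0 hx L vs _ (by omega) hnd.2 ?_
            rw [disjoint_left]
            intro y hy hy'; exact hvs y (by simpa using hy) (sdiff_subset hy')
        · apply EE_disj <;> intro a b ha hb ha' hb' <;> exfalso <;> simp at ha hb ha' hb'
          · exact hvs b hb hb'.1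
          · tauto
        · rw [Set.disjoint_union_left, Set.disjoint_union_right, Set.disjoint_union_right]
          refine ⟨⟨?_, ?_⟩, ?_, ?_⟩ <;> apply EE_disj <;> intro a b ha hb ha' hb' <;> exfalso <;>
            simp at ha hb ha' hb'
          · exact hvs b hb' hb
          · rcases ha with rfl | ha
            · exact hnd.1 ha'
            · exact hvs a ha' (hTU ha)
          · rcases ha with rfl | ha
            · rcases ha' with h | h
              · exact hnd.1 h
              · exact hvU h.1
            · tauto
          · rcases ha with rfl | ha
            · exact hvU ha'.1
            · tauto
          · subst hb; exact hnd.1 hb'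
          · subst hb; exact hvU (hTU hb')
          · tauto
          · tauto
      refine le_trans ?_ (sum_le_sum this)
      rw [← sum_mul, ← pr_small_eq, List.length_cons, pow_succ']
      rw [mul_assoc x]
      exact mlr (hx U v hvU) (by positivity)
    · intro T _
      exact (det_Cl _ _ _).1.inter ((det_NoE _ _).1.inter (det_Peel _ _ _).1)
    · intro T _ T' _ hne
      exact Set.disjoint_left.2 fun c h h' => hne (cl_unique h.1 h'.1)
end
lemma peel_out {b : Sym2 V → Bool} {M : ℕ} : ∀ {vs : List V} {U : Finset V}, vs.Nodup →
    Disjoint vs.toFinset U → Peel b M vs U →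
    ∃ T, T.card ≤ M * vs.length ∧ Cl b vs.toFinset U T ∧ ∃ lv : V → ℕ,
      (∀ i (hi : i < vs.length), lv vs[i] = i) ∧
      ∀ x ∈ vs.toFinset ∪ T, ∀ y ∈ vs.toFinset ∪ T, adj b x y → lv x ≠ lv y → x ∈ vs ∧ y ∈ vs
  | [], U, _, _, _ => ⟨∅, by simp, ⟨by simp, by intro X hX hne; simp at hX; simp [hX] at hne, by simp [NoE]⟩,
      fun _ => 0, by simp, by simp⟩
  | v :: vs, U, hnd, hd, ⟨T1, hT1, hM, hcl, hno, hpeel⟩ => by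
    classical
    rw [List.nodup_cons] at hnd
    rw [disjoint_left] at hd
    have hvU : v ∉ U := hd (by simp)
    have hvs : ∀ y ∈ vs, y ∉ U := fun y hy => hd (by simp [hy])
    obtain ⟨T', hT'c, hT', lv, hlv1, hlv2⟩ := peel_out hnd.2 (by
      rw [disjoint_left]
      intro y hy hy'; exact hvs y (by simpa using hy) (Finset.sdiff_subset hy')) hpeel
    have hT'U : ∀ x ∈ T', x ∈ U ∧ x ∉ T1 := fun x hx => by simpa using hT'.1 hx
    refine ⟨T1 ∪ T', ?_, ⟨?_, ?_, ?_⟩, fun x => if x = v ∨ x ∈ T1 then 0 else lv x + 1, ?_, ?_⟩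
    · refine (card_union_le _ _).trans ?_
      rw [List.length_cons, mul_add, mul_one]; omega
    · exact union_subset hT1 (hT'.1.trans sdiff_subset)
    · intro X hX hne
      by_cases h : (X ∩ T1).Nonempty
      · obtain ⟨x, hx, y, hy, ha⟩ := hcl.2.1 (X ∩ T1) inter_subset_right h
        refine ⟨x, (mem_inter.1 hx).1, y, ?_, ha⟩
        simp only [Finset.mem_sdiff, Finset.mem_union, Finset.mem_singleton, Finset.mem_inter,
          List.mem_toFinset, List.mem_cons] at hy ⊢
        rcases hy with ⟨rfl | hy, hy'⟩
        · refine ⟨by tauto, fun hX' => hvU ?_⟩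
          rcases mem_union.1 (hX hX') with h | h
          · exact hT1 h
          · exact (hT'U _ h).1
        · tauto
      · have hXT : X ⊆ T' := by
          intro x hx
          rcases mem_union.1 (hX hx) with h' | h'
          · exact absurd ⟨x, mem_inter.2 ⟨hx, h'⟩⟩ h
          · exact h'
        obtain ⟨x, hx, y, hy, ha⟩ := hT'.2.1 X hXT hne
        refine ⟨x, hx, y, ?_, ha⟩
        simp only [Finset.mem_sdiff, Finset.mem_union, List.mem_toFinset, List.mem_cons] at hy ⊢
        tauto
    · intro x hx y hy ha
      simp only [Finset.mem_sdiff, Finset.mem_union, List.mem_toFinset, List.mem_cons, not_or] at hx hy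
      have h1 := fun h => hcl.2.2 x h y (by simp; tauto) ha
      have h2 := fun h => hT'.2.2 x h y (by simp; tauto) ha
      simp only [Finset.mem_union, Finset.mem_singleton, List.mem_toFinset, imp_false, not_or] at h1 h2
      tauto
    · intro i hi
      cases i with
      | zero => simp
      | succ i =>
        have hi' : i < vs.length := by simpa using hi
        have h1 : vs[i] ≠ v := fun h => hnd.1 (h ▸ List.getElem_mem _)
        have h2 : vs[i] ∉ T1 := fun h => hvs _ (List.getElem_mem hi') (hT1 h)
        simp [h1, h2, hlv1 i hi']
    · have key : ∀ x y, (x = v ∨ x ∈ T1) → ¬ (y = v ∨ y ∈ T1) → (y ∈ vs ∨ y ∈ T') → adj b x y →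
          x = v ∧ y ∈ vs := by
        intro x y hx hy hy' ha
        rcases hy' with hy' | hy'
        · rcases hx with rfl | hx
          · exact ⟨rfl, hy'⟩
          · exact absurd ha (hno x hx y (by simpa using hy'))
        · exact absurd ha (hcl.2.2 x (by simpa using hx) y (by simpa using hT'U y hy'))
      intro x hx y hy ha hne
      simp only [Finset.mem_union, List.mem_toFinset, List.mem_cons] at hx hy ⊢
      by_cases h1 : x = v ∨ x ∈ T1 <;> by_cases h2 : y = v ∨ y ∈ T1
      · simp [h1, h2] at hne
      · have := key x y h1 h2 (by tauto) ha; tauto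
      · have := key y x h2 h1 (by tauto) ha.symm; tauto
      · simp only [h1, h2, if_false] at hne
        have := hlv2 x (by simp; tauto) y (by simp; tauto) ha (by omega)
        tauto
lemma cl_of_nb {b : Sym2 V → Bool} {v : V} {U N T : Finset V} (hv : v ∉ U) (hN : N ⊆ U)
    (hb : Nb b v U N) (h : Cl b N (U \ N) T) : Cl b {v} U (N ∪ T) := by
  have hTU : ∀ x ∈ T, x ∈ U ∧ x ∉ N := fun x hx => by simpa using h.1 hx
  refine ⟨union_subset hN (h.1.trans sdiff_subset), ?_, ?_⟩
  · intro X hX hne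
    by_cases hXN : (X ∩ N).Nonempty
    · obtain ⟨x, hx⟩ := hXN
      rw [mem_inter] at hx
      refine ⟨x, hx.1, v, ?_, ((hb x (hN hx.2)).1 hx.2).symm⟩
      simp only [Finset.mem_sdiff, Finset.mem_union, Finset.mem_singleton, true_or, true_and]
      intro h'
      rcases mem_union.1 (hX h') with h'' | h''
      · exact hv (hN h'')
      · exact hv (hTU v h'').1
    · have hXT : X ⊆ T := by
        intro x hx
        rcases mem_union.1 (hX hx) with h' | h'
        · exact absurd ⟨x, mem_inter.2 ⟨hx, h'⟩⟩ hXN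
        · exact h'
      obtain ⟨x, hx, y, hy, ha⟩ := h.2.1 X hXT hne
      refine ⟨x, hx, y, ?_, ha⟩
      simp only [Finset.mem_sdiff, Finset.mem_union, Finset.mem_singleton] at hy ⊢
      tauto
  · intro x hx y hy ha
    simp only [Finset.mem_sdiff, Finset.mem_union, Finset.mem_singleton, not_or] at hx hy
    rcases hx with rfl | hx
    · exact hy.2.1 ((hb y hy.1).2 ha)
    · exact h.2.2 x (by simpa using hx) y (by simp; tauto) ha
section
variable {p : ℝ} [hp : Fact (0 ≤ p ∧ p ≤ 1)]
lemma small_step (M R : ℕ) {x : ℝ} (hx0 : 0 ≤ x) (hx1 : x ≤ 1)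
    (hx : ∀ (U : Finset V) (v : V), v ∉ U → x ≤ pr p {c | ∃ T, T.card ≤ M ∧ Cl (bb c) {v} U T})
    (U : Finset V) (v : V) (hv : v ∉ U) :
    (1 - p + p * (x * (1 - p) ^ (M * R))) ^ U.card - (1 / 2) ^ R * (1 + p) ^ U.card ≤
      pr p {c | ∃ T, T.card ≤ R + M * R ∧ Cl (bb c) {v} U T} := by
  have hp0 := hp.out.1
  have hp1 : 0 ≤ 1 - p := by linarith [hp.out.2]
  set x' := x * (1 - p) ^ (M * R) with hx'
  have hx'0 : 0 ≤ x' := by positivity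
  have hx'1 : x' ≤ 1 := mul_le_one₀ hx1 (by positivity) (pow_le_one₀ hp1 (by linarith))
  have h1 : ∑ N ∈ U.powerset.filter (fun N => N.card ≤ R),
      pr p ({c | Nb (bb c) v U N} ∩ {c | Peel (bb c) M N.toList (U \ N)}) ≤
      pr p {c | ∃ T, T.card ≤ R + M * R ∧ Cl (bb c) {v} U T} := by
    apply sum_pr_le
    · exact fun N _ => (det_Nb _ _ _).1.inter (det_Peel _ _ _).1
    · intro N hN N' hN' hne
      simp only [Finset.coe_filter, Finset.mem_powerset, Set.mem_ofPred_eq] at hN hN'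
      exact Set.disjoint_left.2 fun c h h' => hne (Nb_unique hN.1 hN'.1 h.1 h'.1)
    · rintro N hN c ⟨hc1, hc2⟩
      rw [mem_filter, mem_powerset] at hN
      obtain ⟨T, hT1, hT2, -⟩ := peel_out N.nodup_toList (by simp [Finset.disjoint_sdiff]) hc2
      rw [toList_toFinset] at hT2
      rw [length_toList] at hT1
      refine ⟨N ∪ T, (card_union_le _ _).trans (add_le_add hN.2 ?_), cl_of_nb hv hN.1 hc1 hT2⟩
      exact hT1.trans (Nat.mul_le_mul le_rfl hN.2)
  refine le_trans ?_ h1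
  have h2 : ∀ N ∈ U.powerset.filter (fun N => N.card ≤ R),
      (p * x') ^ N.card * (1 - p) ^ (U.card - N.card) ≤
      pr p ({c | Nb (bb c) v U N} ∩ {c | Peel (bb c) M N.toList (U \ N)}) := by
    intro N hN
    rw [mem_filter, mem_powerset] at hN
    rw [pr_indep (det_Nb _ _ _) (det_Peel _ _ _), pr_Nb hv hN.1, mul_pow, mul_right_comm]
    · have := pr_Peel M hx0 hx R N.toList (U \ N) (by simpa using hN.2) N.nodup_toList
        (by simp [Finset.disjoint_sdiff])
      rw [length_toList] at this
      gcongr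
    · apply EE_disj <;> intro a b ha hb ha' hb' <;> exfalso <;> simp at ha hb ha' hb' <;> subst ha
      · rcases ha' with h | h
        · exact hv (hN.1 h)
        · exact hv h
      · exact hv ha'.1
  refine le_trans ?_ (sum_le_sum h2)
  rw [sub_le_iff_le_add, add_comm (1 - p), ← sum_pow_card,
    ← sum_filter_add_sum_filter_not U.powerset (fun N => N.card ≤ R)]
  gcongr
  have h3 : (1 + p) ^ U.card = ∑ N ∈ U.powerset, (2 * p) ^ N.card * (1 - p) ^ (U.card - N.card) := by
    rw [sum_pow_card]; ring
  rw [h3, mul_sum]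
  refine le_trans (sum_le_sum (g := fun N => (1/2) ^ R * ((2 * p) ^ N.card * (1 - p) ^ (U.card - N.card))) ?_)
    (sum_le_sum_of_subset_of_nonneg (filter_subset _ _) fun _ _ _ => by positivity)
  intro N hN
  rw [mem_filter] at hN
  have h4 : (p * x') ^ N.card ≤ (1/2) ^ R * (2 * p) ^ N.card := by
    have : (1:ℝ) ≤ (1/2)^R * 2 ^ N.card := by
      rw [one_div, inv_pow, inv_mul_eq_div, le_div_iff₀ (by positivity), one_mul]
      exact pow_le_pow_right₀ (by norm_num) (by omega)
    calc (p * x') ^ N.card ≤ (p * 1) ^ N.card := by gcongr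
      _ ≤ ((1/2)^R * 2 ^ N.card) * p ^ N.card := by rw [mul_one]; exact le_mul_of_one_le_left (by positivity) this
      _ = _ := by rw [mul_pow]; ring
  calc _ ≤ ((1/2) ^ R * (2 * p) ^ N.card) * (1 - p) ^ (U.card - N.card) := by gcongr
    _ = _ := by ring
end
end
section
open Finset
def Ach (p : ℕ → ℝ) (x : ℝ) : Prop := 0 ≤ x ∧ ∃ M : ℕ, ∀ᶠ n in atTop, ∀ (U : Finset (Fin (n+2))) (v : Fin (n+2)),
  v ∉ U → x ≤ pr (p n) {c : Cfg (Fin (n+2)) | ∃ T, T.card ≤ M ∧ Cl (bb c) {v} U T}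
lemma Ach.le_one {p : ℕ → ℝ} [hp : ∀ n, Fact (0 ≤ p n ∧ p n ≤ 1)] {x : ℝ} (h : Ach p x) : x ≤ 1 := by
  obtain ⟨_, M, h⟩ := h
  obtain ⟨n, hn⟩ := h.exists
  exact (hn ∅ 0 (by simp)).trans (pr_le_one _)
lemma pow_exp_tendsto {p : ℕ → ℝ} {lam : ℝ}
    (hlim : Tendsto (fun n : ℕ => ((n : ℝ) + 2) * p n) atTop (nhds lam)) {y : ℕ → ℝ} {y0 : ℝ}
    (hy : Tendsto y atTop (nhds y0)) :
    Tendsto (fun n : ℕ => exp (-(p n * y n / (1 - p n * y n) * ((n + 2 : ℕ) : ℝ)))) atTop (nhds (exp (-(lam * y0)))) := by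
  have h0 := p_tendsto hlim
  have h1 : Tendsto (fun n : ℕ => 1 - p n * y n) atTop (nhds (1 - 0 * y0)) := tendsto_const_nhds.sub (h0.mul hy)
  have h2 := ((hlim.mul hy).div h1 (by norm_num)).neg.rexp
  simp only [zero_mul, sub_zero, div_one] at h2
  refine h2.congr fun n => ?_
  push_cast
  simp only [Pi.mul_apply, Pi.neg_apply, Pi.div_apply]
  congr 2
  ring
lemma Ach.step {p : ℕ → ℝ} [hp : ∀ n, Fact (0 ≤ p n ∧ p n ≤ 1)] {lam : ℝ} (hlam : 1 < lam)
    (hlim : Tendsto (fun n : ℕ => ((n : ℝ) + 2) * p n) atTop (nhds lam)) {x y : ℝ} (h : Ach p x)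
    (hy0 : 0 ≤ y) (hy : y < exp (-(lam * (1 - x)))) : Ach p y := by
  have hx1 := h.le_one
  obtain ⟨hx0, M, h⟩ := h
  obtain ⟨η, hη⟩ : ∃ η, η = (exp (-(lam * (1 - x))) - y) / 2 := ⟨_, rfl⟩
  have hηp : 0 < η := by rw [hη]; linarith
  obtain ⟨R, hR⟩ := exists_pow_lt_of_lt_one (show 0 < η / exp (lam + 1) by positivity) (show (1/2 : ℝ) < 1 by norm_num)
  have h0 := p_tendsto hlim
  have hyt : Tendsto (fun n => 1 - x * (1 - p n) ^ (M * R)) atTop (nhds (1 - x * (1 - 0) ^ (M * R))) :=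
    tendsto_const_nhds.sub (((tendsto_const_nhds.sub h0).pow _).const_mul x)
  have ht := pow_exp_tendsto hlim hyt
  rw [sub_zero, one_pow, mul_one] at ht
  refine ⟨hy0, R + M * R, ?_⟩
  filter_upwards [h, ht.eventually_const_lt (show y + η < exp (-(lam * (1 - x))) by rw [hη]; linarith),
    hlim.eventually_lt_const (show lam < lam + 1 by linarith), h0.eventually_lt_const one_pos] with n hn h1 h2 h3 U v hv
  refine le_trans ?_ (small_step M R hx0 hx1 hn U v hv)
  have hp0 := (hp n).out.1
  have hp1 : 0 ≤ 1 - p n := by linarith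
  have hU : U.card ≤ n + 2 := by simpa using U.card_le_univ
  have hx' : x * (1 - p n) ^ (M * R) ≤ 1 := mul_le_one₀ hx1 (by positivity) (pow_le_one₀ hp1 (by linarith))
  have hx'' : 0 ≤ x * (1 - p n) ^ (M * R) := by positivity
  have ha : p n * (1 - x * (1 - p n) ^ (M * R)) < 1 := by nlinarith
  have ha0 : 0 ≤ p n * (1 - x * (1 - p n) ^ (M * R)) := mul_nonneg hp0 (by linarith)
  have h4 := one_sub_pow_ge ha (n + 2)
  have h5 : (1 - p n * (1 - x * (1 - p n) ^ (M * R))) ^ (n + 2) ≤ (1 - p n * (1 - x * (1 - p n) ^ (M * R))) ^ U.card :=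
    pow_le_pow_of_le_one (by linarith) (by linarith) hU
  have h6 : (1 + p n) ^ U.card ≤ exp (lam + 1) := by
    calc (1 + p n) ^ U.card ≤ (exp (p n)) ^ U.card := by gcongr; linarith [add_one_le_exp (p n)]
      _ ≤ (exp (p n)) ^ (n + 2) := pow_le_pow_right₀ (one_le_exp hp0) hU
      _ = exp (((n:ℝ) + 2) * p n) := by rw [← exp_nat_mul]; push_cast; rfl
      _ ≤ _ := exp_le_exp.2 h2.le
  have h7 : (1/2 : ℝ) ^ R * (1 + p n) ^ U.card ≤ η := by
    calc (1/2 : ℝ) ^ R * (1 + p n) ^ U.card ≤ (η / exp (lam + 1)) * exp (lam + 1) := by gcongr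
      _ = η := by field_simp
  have h8 : (1 - p n + p n * (x * (1 - p n) ^ (M * R))) = 1 - p n * (1 - x * (1 - p n) ^ (M * R)) := by ring
  rw [h8]
  linarith
theorem small_clusters {p : ℕ → ℝ} [hp : ∀ n, Fact (0 ≤ p n ∧ p n ≤ 1)] {lam : ℝ} (hlam : 1 < lam)
    (hlim : Tendsto (fun n : ℕ => ((n : ℝ) + 2) * p n) atTop (nhds lam))
    {mu : ℝ} (hmu : mu ∈ Set.Ioo (0 : ℝ) 1)
    (hdual : mu * Real.exp (-mu) = lam * Real.exp (-lam)) {x : ℝ} (hx0 : 0 ≤ x) (hx : x < mu / lam) : Ach p x := by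
  have hb : BddAbove {x | Ach p x} := ⟨1, fun x hx => Ach.le_one hx⟩
  have h0 : Ach p 0 := ⟨le_rfl, 0, Eventually.of_forall fun n U v _ => pr_nonneg _⟩
  have hdown : ∀ {x y}, Ach p x → 0 ≤ y → y ≤ x → Ach p y := fun h hy hyx =>
    ⟨hy, h.2.imp fun M hM => hM.mono fun n hn U v hv => hyx.trans (hn U v hv)⟩
  by_contra hcon
  obtain ⟨s, hs⟩ : ∃ s, s = sSup {x | Ach p x} := ⟨_, rfl⟩
  have hs0 : 0 ≤ s := hs ▸ le_csSup hb h0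
  have hsx : s ≤ x := by
    rw [hs]
    exact csSup_le ⟨0, h0⟩ fun y hy => by
      by_contra h; exact hcon (hdown hy hx0 (by linarith))
  have hsq : s < mu / lam := by linarith
  have hl : 0 < lam := by linarith
  have hq1 : mu / lam < 1 := by rw [div_lt_one hl]; linarith [hmu.2]
  have hfix := zeta_fix hlam hdual
  -- exp(-lam (1-s)) > s
  have h1 := exp_chord_lt hl (show 0 < 1 - mu / lam by linarith) (show 1 - mu / lam < 1 - s by linarith)
  rw [hfix] at h1
  have h2 : s < exp (-(lam * (1 - s))) := by nlinarith
  have hcont : Tendsto (fun t : ℝ => exp (-(lam * (1 - t)))) (nhds s) (nhds (exp (-(lam * (1 - s))))) :=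
    (by fun_prop : Continuous fun t : ℝ => exp (-(lam * (1 - t)))).tendsto s
  obtain ⟨y, hy1, hy2⟩ := exists_between h2
  obtain ⟨ε, hε, hball⟩ := Metric.eventually_nhds_iff.1 (hcont.eventually_const_lt hy2)
  obtain ⟨t, ht, hts⟩ := exists_lt_of_lt_csSup ⟨0, h0⟩ (show s - ε < sSup {x | Ach p x} by rw [← hs]; linarith)
  have hts' : t ≤ s := hs ▸ le_csSup hb ht
  have := hball (y := t) (by rw [Real.dist_eq, abs_lt]; constructor <;> linarith)
  have hy := Ach.step hlam hlim ht (by linarith : (0:ℝ) ≤ y) this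
  have := hs ▸ le_csSup hb hy
  linarith
end
section
open Finset
variable {V : Type} [Fintype V] [DecidableEq V]
def lapF (θ : ℝ) (z : Bool × ℝ) : ℝ≥0∞ := if z.1 = true then ENNReal.ofReal (exp (-(θ * z.2))) else 0
lemma lapF_meas (θ : ℝ) : Measurable (lapF θ) :=
  Measurable.ite meas_true (by fun_prop) measurable_const
section
variable {p : ℝ} [hp : Fact (0 ≤ p ∧ p ≤ 1)]
lemma lapF_int {θ : ℝ} (hθ : 0 ≤ θ) : ∫⁻ z, lapF θ z ∂(BE p) = ENNReal.ofReal (p / (1 + θ)) := by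
  rw [BE, lintegral_prod _ (lapF_meas θ).aemeasurable]
  have h := fun x : Bool => exp_laplace θ (by linarith : 0 < 1 + θ)
  rw [bernoulliDist, lintegral_add_measure, lintegral_smul_measure, lintegral_smul_measure,
    lintegral_dirac, lintegral_dirac]
  simp only [lapF, if_true]
  rw [exp_laplace θ (by linarith)]
  simp only [Bool.false_eq_true, if_false, lintegral_zero, smul_eq_mul, mul_zero, add_zero]
  rw [← ENNReal.ofReal_mul hp.out.1, mul_one_div]
lemma pr_laplace (F : Finset (Sym2 V)) {θ : ℝ} (hθ : 0 ≤ θ) (x : ℝ) :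
    pr p {c | (∀ e ∈ F, (c e).1 = true) ∧ ∑ e ∈ F, (c e).2 ≤ x} ≤
      (p / (1 + θ)) ^ F.card * exp (θ * x) := by
  have hp0 := hp.out.1
  have hi : iIndepFun (fun (e : Sym2 V) (c : Cfg V) => lapF θ (c e)) (PP V p) :=
    iIndepFun_pi (X := fun _ => lapF θ) (fun _ => (lapF_meas θ).aemeasurable)
  have h1 := lintegral_prod_eq_prod_lintegral_of_indepFun F _ hi
    (fun e => (lapF_meas θ).comp (measurable_pi_apply e))
  have h2 : ∀ e : Sym2 V, ∫⁻ c, lapF θ (c e) ∂(PP V p) = ENNReal.ofReal (p / (1 + θ)) := by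
    intro e
    rw [← lapF_int hθ]
    have := (measurePreserving_eval (fun _ : Sym2 V => BE p) e).lintegral_comp (lapF_meas θ)
    exact this
  simp only [h2, prod_const] at h1
  have h3 : (PP V p) {c | (∀ e ∈ F, (c e).1 = true) ∧ ∑ e ∈ F, (c e).2 ≤ x} ≤
      ENNReal.ofReal (exp (θ * x)) * ENNReal.ofReal (p / (1 + θ)) ^ F.card := by
    rw [← h1, ← lintegral_const_mul]
    · refine le_trans ?_ (meas_ge_le_lintegral_div (μ := PP V p) (ε := 1) (f := fun c => ENNReal.ofReal (exp (θ * x)) * ∏ e ∈ F, lapF θ (c e)) ?_ one_ne_zero ENNReal.one_ne_top |>.trans (by rw [div_one]))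
      · apply measure_mono
        rintro c ⟨hc1, hc2⟩
        simp only [Set.mem_ofPred_eq]
        have : ∏ e ∈ F, lapF θ (c e) = ENNReal.ofReal (exp (-(θ * ∑ e ∈ F, (c e).2))) := by
          rw [mul_sum, ← sum_neg_distrib, exp_sum, ENNReal.ofReal_prod_of_nonneg (fun _ _ => (exp_pos _).le)]
          refine prod_congr rfl fun e he => ?_
          simp [lapF, hc1 e he]
        rw [this, ← ENNReal.ofReal_mul (exp_pos _).le, ← exp_add, ENNReal.one_le_ofReal]
        apply one_le_exp
        have := mll hc2 hθ
        linarith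
      · refine (Measurable.const_mul ?_ _).aemeasurable
        exact measurable_prod _ fun e _ => (lapF_meas θ).comp (measurable_pi_apply e)
    · exact measurable_prod _ fun e _ => (lapF_meas θ).comp (measurable_pi_apply e)
  have h4 : ENNReal.ofReal (exp (θ * x)) * ENNReal.ofReal (p / (1 + θ)) ^ F.card =
      ENNReal.ofReal ((p / (1 + θ)) ^ F.card * exp (θ * x)) := by
    rw [← ENNReal.ofReal_pow (by positivity), ← ENNReal.ofReal_mul (exp_pos _).le, mul_comm]
  rw [h4] at h3
  exact ENNReal.toReal_le_of_le_ofReal (by positivity) h3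
end
def ledges (l : List V) : List (Sym2 V) := List.zipWith (fun x y => s(x, y)) l l.tail
@[simp] lemma ledges_nil : ledges ([] : List V) = [] := rfl
@[simp] lemma ledges_one (x : V) : ledges [x] = [] := rfl
@[simp] lemma ledges_cons (x y : V) (l : List V) : ledges (x :: y :: l) = s(x, y) :: ledges (y :: l) := rfl
lemma ledges_mem {e : Sym2 V} : ∀ {l : List V}, e ∈ ledges l → ∀ x ∈ e, x ∈ l
  | [], h => by simp at h
  | [x], h => by simp at h
  | x :: y :: l, h => by
    rw [ledges_cons, List.mem_cons] at h
    rcases h with rfl | h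
    · intro z hz; simp at hz; rcases hz with rfl | rfl <;> simp
    · intro z hz; exact List.mem_cons_of_mem _ (ledges_mem h z hz)
lemma ledges_nodup : ∀ {l : List V}, l.Nodup → (ledges l).Nodup
  | [], _ => by simp
  | [x], _ => by simp
  | x :: y :: l, h => by
    rw [ledges_cons, List.nodup_cons]
    rw [List.nodup_cons] at h
    exact ⟨fun he => h.1 (ledges_mem he x (by simp)), ledges_nodup h.2⟩
lemma ledges_length (l : List V) : (ledges l).length = l.length - 1 := by
  simp [ledges]
def wts (c : Cfg V) (es : List (Sym2 V)) : ℝ≥0 := (es.map fun e => (c e).2.toNNReal).sum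
lemma wts_append (c : Cfg V) (es es' : List (Sym2 V)) : wts c (es ++ es') = wts c es + wts c es' := by
  simp [wts]
@[simp] lemma wts_cons (c : Cfg V) (e : Sym2 V) (es : List (Sym2 V)) : wts c (e :: es) = (c e).2.toNNReal + wts c es := by
  simp [wts]
@[simp] lemma wts_nil (c : Cfg V) : wts c [] = 0 := rfl
lemma wts_sublist {c : Cfg V} {es es' : List (Sym2 V)} (h : es.Sublist es') : wts c es ≤ wts c es' :=
  (h.map _).sum_le_sum (by simp)
lemma wts_ge (c : Cfg V) {es : List (Sym2 V)} (h : es.Nodup) : ∑ e ∈ es.toFinset, (c e).2 ≤ wts c es := by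
  rw [List.sum_toFinset _ h]
  clear h
  induction es with
  | nil => simp
  | cons e es ih => simp only [List.map_cons, List.sum_cons, wts_cons, NNReal.coe_add]
                    exact add_le_add (Real.le_coe_toNNReal _) ih
def PL (c : Cfg V) (l : List V) (t : ℝ) : Prop := (∀ e ∈ ledges l, (c e).1 = true) ∧ (wts c (ledges l) : ℝ) ≤ t
def PLst (X : Finset V) (a b : V) (l : List V) : Prop :=
  l.Nodup ∧ (∀ x ∈ l, x ∈ X) ∧ l.head? = some a ∧ l.getLast? = some b
def SP (c : Cfg V) (X : Finset V) (a b : V) (t : ℝ) : Prop := ∃ l, PLst X a b l ∧ PL c l t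
def SPk (c : Cfg V) (X : Finset V) (a b : V) (t : ℝ) (k : ℕ) : Prop := ∃ l, PLst X a b l ∧ PL c l t ∧ l.length ≤ k + 1
lemma ledges_EE {X : Finset V} {l : List V} (hn : l.Nodup) (hX : ∀ x ∈ l, x ∈ X) : ∀ e ∈ ledges l, e ∈ EE X X := by
  induction l with
  | nil => simp
  | cons x l ih =>
    cases l with
    | nil => simp
    | cons y l =>
      intro e he
      rw [ledges_cons, List.mem_cons] at he
      rcases he with rfl | he
      · exact ⟨x, hX x (by simp), y, hX y (by simp), by rintro rfl; simp at hn, rfl⟩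
      · exact ih (List.nodup_cons.1 hn).2 (fun z hz => hX z (List.mem_cons_of_mem _ hz)) e he
lemma meas_wts (es : List (Sym2 V)) : Measurable fun c : Cfg V => wts c es := by
  induction es with
  | nil => simp
  | cons e es ih =>
    simp only [wts_cons]
    exact ((measurable_snd.comp (measurable_pi_apply e)).real_toNNReal).add ih
lemma det_PL {X : Finset V} {l : List V} (hn : l.Nodup) (hX : ∀ x ∈ l, x ∈ X) (t : ℝ) :
    Det (EE X X) {c : Cfg V | PL c l t} := by
  refine ⟨?_, fun c c' hc h => ?_⟩
  · refine MeasurableSet.inter ?_ (measurableSet_le (meas_wts _).coe_nnreal_real measurable_const)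
    have : {c : Cfg V | ∀ e ∈ ledges l, (c e).1 = true} = ⋂ e ∈ (ledges l).toFinset, {c : Cfg V | (c e).1 = true} := by
      ext; simp
    show MeasurableSet {c : Cfg V | ∀ e ∈ ledges l, (c e).1 = true}
    rw [this]
    exact measurableSet_biInter _ fun e _ => (det_edge meas_true e).1
  · have he : ∀ e ∈ ledges l, c e = c' e := fun e he => hc e (ledges_EE hn hX e he)
    have hw : wts c (ledges l) = wts c' (ledges l) := by
      unfold wts; congr 1; exact List.map_congr_left fun e h => by rw [he e h]
    exact ⟨fun e h' => by rw [← he e h']; exact h.1 e h', by rw [← hw]; exact h.2⟩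
lemma det_SP (X : Finset V) (a b : V) (t : ℝ) : Det (EE X X) {c | SP c X a b t} := by
  have : {c | SP c X a b t} = ⋃ l : {l : List V // PLst X a b l}, {c | PL c l t} := by
    ext c; simp [SP]
  rw [this]
  exact Det.iUnion fun l => det_PL l.2.1 l.2.2.1 t
lemma det_SPk (X : Finset V) (a b : V) (t : ℝ) (k : ℕ) : Det (EE X X) {c | SPk c X a b t k} := by
  have : {c | SPk c X a b t k} = ⋃ l : {l : List V // PLst X a b l ∧ l.length ≤ k + 1}, {c | PL c l t} := by
    ext c; simp only [SPk, Set.mem_ofPred_eq, Set.mem_iUnion, Subtype.exists, exists_prop]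
    exact ⟨fun ⟨l, h1, h2, h3⟩ => ⟨l, ⟨h1, h3⟩, h2⟩, fun ⟨l, ⟨h1, h3⟩, h2⟩ => ⟨l, h1, h2, h3⟩⟩
  rw [this]
  exact Det.iUnion fun l => det_PL l.2.1.1 l.2.1.2.1 t
lemma pr_PL {p : ℝ} [hp : Fact (0 ≤ p ∧ p ≤ 1)] {l : List V} (hn : l.Nodup) {θ : ℝ} (hθ : 0 ≤ θ) (t : ℝ) :
    pr p {c | PL c l t} ≤ (p / (1 + θ)) ^ (l.length - 1) * exp (θ * t) := by
  have h := pr_laplace (p := p) (ledges l).toFinset hθ t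
  rw [List.toFinset_card_of_nodup (ledges_nodup hn), ledges_length] at h
  refine le_trans (pr_mono ?_) h
  rintro c ⟨h1, h2⟩
  exact ⟨fun e he => h1 e (by simpa using he), (wts_ge c (ledges_nodup hn)).trans h2⟩
lemma SPk_sub (X : Finset V) {a b : V} (hab : a ≠ b) (t : ℝ) (k : ℕ) :
    {c | SPk c X a b t k} ⊆ ⋃ m ∈ range k, ⋃ f ∈ (univ : Finset (Fin m → V)),
      {c | (a :: (List.ofFn f ++ [b])).Nodup ∧ PL c (a :: (List.ofFn f ++ [b])) t} := by
  rintro c ⟨l, ⟨h1, h2, h3, h4⟩, h5, h6⟩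
  simp only [Set.mem_iUnion, mem_range, mem_univ, exists_true_left]
  cases l with
  | nil => simp at h3
  | cons x l =>
    simp at h3
    subst h3
    have hl : l ≠ [] := by
      rintro rfl; simp at h4; exact hab h4
    have h7 : l.dropLast ++ [b] = l := by
      have := List.dropLast_append_getLast hl
      rw [List.getLast?_cons] at h4
      rw [List.getLast?_eq_some_getLast hl] at h4
      simp at h4
      rwa [h4] at this
    refine ⟨l.dropLast.length, ?_, fun i => l.dropLast.get i, ?_⟩
    · simp at h6 ⊢
      have : 0 < l.length := List.length_pos_iff.2 hl
      omega
    · rw [List.ofFn_get, h7]; exact ⟨h1, h5⟩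
lemma pr_SPk {p : ℝ} [hp : Fact (0 ≤ p ∧ p ≤ 1)] (X : Finset V) {a b : V} (hab : a ≠ b) (t : ℝ) (k : ℕ) {θ : ℝ} (hθ : 0 ≤ θ) :
    pr p {c | SPk c X a b t k} ≤
      ∑ m ∈ range k, (Fintype.card V : ℝ) ^ m * ((p / (1 + θ)) ^ (m + 1) * exp (θ * t)) := by
  have hp0 := hp.out.1
  refine (pr_mono (SPk_sub X hab t k)).trans ((pr_biUnion_le _ _).trans (sum_le_sum fun m _ => ?_))
  refine (pr_biUnion_le _ _).trans ?_
  have : ∀ f ∈ (univ : Finset (Fin m → V)), pr p {c | (a :: (List.ofFn f ++ [b])).Nodup ∧ PL c (a :: (List.ofFn f ++ [b])) t} ≤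
      (p / (1 + θ)) ^ (m + 1) * exp (θ * t) := by
    intro f _
    by_cases h : (a :: (List.ofFn f ++ [b])).Nodup
    · have := pr_PL (p := p) h hθ t
      simp only [h, true_and]
      simpa using this
    · simp only [h, false_and, Set.setOf_false]
      simp only [pr, measureReal_empty]; positivity
  refine (sum_le_sum this).trans ?_
  simp
lemma SP_SPk {c : Cfg V} {X : Finset V} {a b : V} {t : ℝ} (h : SP c X a b t) : SPk c X a b t (Fintype.card V) := by
  obtain ⟨l, h1, h2⟩ := h
  exact ⟨l, h1, h2, h1.1.length_le_card.trans (by omega)⟩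
end
section
open Finset
lemma logN_tendsto : Tendsto (fun n : ℕ => log ((n : ℝ) + 2)) atTop atTop := tendsto_log_atTop.comp N_tendsto
lemma sum_rw (N p θ E : ℝ) (hN : N ≠ 0) (k : ℕ) :
    ∑ m ∈ range k, N ^ m * ((p / (1 + θ)) ^ (m + 1) * E) =
      E / N * ∑ m ∈ range k, (N * p / (1 + θ)) ^ (m + 1) := by
  rw [mul_sum]
  refine sum_congr rfl fun m _ => ?_
  rw [show N * p / (1 + θ) = N * (p / (1 + θ)) by ring, mul_pow N, pow_succ N]
  field_simp
theorem short_low {p : ℕ → ℝ} [hp : ∀ n, Fact (0 ≤ p n ∧ p n ≤ 1)] {lam : ℝ} (hlam : 1 < lam)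
    (hlim : Tendsto (fun n : ℕ => ((n : ℝ) + 2) * p n) atTop (nhds lam)) {δ : ℝ} (hδ : 0 < δ) (hδ1 : δ < 1)
    {η : ℝ} (hη : 0 < η) : ∀ᶠ n : ℕ in atTop, ∀ (X : Finset (Fin (n+2))) (a b : Fin (n+2)), a ≠ b →
      pr (p n) {c | SP c X a b ((1 - δ) * log ((n : ℝ) + 2) / (lam - 1))} ≤ η := by
  have hl : 0 < lam - 1 := by linarith
  obtain ⟨θ, hθ⟩ : ∃ θ, θ = (lam - 1) * (1 + δ) := ⟨_, rfl⟩
  have hθ0 : 0 < θ := by rw [hθ]; positivity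
  have hθl : lam < 1 + θ := by rw [hθ]; nlinarith
  have h1 : lam / (1 + θ) < 1 := by rw [div_lt_one (by linarith)]; exact hθl
  obtain ⟨ρ, hρ, hρ1⟩ := exists_between h1
  have hρ0 : 0 < ρ := lt_trans (by positivity) hρ
  have ht : Tendsto (fun n : ℕ => exp (-(δ ^ 2 * log ((n : ℝ) + 2))) * (1 - ρ)⁻¹) atTop (nhds (0 * (1 - ρ)⁻¹)) := by
    refine Tendsto.mul_const _ ?_
    exact tendsto_exp_neg_atTop_nhds_zero.comp (logN_tendsto.const_mul_atTop (by positivity))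
  rw [zero_mul] at ht
  filter_upwards [(hlim.div_const (1 + θ)).eventually_lt_const hρ, ht.eventually_lt_const hη] with n h2 h3 X a b hab
  have hp0 := (hp n).out.1
  have hN : (0:ℝ) < (n:ℝ) + 2 := by positivity
  refine le_trans (pr_mono fun c hc => SP_SPk hc) ((pr_SPk X hab _ _ hθ0.le).trans ?_)
  simp only [Fintype.card_fin, Nat.cast_add, Nat.cast_ofNat]
  rw [sum_rw _ _ _ _ hN.ne']
  refine le_trans ?_ h3.le
  have h4 : exp (θ * ((1 - δ) * log ((n:ℝ) + 2) / (lam - 1))) / ((n:ℝ) + 2) = exp (-(δ ^ 2 * log ((n : ℝ) + 2))) := by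
    nth_rw 2 [← exp_log hN]
    rw [← exp_sub]
    congr 1
    rw [hθ]; field_simp; ring
  rw [h4]
  gcongr
  calc ∑ m ∈ range (n + 2), (((n:ℝ) + 2) * p n / (1 + θ)) ^ (m + 1) ≤ ∑ m ∈ range (n + 2), ρ ^ m := by
        refine sum_le_sum fun m _ => ?_
        calc (((n:ℝ) + 2) * p n / (1 + θ)) ^ (m + 1) ≤ ρ ^ (m + 1) := by gcongr
          _ ≤ ρ ^ m := pow_le_pow_of_le_one hρ0.le hρ1.le (by omega)
    _ ≤ ∑' m : ℕ, ρ ^ m := (summable_geometric_of_lt_one hρ0.le hρ1).sum_le_tsum _ (fun _ _ => by positivity)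
    _ = _ := tsum_geometric_of_lt_one hρ0.le hρ1
theorem short_hops {p : ℕ → ℝ} [hp : ∀ n, Fact (0 ≤ p n ∧ p n ≤ 1)] {lam : ℝ} (hlam : 1 < lam)
    (hlim : Tendsto (fun n : ℕ => ((n : ℝ) + 2) * p n) atTop (nhds lam)) {ε : ℝ} (hε : 0 < ε) (hε1 : ε < 1) :
    ∃ δ > 0, ∀ η > 0, ∀ᶠ n : ℕ in atTop, ∀ (X : Finset (Fin (n+2))) (a b : Fin (n+2)) (k : ℕ), a ≠ b →
      (k : ℝ) ≤ (1 - ε) * lam / (lam - 1) * log ((n : ℝ) + 2) →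
      pr (p n) {c | SPk c X a b ((1 + δ) * log ((n : ℝ) + 2) / (lam - 1) + 3) k} ≤ η := by
  have hl : 0 < lam - 1 := by linarith
  have hl0 : 0 < lam := by linarith
  obtain ⟨d, hd⟩ : ∃ d, d = min ((lam - 1) / lam) (ε / 8) := ⟨_, rfl⟩
  have hd0 : 0 < d := by rw [hd]; positivity
  have hd1 : d ≤ (lam - 1) / lam := hd ▸ min_le_left _ _
  have hd2 : d ≤ ε / 8 := hd ▸ min_le_right _ _
  rw [le_div_iff₀ hl0] at hd1
  obtain ⟨θ, hθ⟩ : ∃ θ, θ = lam * (1 - d) - 1 := ⟨_, rfl⟩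
  have hθ0 : 0 ≤ θ := by rw [hθ]; linarith
  obtain ⟨r, hr⟩ : ∃ r, r = d * (1 + ε / 2) := ⟨_, rfl⟩
  have hr0 : 0 < r := by rw [hr]; positivity
  obtain ⟨δ, hδ⟩ : ∃ δ, δ = lam * d * ε / (4 * (lam - 1)) := ⟨_, rfl⟩
  have hδ0 : 0 < δ := by rw [hδ]; positivity
  have h1 : lam / (1 + θ) < exp r := by
    refine lt_of_lt_of_le ?_ (add_one_le_exp r)
    rw [show 1 + θ = lam * (1 - d) by rw [hθ]; ring, div_lt_iff₀ (by nlinarith), hr]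
    have : 1 < (d * (1 + ε / 2) + 1) * (1 - d) := by
      have g1 : d * (1 + ε / 2) ≤ ε / 4 := by nlinarith
      have g2 := mll g1 hd0.le
      have g3 : 0 < d * ε := by positivity
      linarith
    nlinarith
  obtain ⟨C, hC⟩ : ∃ C, C = (1 - ε) * lam / (lam - 1) := ⟨_, rfl⟩
  have hC0 : 0 ≤ C := by rw [hC]; have : 0 ≤ 1 - ε := by linarith
                         positivity
  have ht : Tendsto (fun n : ℕ => exp (3 * θ) * C * (log ((n : ℝ) + 2) ^ 1 * exp (-(δ * log ((n : ℝ) + 2))))) atTop (nhds (exp (3 * θ) * C * 0)) := by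
    refine Tendsto.const_mul _ ?_
    have := (tendsto_pow_mul_exp_neg_atTop_nhds_zero 1).comp (logN_tendsto.const_mul_atTop hδ0)
    have h2 := this.const_mul (δ⁻¹)
    rw [mul_zero] at h2
    refine h2.congr fun n => ?_
    simp only [Function.comp, pow_one]
    field_simp
  rw [mul_zero] at ht
  refine ⟨δ, hδ0, fun η hη => ?_⟩
  filter_upwards [(hlim.div_const (1 + θ)).eventually_lt_const h1, ht.eventually_lt_const hη] with n h2 h3 X a b k hab hk
  have hp0 := (hp n).out.1
  have hN : (0:ℝ) < (n:ℝ) + 2 := by positivity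
  rw [← hC] at hk
  refine (pr_SPk X hab _ _ hθ0).trans ?_
  simp only [Fintype.card_fin, Nat.cast_add, Nat.cast_ofNat]
  rw [sum_rw _ _ _ _ hN.ne']
  refine le_trans ?_ h3.le
  obtain ⟨L, hL⟩ : ∃ L, L = log ((n:ℝ) + 2) := ⟨_, rfl⟩
  have hL0 : 0 ≤ L := by rw [hL]; exact log_nonneg (by linarith)
  have hNL : (n:ℝ) + 2 = exp L := by rw [hL, exp_log hN]
  rw [← hL] at hk ⊢
  have h5 : ∑ m ∈ range k, (((n:ℝ) + 2) * p n / (1 + θ)) ^ (m + 1) ≤ C * L * exp (r * (C * L)) := by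
    calc _ ≤ ∑ m ∈ range k, exp (r * (C * L)) := by
          refine sum_le_sum fun m hm => ?_
          calc (((n:ℝ) + 2) * p n / (1 + θ)) ^ (m + 1) ≤ (exp r) ^ (m + 1) := by gcongr
            _ ≤ (exp r) ^ k := pow_le_pow_right₀ (one_le_exp hr0.le) (mem_range.1 hm)
            _ = exp (r * k) := by rw [← exp_nat_mul, mul_comm]
            _ ≤ _ := by gcongr
      _ = k * exp (r * (C * L)) := by simp
      _ ≤ _ := by gcongr
  calc _ ≤ exp (θ * ((1 + δ) * L / (lam - 1) + 3)) / ((n:ℝ) + 2) * (C * L * exp (r * (C * L))) := by gcongr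
    _ = exp (3 * θ) * C * (L * exp ((θ * (1 + δ) / (lam - 1) - 1 + r * C) * L)) := by
        rw [hNL, ← exp_sub]
        have : exp ((θ * (1 + δ) / (lam - 1) - 1 + r * C) * L) * exp (3 * θ) = exp (θ * ((1 + δ) * L / (lam - 1) + 3) - L) * exp (r * (C * L)) := by
          rw [← exp_add, ← exp_add]; congr 1; field_simp; ring
        linear_combination (-C * L) * this
    _ ≤ _ := by
        rw [pow_one]
        gcongr
        rw [← neg_mul]
        refine mlr ?_ hL0
        have e1 : θ * (1 + δ) / (lam - 1) - 1 + r * C = (θ * (1 + δ) - (lam - 1) + r * ((1 - ε) * lam)) / (lam - 1) := by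
          rw [hC]; field_simp
        rw [e1, div_le_iff₀ hl]
        have e2 : δ * (lam - 1) = lam * d * ε / 4 := by rw [hδ]; field_simp
        have e3 : θ * δ ≤ (lam - 1) * δ := by
          refine mlr ?_ hδ0.le
          rw [hθ]; nlinarith
        have e4 : r * ((1 - ε) * lam) ≤ lam * d * (1 - ε / 2) := by
          rw [hr]
          have : (1 + ε / 2) * (1 - ε) ≤ 1 - ε / 2 := by nlinarith
          have := mll this (show 0 ≤ lam * d by positivity)
          linarith
        have e5 : θ = lam - lam * d - 1 := by rw [hθ]; ring
        nlinarith
end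
section
open Finset
variable {V : Type} [Fintype V] [DecidableEq V]
def lev (h : ℝ) (j : ℕ) : Set (Bool × ℝ) := {z | (z.1 = true ∧ z.2 ≤ j * h) ∧ 0 < j}
def FF (p h : ℝ) (j : ℕ) : ℝ := p * (1 - exp (-(j * h)))
lemma lev_meas (h : ℝ) (j : ℕ) : MeasurableSet (lev h j) :=
  (meas_le (j * h)).inter (MeasurableSet.const _)
lemma lev_mono {h : ℝ} (hh : 0 < h) {i j : ℕ} (hij : i ≤ j) : lev h i ⊆ lev h j := by
  rintro z ⟨⟨h1, h2⟩, h3⟩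
  have : (i : ℝ) ≤ j := by exact_mod_cast hij
  exact ⟨⟨h1, h2.trans (by gcongr)⟩, by omega⟩
lemma BE_lev {p : ℝ} [hp : Fact (0 ≤ p ∧ p ≤ 1)] {h : ℝ} (hh : 0 < h) (j : ℕ) :
    (BE p).real (lev h j) = FF p h j := by
  rcases Nat.eq_zero_or_pos j with rfl | hj
  · simp [lev, FF]
  · have := BE_le (p := p) (show 0 ≤ j * h by positivity)
    rw [FF, ← this]; congr 1; ext z; simp [lev, hj]
def al (A : Finset V) : List (Finset V) → Finset V
  | [] => A
  | N :: l => N ∪ al A l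
def hd (A : Finset V) : List (Finset V) → Finset V
  | [] => A
  | N :: _ => N
def Val (A U : Finset V) : List (Finset V) → Prop
  | [] => True
  | N :: l => N ⊆ U \ al A l ∧ Val A U l
def nh (h : ℝ) (A : Finset V) (c : Cfg V) (y : V) : ℕ → List (Finset V) → Prop
  | s, [] => ∀ x ∈ A, c s(x, y) ∉ lev h s
  | s, N :: l => (∀ x ∈ N, c s(x, y) ∉ lev h s) ∧ nh h A c y (s + 1) l
def pn (p h : ℝ) (A : Finset V) : ℕ → List (Finset V) → ℝ
  | s, [] => (1 - FF p h s) ^ A.card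
  | s, N :: l => (1 - FF p h s) ^ N.card * pn p h A (s + 1) l
def Phi (h : ℝ) (A : Finset V) : List (Finset V) → ℝ
  | [] => A.card
  | N :: l => N.card + exp (-h) * Phi h A l
def Ex (h : ℝ) (A U : Finset V) (c : Cfg V) : List (Finset V) → Prop
  | [] => True
  | N :: l => Ex h A U c l ∧ ∀ y ∈ U \ al A l, y ∈ N ↔ ¬ nh h A c y 1 l
def OO (h : ℝ) (A : Finset V) (c : Cfg V) : List (Finset V) → Prop
  | [] => True
  | N :: l => OO h A c l ∧ ∀ y ∈ N, nh h A c y 0 l ∧ ¬ nh h A c y 1 l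
lemma nh_mono {h : ℝ} (hh : 0 < h) {A : Finset V} {c : Cfg V} {y : V} : ∀ {l : List (Finset V)} {s t : ℕ}, s ≤ t →
    nh h A c y t l → nh h A c y s l
  | [], s, t, hst, H => fun x hx hc => H x hx (lev_mono hh hst hc)
  | N :: l, s, t, hst, H => ⟨fun x hx hc => H.1 x hx (lev_mono hh hst hc), nh_mono hh (by omega) H.2⟩
lemma nh_zero_nil {h : ℝ} {A : Finset V} {c : Cfg V} {y : V} : nh h A c y 0 [] := by
  intro x _ hx; simp [lev] at hx
lemma nh_zero_cons {h : ℝ} {A N : Finset V} {l : List (Finset V)} {c : Cfg V} {y : V} :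
    nh h A c y 0 (N :: l) ↔ nh h A c y 1 l := by
  simp [nh, lev]
lemma Ex_iff {h : ℝ} (hh : 0 < h) {A U : Finset V} {c : Cfg V} : ∀ {l : List (Finset V)}, Val A U l →
    (Ex h A U c l ↔ OO h A c l ∧ ∀ y ∈ U \ al A l, nh h A c y 0 l)
  | [], _ => by simp [Ex, OO, nh_zero_nil]
  | N :: l, hv => by
    simp only [Ex, OO, nh_zero_cons]
    rw [Ex_iff hh hv.2]
    constructor
    · rintro ⟨⟨h1, h2⟩, h3⟩
      refine ⟨⟨h1, fun y hy => ⟨h2 y (hv.1 hy), (h3 y (hv.1 hy)).1 hy⟩⟩, fun y hy => ?_⟩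
      simp [al] at hy
      by_contra hc
      exact hy.2.1 ((h3 y (by simp; tauto)).2 hc)
    · rintro ⟨⟨h1, h2⟩, h3⟩
      have h3' : ∀ y ∈ U \ al A l, y ∉ N → nh h A c y 1 l := fun y hy hn => h3 y (by simp [al] at hy ⊢; tauto)
      refine ⟨⟨h1, fun y hy => ?_⟩, fun y hy => ⟨fun hn => (h2 y hn).2, fun hn => ?_⟩⟩
      · by_cases hn : y ∈ N
        · exact (h2 y hn).1
        · exact nh_mono hh (by omega) (h3' y hy hn)
      · by_contra hcon; exact hn (h3' y hy hcon)
lemma det_edges_not {y : V} {N : Finset V} {L : Set (Bool × ℝ)} (hL : MeasurableSet L) (hy : y ∉ N) :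
    Det (EE {y} N) {c : Cfg V | ∀ x ∈ N, c s(x, y) ∉ L} := by
  have : {c : Cfg V | ∀ x ∈ N, c s(x, y) ∉ L} = (⋃ x ∈ N, {c : Cfg V | c s(x, y) ∈ L})ᶜ := by
    ext c; simp
  rw [this]
  refine (Det.biUnion _ fun x hx => (det_edge hL _).mono ?_).compl
  rintro e rfl
  exact ⟨y, by simp, x, hx, by rintro rfl; exact hy hx, Sym2.eq_swap⟩
lemma det_nh (h : ℝ) (A : Finset V) {y : V} : ∀ (s : ℕ) {l : List (Finset V)}, y ∉ al A l →
    Det (EE {y} (al A l)) {c | nh h A c y s l}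
  | s, [], hy => det_edges_not (lev_meas h s) hy
  | s, N :: l, hy => by
    simp [al] at hy
    exact ((det_edges_not (lev_meas h s) hy.1).mono (EE_mono subset_rfl (subset_union_left))).inter
      ((det_nh h A (s + 1) hy.2).mono (EE_mono subset_rfl (subset_union_right)))
lemma det_OO (h : ℝ) (A U : Finset V) : ∀ {l : List (Finset V)}, Val A U l →
    Det (EE (al A l) (al A l)) {c | OO h A c l}
  | [], _ => by simp only [OO]; exact Det.univ'
  | N :: l, hv => by
    have h1 : {c | OO h A c (N :: l)} = {c | OO h A c l} ∩
        (⋃ y ∈ N, ({c | nh h A c y 0 l} ∩ {c | nh h A c y 1 l}ᶜ)ᶜ)ᶜ := by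
      ext c; simp only [OO, Set.compl_iUnion, compl_compl, Set.mem_iInter, Set.mem_inter_iff, Set.mem_compl_iff, Set.mem_ofPred_eq]
    rw [h1]
    refine ((det_OO h A U hv.2).mono (EE_mono subset_union_right subset_union_right)).inter
      (Det.biUnion _ fun y hy => (Det.mono (T := EE {y} (al A l)) ?_ ?_)).compl
    · have hy' := (mem_sdiff.1 (hv.1 hy)).2
      exact ((det_nh h A 0 hy').inter (det_nh h A 1 hy').compl).compl
    · exact EE_mono (by simp [al, hy]) subset_union_right
section
variable {p : ℝ} [hp : Fact (0 ≤ p ∧ p ≤ 1)]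
lemma pr_edges_not {y : V} {N : Finset V} {L : Set (Bool × ℝ)} (hL : MeasurableSet L) (hy : y ∉ N) :
    pr p {c | ∀ x ∈ N, c s(x, y) ∉ L} = (1 - (BE p).real L) ^ N.card := by
  have := pr_pairs (p := p) (N ×ˢ {y}) (pair_inj (by simpa using hy)) (fun _ => Lᶜ)
  rw [prod_const, card_product, card_singleton, mul_one, BE_compl hL] at this
  rw [← this]; congr 1; ext c; simp
lemma pr_nh {h : ℝ} (hh : 0 < h) (A U : Finset V) {y : V} : ∀ (s : ℕ) {l : List (Finset V)}, Val A U l → y ∉ al A l →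
    pr p {c | nh h A c y s l} = pn p h A s l
  | s, [], _, hy => by
    simp only [nh, pn]; rw [pr_edges_not (lev_meas h s) (show y ∉ A from hy), BE_lev hh]
  | s, N :: l, hv, hy => by
    simp [al] at hy
    have h1 : {c | nh h A c y s (N :: l)} = {c | ∀ x ∈ N, c s(x, y) ∉ lev h s} ∩ {c | nh h A c y (s + 1) l} := by
      ext c; simp [nh]
    rw [h1, pr_indep (det_edges_not (lev_meas h s) hy.1) (det_nh h A (s+1) hy.2), pr_nh hh A U (s+1) hv.2 hy.2,
      pr_edges_not (lev_meas h s) hy.1, BE_lev hh, pn]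
    have hN : ∀ x ∈ N, x ∉ al A l := fun x hx => (mem_sdiff.1 (hv.1 hx)).2
    apply EE_disj
    · intro a b _ hb _ hb'; exact absurd hb' (hN b hb)
    · intro a b ha hb ha' hb'; simp at ha hb'; rw [ha, hb']
lemma pr_star_prod {X : Finset V} {O : Set (Cfg V)} (hO : Det (EE X X) O) {G : V → Set (Cfg V)} : ∀ (C : Finset V),
    Disjoint C X → (∀ y ∈ C, Det (EE {y} X) (G y)) →
    Det (EE (X ∪ C) X) (O ∩ {c | ∀ y ∈ C, c ∈ G y}) ∧ pr p (O ∩ {c | ∀ y ∈ C, c ∈ G y}) = pr p O * ∏ y ∈ C, pr p (G y) := by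
  intro C
  induction C using Finset.induction_on with
  | empty => intro _ _; simp; exact hO
  | insert a C ha ih =>
    intro hd hG
    rw [disjoint_insert_left] at hd
    obtain ⟨h1, h2⟩ := ih hd.2 fun y hy => hG y (mem_insert_of_mem hy)
    have h3 : O ∩ {c | ∀ y ∈ insert a C, c ∈ G y} = (O ∩ {c | ∀ y ∈ C, c ∈ G y}) ∩ G a := by
      ext c; simp only [Set.mem_inter_iff, Set.mem_ofPred_eq, Finset.forall_mem_insert]; tauto
    have hGa := hG a (mem_insert_self _ _)
    rw [h3, prod_insert ha, pr_indep h1 hGa, h2]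
    · refine ⟨(h1.mono (EE_mono ?_ subset_rfl)).inter (hGa.mono (EE_mono ?_ subset_rfl)), by ring⟩
      · intro x; simp; tauto
      · intro x; simp; tauto
    · apply EE_disj
      · intro x y hx hy hx' hy'
        simp at hx hx'; subst hx'; tauto
      · intro x y hx hy hx' hy'
        simp at hy'; subst hy'; exact absurd hy hd.1
lemma pn_pos (hp1 : p < 1) {h : ℝ} (hh : 0 < h) (A : Finset V) : ∀ (s : ℕ) (l : List (Finset V)), 0 < pn p h A s l := by
  have hF : ∀ s, 0 < 1 - FF p h s := by
    intro s
    have : FF p h s ≤ p * 1 := mll (by linarith [exp_pos (-(s * h))]) hp.out.1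
    linarith
  intro s l
  induction l generalizing s with
  | nil => exact pow_pos (hF _) _
  | cons N l ih => exact mul_pos (pow_pos (hF _) _) (ih _)
lemma FF_step {h : ℝ} (hh : 0 < h) (j : ℕ) :
    1 - FF p h (j + 1) ≤ (1 - FF p h j) * exp (-(p * (1 - exp (-h)) * exp (-(j * h)))) := by
  have hp0 := hp.out.1
  have h1 := add_one_le_exp (-(p * (1 - exp (-h)) * exp (-(j * h))))
  have e1 : 0 < exp (-(j * h)) := exp_pos _
  have e2 : exp (-(j * h)) ≤ 1 := exp_le_one_iff.2 (by have : 0 ≤ j * h := by positivity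
                                                       linarith)
  have e4 : exp (-h) ≤ 1 := exp_le_one_iff.2 (by linarith)
  have e3 : exp (-((j + 1 : ℕ) * h)) = exp (-(j * h)) * exp (-h) := by rw [← exp_add]; push_cast; ring_nf
  have hF0 : 0 ≤ FF p h j := mul_nonneg hp0 (by linarith)
  have hF1 : FF p h j ≤ p * 1 := mll (by linarith) hp0
  have hx : 0 ≤ p * (1 - exp (-h)) * exp (-(j * h)) := mul_nonneg (mul_nonneg hp0 (by linarith)) e1.le
  have h2 := mll h1 (show 0 ≤ 1 - FF p h j by linarith [hp.out.2])
  refine le_trans ?_ h2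
  have h3 : FF p h (j + 1) = FF p h j + p * (1 - exp (-h)) * exp (-(j * h)) := by
    simp only [FF, e3]; ring
  rw [h3]
  have := mul_nonneg hF0 hx
  linarith
lemma pn_step {h : ℝ} (hh : 0 < h) (A : Finset V) : ∀ (s : ℕ) (l : List (Finset V)),
    pn p h A (s + 1) l ≤ pn p h A s l * exp (-(p * (1 - exp (-h)) * (exp (-(s * h)) * Phi h A l))) := by
  have hF : ∀ s, 0 ≤ 1 - FF p h s := by
    intro s
    have : FF p h s ≤ p * 1 := mll (by linarith [exp_pos (-(s * h))]) hp.out.1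
    linarith [hp.out.2]
  have key : ∀ (s k : ℕ), (1 - FF p h (s + 1)) ^ k ≤ (1 - FF p h s) ^ k * exp (-(p * (1 - exp (-h)) * (exp (-(s * h)) * k))) := by
    intro s k
    calc (1 - FF p h (s + 1)) ^ k ≤ ((1 - FF p h s) * exp (-(p * (1 - exp (-h)) * exp (-(s * h))))) ^ k :=
          pow_le_pow_left₀ (hF _) (FF_step hh s) k
      _ = _ := by rw [mul_pow, ← exp_nat_mul]; congr 2; ring
  have pn0 : ∀ s l, 0 ≤ pn p h A s l := by
    intro s l
    induction l generalizing s with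
    | nil => exact pow_nonneg (hF _) _
    | cons N l ih => exact mul_nonneg (pow_nonneg (hF _) _) (ih _)
  intro s l
  induction l generalizing s with
  | nil => exact key s _
  | cons N l ih =>
    simp only [pn, Phi]
    calc _ ≤ ((1 - FF p h s) ^ N.card * exp (-(p * (1 - exp (-h)) * (exp (-(s * h)) * N.card)))) * (pn p h A (s + 1) l * exp (-(p * (1 - exp (-h)) * (exp (-((s + 1 : ℕ) * h)) * Phi h A l)))) :=
          mul_le_mul (key _ _) (ih _) (pn0 _ _) (mul_nonneg (pow_nonneg (hF _) _) (exp_pos _).le)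
      _ = _ := by
        have e3 : exp (-((s + 1 : ℕ) * h)) = exp (-(s * h)) * exp (-h) := by rw [← exp_add]; push_cast; ring_nf
        rw [e3, mul_mul_mul_comm, ← exp_add]; congr 2; ring
def ppi (p h : ℝ) (A : Finset V) (l : List (Finset V)) : ℝ := 1 - pn p h A 1 l / pn p h A 0 l
lemma pr_Ex {h : ℝ} (hh : 0 < h) {A U : Finset V} (hAU : Disjoint A U) {l : List (Finset V)} (hv : Val A U l) :
    pr p {c | Ex h A U c l} = pr p {c | OO h A c l} * pn p h A 0 l ^ (U \ al A l).card := by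
  have h1 : {c | Ex h A U c l} = {c | OO h A c l} ∩ {c | ∀ y ∈ U \ al A l, c ∈ {c | nh h A c y 0 l}} := by
    ext c; simp only [Set.mem_ofPred_eq, Set.mem_inter_iff]; exact Ex_iff hh hv
  rw [h1, (pr_star_prod (det_OO h A U hv) _ sdiff_disjoint fun y hy => det_nh h A 0 (mem_sdiff.1 hy).2).2]
  congr 1
  rw [prod_congr rfl fun y hy => pr_nh hh A U 0 hv (mem_sdiff.1 hy).2, prod_const]
lemma det_Ex {h : ℝ} (hh : 0 < h) {A U : Finset V} {l : List (Finset V)} (hv : Val A U l) :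
    Det (EE (al A l ∪ U \ al A l) (al A l)) {c | Ex h A U c l} := by
  have h1 : {c | Ex h A U c l} = {c | OO h A c l} ∩ {c | ∀ y ∈ U \ al A l, c ∈ {c | nh h A c y 0 l}} := by
    ext c; simp only [Set.mem_ofPred_eq, Set.mem_inter_iff]; exact Ex_iff hh hv
  have hp' : Fact ((0:ℝ) ≤ 0 ∧ (0:ℝ) ≤ 1) := ⟨le_rfl, zero_le_one⟩
  rw [h1]
  exact (pr_star_prod (p := 0) (hp := hp') (det_OO h A U hv) _ sdiff_disjoint fun y hy => det_nh h A 0 (mem_sdiff.1 hy).2).1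
lemma pr_Ex_cons (hp1 : p < 1) {h : ℝ} (hh : 0 < h) {A U : Finset V} (hAU : Disjoint A U) {N : Finset V} {l : List (Finset V)}
    (hv : Val A U (N :: l)) :
    pr p {c | Ex h A U c (N :: l)} = pr p {c | Ex h A U c l} *
      (ppi p h A l ^ N.card * (1 - ppi p h A l) ^ ((U \ al A l).card - N.card)) := by
  have hpos := pn_pos (p := p) hp1 hh A 0 l
  have h1 : {c | OO h A c (N :: l)} = {c | OO h A c l} ∩
      {c | ∀ y ∈ N, c ∈ {c | nh h A c y 0 l} \ {c | nh h A c y 1 l}} := by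
    ext c; simp [OO]
  have hN : ∀ y ∈ N, y ∉ al A l := fun y hy => (mem_sdiff.1 (hv.1 hy)).2
  have h2 : pr p {c | OO h A c (N :: l)} = pr p {c | OO h A c l} * (pn p h A 0 l - pn p h A 1 l) ^ N.card := by
    rw [h1, (pr_star_prod (det_OO h A U hv.2) N (disjoint_left.2 hN) fun y hy => ?_).2]
    · congr 1
      rw [prod_congr rfl (g := fun _ => pn p h A 0 l - pn p h A 1 l), prod_const]
      intro y hy
      rw [← pr_nh hh A U 0 hv.2 (hN y hy), ← pr_nh hh A U 1 hv.2 (hN y hy)]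
      exact measureReal_diff (fun c hc => nh_mono hh (by omega) hc) (det_nh h A 1 (hN y hy)).1
    · exact (det_nh h A 0 (hN y hy)).inter (det_nh h A 1 (hN y hy)).compl
  rw [pr_Ex hh hAU hv, pr_Ex hh hAU hv.2, h2]
  have h3 : pn p h A 0 (N :: l) = pn p h A 1 l := by simp [pn, FF]
  have h4 : (U \ al A (N :: l)).card = (U \ al A l).card - N.card := by
    rw [← card_sdiff_of_subset hv.1]; congr 1; ext x; simp [al]; tauto
  have h5 : N.card ≤ (U \ al A l).card := card_le_card hv.1
  rw [h3, h4, ppi]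
  obtain ⟨m, hm⟩ := Nat.exists_eq_add_of_le h5
  rw [hm, Nat.add_sub_cancel_left, pow_add, sub_sub_cancel]
  have h6 : 1 - pn p h A 1 l / pn p h A 0 l = (pn p h A 0 l - pn p h A 1 l) / pn p h A 0 l := by field_simp
  rw [h6, div_pow, div_pow]
  field_simp
end
end
section
open Finset
variable {V : Type} [Fintype V] [DecidableEq V]
lemma Val.suffix {A U : Finset V} {l l' : List (Finset V)} (h : l' <:+ l) (hv : Val A U l) : Val A U l' := by
  induction l with
  | nil => rw [List.suffix_nil] at h; rw [h]; trivial
  | cons N l ih =>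
    rcases List.suffix_cons_iff.1 h with rfl | h
    · exact hv
    · exact ih h hv.2
lemma Ex.suffix {h : ℝ} {A U : Finset V} {c : Cfg V} {l l' : List (Finset V)} (h' : l' <:+ l) (hv : Ex h A U c l) : Ex h A U c l' := by
  induction l with
  | nil => rw [List.suffix_nil] at h'; rw [h']; trivial
  | cons N l ih =>
    rcases List.suffix_cons_iff.1 h' with rfl | h'
    · exact hv
    · exact ih h' hv.1
lemma al_suffix {A : Finset V} {l l' : List (Finset V)} (h : l' <:+ l) : al A l' ⊆ al A l := by
  induction l with
  | nil => rw [List.suffix_nil] at h; rw [h]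
  | cons N l ih =>
    rcases List.suffix_cons_iff.1 h with rfl | h
    · exact subset_rfl
    · exact (ih h).trans subset_union_right
lemma al_hd {A : Finset V} {y : V} : ∀ {l : List (Finset V)}, y ∈ al A l → ∃ l', l' <:+ l ∧ y ∈ hd A l'
  | [], h => ⟨[], List.suffix_rfl, h⟩
  | N :: l, h => by
    rcases mem_union.1 h with h | h
    · exact ⟨N :: l, List.suffix_rfl, h⟩
    · obtain ⟨l', h1, h2⟩ := al_hd h
      exact ⟨l', h1.trans (List.suffix_cons _ _), h2⟩
lemma hit {h : ℝ} {A : Finset V} {c : Cfg V} {y : V} : ∀ {l : List (Finset V)} {s : ℕ}, ¬ nh h A c y s l →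
    ∃ l', l' <:+ l ∧ ∃ x ∈ hd A l', c s(x, y) ∈ lev h (s + (l.length - l'.length))
  | [], s, H => by
    simp only [nh] at H; push Not at H
    obtain ⟨x, hx, hc⟩ := H
    exact ⟨[], List.suffix_rfl, x, hx, by simpa using hc⟩
  | N :: l, s, H => by
    simp only [nh] at H
    by_cases h1 : ∀ x ∈ N, c s(x, y) ∉ lev h s
    · have h2 : ¬ nh h A c y (s + 1) l := fun h2 => H ⟨h1, h2⟩
      obtain ⟨l', h3, x, hx, hc⟩ := hit h2
      refine ⟨l', h3.trans (List.suffix_cons _ _), x, hx, ?_⟩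
      have := h3.length_le
      have h4 : s + ((N :: l).length - l'.length) = s + 1 + (l.length - l'.length) := by simp; omega
      rwa [h4]
    · push Not at h1
      obtain ⟨x, hx, hc⟩ := h1
      exact ⟨N :: l, List.suffix_rfl, x, hx, by simpa using hc⟩
lemma ledges_snoc (y z : V) : ∀ {l : List V}, l.getLast? = some y → ledges (l ++ [z]) = ledges l ++ [s(y, z)]
  | [], h => by simp at h
  | [x], h => by simp at h; subst h; simp
  | x :: x' :: l, h => by
    have : (x' :: l).getLast? = some y := by simpa using h
    have := ledges_snoc y z this
    simp only [List.cons_append, ledges_cons] at this ⊢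
    rw [this]
lemma SP_mono {c : Cfg V} {X X' : Finset V} {a b : V} {t t' : ℝ} (h : SP c X a b t) (hX : X ⊆ X') (ht : t ≤ t') :
    SP c X' a b t' := by
  obtain ⟨l, ⟨h1, h2, h3⟩, h4, h5⟩ := h
  exact ⟨l, ⟨h1, fun x hx => hX (h2 x hx), h3⟩, h4, h5.trans ht⟩
lemma SP_refl {c : Cfg V} {X : Finset V} {a : V} {t : ℝ} (ha : a ∈ X) (ht : 0 ≤ t) : SP c X a a t :=
  ⟨[a], ⟨by simp, by simpa using ha, by simp, by simp⟩, by simp, by simpa using ht⟩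
lemma SP_snoc {c : Cfg V} {X : Finset V} {a y z : V} {t s : ℝ} (h : SP c X a y t) (hz : z ∉ X)
    (h1 : (c s(y, z)).1 = true) (h2 : (c s(y, z)).2 ≤ s) (hs : 0 ≤ s) : SP c (insert z X) a z (t + s) := by
  obtain ⟨l, ⟨hn, hX, hh, hl⟩, h4, h5⟩ := h
  refine ⟨l ++ [z], ⟨?_, ?_, ?_, by simp⟩, ?_, ?_⟩
  · rw [List.nodup_append]
    refine ⟨hn, by simp, ?_⟩
    intro x hx w hw; simp at hw; subst hw; rintro rfl; exact hz (hX x hx)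
  · intro x hx; simp at hx; rcases hx with hx | rfl
    · exact mem_insert_of_mem (hX x hx)
    · simp
  · cases l with
    | nil => simp at hh
    | cons x l => simpa using hh
  · rw [ledges_snoc y z hl]
    intro e he; simp at he; rcases he with he | rfl
    · exact h4 e he
    · exact h1
  · rw [ledges_snoc y z hl, wts_append, NNReal.coe_add]
    refine add_le_add h5 ?_
    simp; exact ⟨h2, hs⟩
lemma path_hd {h : ℝ} (hh : 0 < h) {A U : Finset V} {c : Cfg V} : ∀ (k : ℕ) (l : List (Finset V)), l.length = k → Val A U l → Ex h A U c l →
    ∀ y ∈ hd A l, ∃ a ∈ A, SP c (al A l) a y (l.length * h) := by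
  intro k
  induction k using Nat.strong_induction_on with
  | _ k ih =>
    intro l hk hv hE y hy
    cases l with
    | nil => exact ⟨y, hy, SP_refl hy (by simp)⟩
    | cons N l =>
      have hyN : y ∈ N := hy
      have hyU := hv.1 hyN
      obtain ⟨l', h1, x, hx, hc⟩ := hit ((hE.2 y hyU).1 hyN)
      have hlen := h1.length_le
      obtain ⟨a, ha, hp⟩ := ih l'.length (by simp at hk; omega) l' rfl (hv.2.suffix h1) (hE.1.suffix h1) x hx
      refine ⟨a, ha, ?_⟩
      have := SP_snoc (SP_mono hp (al_suffix h1) le_rfl) (mem_sdiff.1 hyU).2 hc.1.1 hc.1.2 (by positivity)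
      refine SP_mono this ?_ ?_
      · intro z hz; simp [al] at hz ⊢; rcases hz with rfl | hz
        · exact Or.inl hyN
        · exact Or.inr hz
      · rw [← add_mul]
        apply le_of_eq; congr 1
        rw [← Nat.cast_add]; congr 1
        simp; omega
lemma path_al {h : ℝ} (hh : 0 < h) {A U : Finset V} {c : Cfg V} {l : List (Finset V)} (hv : Val A U l) (hE : Ex h A U c l)
    {y : V} (hy : y ∈ al A l) : ∃ a ∈ A, SP c (al A l) a y (l.length * h) := by
  obtain ⟨l', h1, h2⟩ := al_hd hy
  obtain ⟨a, ha, hp⟩ := path_hd hh _ l' rfl (hv.suffix h1) (hE.suffix h1) y h2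
  refine ⟨a, ha, SP_mono hp (al_suffix h1) ?_⟩
  have : (l'.length : ℝ) ≤ l.length := by exact_mod_cast h1.length_le
  gcongr
lemma Phi_le {h : ℝ} (hh : 0 < h) {A U : Finset V} : ∀ {l : List (Finset V)}, Val A U l → Phi h A l ≤ (al A l).card
  | [], _ => le_rfl
  | N :: l, hv => by
    have : (al A (N :: l)).card = N.card + (al A l).card :=
      card_union_of_disjoint (disjoint_left.2 fun x hx => (mem_sdiff.1 (hv.1 hx)).2)
    rw [this, Phi]; push_cast
    have h1 := Phi_le hh hv.2
    have e4 : exp (-h) ≤ 1 := exp_le_one_iff.2 (by linarith)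
    have : exp (-h) * Phi h A l ≤ 1 * (al A l).card := by
      refine mul_le_mul e4 h1 ?_ zero_le_one
      clear h1 hv this
      induction l with
      | nil => exact Nat.cast_nonneg _
      | cons N l ih => exact add_nonneg (Nat.cast_nonneg _) (mul_nonneg (exp_pos _).le ih)
    linarith
lemma Phi_nonneg {h : ℝ} {A : Finset V} : ∀ {l : List (Finset V)}, 0 ≤ Phi h A l
  | [] => Nat.cast_nonneg _
  | N :: l => add_nonneg (Nat.cast_nonneg _) (mul_nonneg (exp_pos _).le Phi_nonneg)
lemma al_sub {A U : Finset V} : ∀ {l : List (Finset V)}, Val A U l → al A l ⊆ A ∪ U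
  | [], _ => subset_union_left
  | N :: l, hv => union_subset ((hv.1.trans sdiff_subset).trans subset_union_right) (al_sub hv.2)
section
variable {p : ℝ} [hp : Fact (0 ≤ p ∧ p ≤ 1)]
lemma ppi_mem (hp1 : p < 1) {h : ℝ} (hh : 0 < h) (A : Finset V) (l : List (Finset V)) :
    1 - exp (-(p * (1 - exp (-h)) * Phi h A l)) ≤ ppi p h A l ∧ 0 ≤ ppi p h A l ∧ ppi p h A l ≤ 1 := by
  have h0 := pn_pos (p := p) hp1 hh A 0 l
  have h1 := pn_pos (p := p) hp1 hh A 1 l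
  have h2 := pn_step (p := p) hh A 0 l
  simp only [Nat.cast_zero, zero_mul, neg_zero, exp_zero, one_mul, zero_add] at h2
  have h3 : pn p h A 1 l / pn p h A 0 l ≤ exp (-(p * (1 - exp (-h)) * Phi h A l)) := by
    rw [div_le_iff₀ h0]; linarith
  have h4 : exp (-(p * (1 - exp (-h)) * Phi h A l)) ≤ 1 := by
    rw [exp_le_one_iff]
    have e4 : exp (-h) ≤ 1 := exp_le_one_iff.2 (by linarith)
    have := mul_nonneg (mul_nonneg hp.out.1 (show 0 ≤ 1 - exp (-h) by linarith)) (Phi_nonneg (h := h) (A := A) (l := l))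
    linarith
  have h5 : 0 < pn p h A 1 l / pn p h A 0 l := by positivity
  unfold ppi
  refine ⟨by linarith, by linarith, by linarith⟩
theorem growth_rec (hp1 : p < 1) {h : ℝ} (hh : 0 < h) {A U : Finset V} (hAU : Disjoint A U)
    (Bd : Set (Cfg V)) (Tmax : ℕ) (D0 lk ρ c g : ℝ) (hc : 0 < c) (hlk : 0 ≤ lk) (hg : g = ρ + exp (-h)) (hρ : 0 < ρ)
    (Hend : ∀ l, Val A U l → l.length ≤ Tmax → D0 ≤ (al A l).card →
      pr p ({c | Ex h A U c l} ∩ Bd) ≤ pr p {c | Ex h A U c l} * lk)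
    (Hstep : ∀ l, Val A U l → ((al A l).card : ℝ) < D0 →
      ∑ N ∈ (U \ al A l).powerset.filter (fun N => (N.card : ℝ) < ρ * Phi h A l),
        ppi p h A l ^ N.card * (1 - ppi p h A l) ^ ((U \ al A l).card - N.card) ≤ exp (-(c * Phi h A l))) :
    ∀ (T : ℕ) (l : List (Finset V)) (φ : ℝ), Val A U l → 0 ≤ φ → φ ≤ Phi h A l → D0 ≤ φ * g ^ T → l.length + T ≤ Tmax →
      pr p ({c | Ex h A U c l} ∩ Bd) ≤ pr p {c | Ex h A U c l} * (lk + ∑ i ∈ range T, exp (-(c * (φ * g ^ i)))) := by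
  intro T
  have hg0 : 0 < g := by rw [hg]; positivity
  induction T with
  | zero =>
    intro l φ hv h0 h1 h2 h3
    simp only [range_zero, sum_empty, add_zero]
    exact Hend l hv (by omega) (by have := Phi_le hh hv; simp at h2; linarith)
  | succ T ih =>
    intro l φ hv h0 h1 h2 h3
    by_cases hD : D0 ≤ (al A l).card
    · refine (Hend l hv (by omega) hD).trans (mll ?_ (pr_nonneg _))
      have : 0 ≤ ∑ i ∈ range (T + 1), exp (-(c * (φ * g ^ i))) := sum_nonneg fun _ _ => (exp_pos _).le
      linarith
    push Not at hD
    obtain ⟨C, hC⟩ : ∃ C, C = U \ al A l := ⟨_, rfl⟩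
    obtain ⟨pw, hpw⟩ : ∃ pw, pw = ppi p h A l := ⟨_, rfl⟩
    have hst := Hstep l hv hD
    rw [← hC, ← hpw] at hst
    have hvN : ∀ N ∈ C.powerset, Val A U (N :: l) := fun N hN => ⟨hC ▸ mem_powerset.1 hN, hv⟩
    have hprN : ∀ N ∈ C.powerset, pr p {c | Ex h A U c (N :: l)} = pr p {c | Ex h A U c l} *
        (pw ^ N.card * (1 - pw) ^ (C.card - N.card)) := by
      intro N hN; rw [pr_Ex_cons hp1 hh hAU (hvN N hN), hC, hpw]
    have hpwm := ppi_mem (p := p) hp1 hh A l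
    rw [← hpw] at hpwm
    have hq : 0 ≤ 1 - pw := by linarith [hpwm.2.2]
    have hpw0 := hpwm.2.1
    have hsub : {c | Ex h A U c l} ∩ Bd ⊆ ⋃ N ∈ C.powerset, ({c | Ex h A U c (N :: l)} ∩ Bd) := by
      classical
      rintro c ⟨h1, h2⟩
      refine Set.mem_iUnion₂.2 ⟨C.filter (fun y => ¬ nh h A c y 1 l), by simp, ⟨h1, fun y hy => ?_⟩, h2⟩
      rw [← hC] at hy; simp [hy]
    refine (pr_mono hsub).trans ((pr_biUnion_le _ _).trans ?_)
    rw [← sum_filter_add_sum_filter_not C.powerset (fun N => (N.card : ℝ) < ρ * Phi h A l)]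
    obtain ⟨E, hE⟩ : ∃ E, E = lk + ∑ i ∈ range T, exp (-(c * (g * φ * g ^ i))) := ⟨_, rfl⟩
    have hE0 : 0 ≤ E := by rw [hE]; exact add_nonneg hlk (sum_nonneg fun _ _ => (exp_pos _).le)
    have hP0 := pr_nonneg (p := p) {c | Ex h A U c l}
    have hS1 : ∑ N ∈ C.powerset.filter (fun N => (N.card : ℝ) < ρ * Phi h A l), pr p ({c | Ex h A U c (N :: l)} ∩ Bd) ≤
        pr p {c | Ex h A U c l} * exp (-(c * φ)) := by
      calc _ ≤ ∑ N ∈ C.powerset.filter (fun N => (N.card : ℝ) < ρ * Phi h A l), pr p {c | Ex h A U c l} *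
            (pw ^ N.card * (1 - pw) ^ (C.card - N.card)) := by
              refine sum_le_sum fun N hN => ?_
              rw [← hprN N (mem_filter.1 hN).1]
              exact pr_mono Set.inter_subset_left
        _ ≤ pr p {c | Ex h A U c l} * exp (-(c * Phi h A l)) := by
              rw [← mul_sum]; exact mll hst hP0
        _ ≤ _ := by
              refine mll (exp_le_exp.2 (neg_le_neg ?_)) hP0
              exact mll h1 hc.le
    have hS2 : ∑ N ∈ C.powerset.filter (fun N => ¬ (N.card : ℝ) < ρ * Phi h A l), pr p ({c | Ex h A U c (N :: l)} ∩ Bd) ≤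
        pr p {c | Ex h A U c l} * E := by
      calc _ ≤ ∑ N ∈ C.powerset.filter (fun N => ¬ (N.card : ℝ) < ρ * Phi h A l), pr p {c | Ex h A U c l} *
            (pw ^ N.card * (1 - pw) ^ (C.card - N.card)) * E := by
              refine sum_le_sum fun N hN => ?_
              obtain ⟨hN1, hN2⟩ := mem_filter.1 hN
              push Not at hN2
              rw [← hprN N hN1, hE]
              refine ih (N :: l) (g * φ) (hvN N hN1) (by positivity) ?_ ?_ ?_
              · rw [Phi, hg, add_mul]
                have e1 := mll h1 hρ.le
                have e2 := mll h1 (exp_pos (-h)).le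
                linarith
              · rw [pow_succ] at h2; linarith
              · simp; omega
        _ ≤ ∑ N ∈ C.powerset, pr p {c | Ex h A U c l} *
            (pw ^ N.card * (1 - pw) ^ (C.card - N.card)) * E :=
              sum_le_sum_of_subset_of_nonneg (filter_subset _ _) fun _ _ _ => by positivity
        _ = _ := by rw [← sum_mul, ← mul_sum, sum_pow_card]; simp
    rw [sum_range_succ']
    have hE' : E = lk + ∑ i ∈ range T, exp (-(c * (φ * g ^ (i + 1)))) := by
      rw [hE]; congr 1; refine sum_congr rfl fun i _ => ?_; rw [pow_succ]; congr 3; ring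
    rw [pow_zero, mul_one, ← add_assoc, ← hE', mul_add]
    linarith
lemma chernoff (C : Finset V) {pw : ℝ} (h0 : 0 ≤ pw) (h1 : pw ≤ 1) {θ r : ℝ} (hθ : 0 ≤ θ) :
    ∑ N ∈ C.powerset.filter (fun N => (N.card : ℝ) < r), pw ^ N.card * (1 - pw) ^ (C.card - N.card) ≤
      exp (θ * r - C.card * (pw * (1 - exp (-θ)))) := by
  have hq : 0 ≤ 1 - pw := by linarith
  calc _ ≤ ∑ N ∈ C.powerset.filter (fun N => (N.card : ℝ) < r), exp (θ * r) * ((pw * exp (-θ)) ^ N.card * (1 - pw) ^ (C.card - N.card)) := by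
        refine sum_le_sum fun N hN => ?_
        have hN := (mem_filter.1 hN).2
        rw [mul_pow, ← exp_nat_mul]
        have : 1 ≤ exp (θ * r) * exp (N.card * -θ) := by
          rw [← exp_add]; apply one_le_exp
          have := mll hN.le hθ
          linarith
        calc pw ^ N.card * (1 - pw) ^ (C.card - N.card) = 1 * (pw ^ N.card * (1 - pw) ^ (C.card - N.card)) := by rw [one_mul]
          _ ≤ (exp (θ * r) * exp (N.card * -θ)) * (pw ^ N.card * (1 - pw) ^ (C.card - N.card)) := by gcongr
          _ = _ := by ring
    _ ≤ ∑ N ∈ C.powerset, exp (θ * r) * ((pw * exp (-θ)) ^ N.card * (1 - pw) ^ (C.card - N.card)) :=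
        sum_le_sum_of_subset_of_nonneg (filter_subset _ _) fun _ _ _ => by positivity
    _ = exp (θ * r) * (1 - pw * (1 - exp (-θ))) ^ C.card := by
        rw [← mul_sum, sum_pow_card]; congr 2; ring
    _ ≤ exp (θ * r) * exp (-(pw * (1 - exp (-θ)) * C.card)) := by
        refine mll (one_sub_pow_le ?_ _) (exp_pos _).le
        calc pw * (1 - exp (-θ)) ≤ 1 * 1 := by
              refine mul_le_mul h1 (by linarith [exp_pos (-θ)]) ?_ zero_le_one
              have : exp (-θ) ≤ 1 := exp_le_one_iff.2 (by linarith)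
              linarith
          _ = 1 := by norm_num
    _ = _ := by rw [← exp_add]; congr 1; ring
end
end
section
open Finset
variable {V : Type} [Fintype V] [DecidableEq V]
def Gd (c : Cfg V) (X A B : Finset V) (D0 t : ℝ) : Prop :=
  (∃ x ∈ A, ∃ y ∈ B, SP c X x y t) ∧ ∃ T ⊆ X, D0 ≤ T.card ∧ ∀ y ∈ T, ∃ x ∈ A, SP c X x y t
lemma det_nolight {A B : Finset V} (hAB : Disjoint A B) :
    Det (EE A B) {c : Cfg V | ∀ d ∈ A ×ˢ B, c s(d.1, d.2) ∈ (lev 1 1)ᶜ} := by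
  have : {c : Cfg V | ∀ d ∈ A ×ˢ B, c s(d.1, d.2) ∈ (lev 1 1)ᶜ} = (⋃ d ∈ A ×ˢ B, {c : Cfg V | c s(d.1, d.2) ∈ lev 1 1})ᶜ := by
    ext c; simp
  rw [this]
  refine (Det.biUnion _ fun d hd => (det_edge (lev_meas 1 1) _).mono ?_).compl
  rintro e rfl
  obtain ⟨h1, h2⟩ := mem_product.1 hd
  exact ⟨d.1, h1, d.2, h2, fun h => disjoint_left.1 hAB h1 (h ▸ h2), rfl⟩
section
variable {p : ℝ} [hp : Fact (0 ≤ p ∧ p ≤ 1)]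
lemma FF_one_le : p * (1 - exp (-1)) ≤ 1 := by
  have := hp.out
  have e1 := exp_pos (-1)
  have e2 : exp (-1) ≤ 1 := exp_le_one_iff.2 (by norm_num)
  calc p * (1 - exp (-1)) ≤ 1 * 1 := mul_le_mul this.2 (by linarith) (by linarith) zero_le_one
    _ = 1 := one_mul 1
lemma pr_nolight {A B : Finset V} (hAB : Disjoint A B) :
    pr p {c | ∀ d ∈ A ×ˢ B, c s(d.1, d.2) ∈ (lev 1 1)ᶜ} ≤ exp (-(p * (1 - exp (-1)) * (A.card * B.card))) := by
  rw [pr_pairs (p := p) (A ×ˢ B) (pair_inj hAB) (fun _ => (lev 1 1)ᶜ), prod_const, card_product,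
    BE_compl (lev_meas 1 1), BE_lev one_pos]
  have := one_sub_pow_le (p := FF p 1 1) (by simpa [FF] using FF_one_le) (A.card * B.card)
  refine this.trans (le_of_eq ?_)
  simp [FF]
theorem growth_one (hp1 : p < 1) {h : ℝ} (hh : 0 < h) {X A B : Finset V} (hA : A ⊆ X) (hB : B ⊆ X) {K : ℕ} (hAK : A.card = K)
    (hBK : B.card = K) (D0 t ρ c g θ : ℝ) (T : ℕ) (ht : T * h + 1 ≤ t) (hc : 0 < c) (hg : g = ρ + exp (-h)) (hρ : 0 < ρ) (hθ : 0 ≤ θ)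
    (hD0 : 0 ≤ D0) (hT : D0 ≤ K * g ^ T)
    (Hs : ∀ φ m : ℝ, 0 ≤ φ → φ ≤ D0 → X.card - 2 * K - D0 ≤ m →
      θ * (ρ * φ) - m * ((1 - exp (-(p * (1 - exp (-h)) * φ))) * (1 - exp (-θ))) ≤ -(c * φ)) :
    pr p {c : Cfg V | ¬ Gd c X A B D0 t} ≤
      exp (-(p * (1 - exp (-1)) * (D0 * K))) + ∑ i ∈ range T, exp (-(c * (K * g ^ i))) := by
  obtain ⟨U, hU⟩ : ∃ U, U = (X \ A) \ B := ⟨_, rfl⟩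
  have hAU : Disjoint A U := by
    rw [hU, disjoint_left]; intro x hx; simp [hx]
  have hBU : ∀ x ∈ B, x ∉ U := by rw [hU]; intro x hx; simp [hx]
  have hUX : U ⊆ X := by rw [hU]; exact sdiff_subset.trans sdiff_subset
  have h0p := hp.out.1
  have e2 : exp (-1) ≤ 1 := exp_le_one_iff.2 (by norm_num)
  have key := growth_rec (p := p) hp1 hh hAU {c : Cfg V | ¬ Gd c X A B D0 t} T D0 (exp (-(p * (1 - exp (-1)) * (D0 * K)))) ρ c g hc (exp_pos _).le hg hρ
    ?_ ?_ T [] K trivial (Nat.cast_nonneg _) (by simp [Phi, hAK]) hT (by simp)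
  · simp only [Ex] at key
    have hu : pr p {c : Cfg V | True} = 1 := by simp [pr]
    rw [hu, one_mul] at key
    refine le_trans (pr_mono ?_) key
    intro c hc; exact ⟨trivial, hc⟩
  · intro l hv hl hD
    have hal : al A l ⊆ X := (al_sub hv).trans (union_subset hA hUX)
    have hlt : (l.length : ℝ) * h ≤ T * h := by gcongr
    have hT2 : ∀ c, Ex h A U c l → ∃ T ⊆ X, D0 ≤ T.card ∧ ∀ y ∈ T, ∃ x ∈ A, SP c X x y t := by
      intro c hE
      refine ⟨al A l, hal, hD, fun y hy => ?_⟩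
      obtain ⟨a, ha, hp⟩ := path_al hh hv hE hy
      exact ⟨a, ha, SP_mono hp hal (by linarith)⟩
    by_cases hAB : Disjoint A B
    · have hdj : Disjoint (al A l) B := by
        rw [disjoint_left]; intro x hx hxB
        rcases mem_union.1 (al_sub hv hx) with h1 | h1
        · exact disjoint_left.1 hAB h1 hxB
        · exact hBU x hxB h1
      have hsub : {c : Cfg V | Ex h A U c l} ∩ {c : Cfg V | ¬ Gd c X A B D0 t} ⊆ {c : Cfg V | Ex h A U c l} ∩ 
          {c : Cfg V | ∀ d ∈ al A l ×ˢ B, c s(d.1, d.2) ∈ (lev 1 1)ᶜ} := by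
        rintro c ⟨hE, hG⟩
        refine ⟨hE, ?_⟩
        rintro ⟨x, y⟩ hd hcl
        obtain ⟨hx, hy⟩ := mem_product.1 hd
        obtain ⟨a, ha, hp⟩ := path_al hh hv hE hx
        refine hG ⟨⟨a, ha, y, hy, ?_⟩, hT2 c hE⟩
        have hyl : y ∉ al A l := fun h => disjoint_left.1 hdj h hy
        have hc1 : (c s(x, y)).2 ≤ 1 := by have := hcl.1.2; simpa using this
        exact SP_mono (SP_snoc hp hyl hcl.1.1 hc1 zero_le_one) (insert_subset (hB hy) hal) (by linarith)
      refine (pr_mono hsub).trans ?_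
      rw [pr_indep (det_Ex hh hv) (det_nolight hdj)]
      · refine mll ((pr_nolight hdj).trans (exp_le_exp.2 ?_)) (pr_nonneg _)
        rw [hBK]
        have : 0 ≤ p * (1 - exp (-1)) := mul_nonneg h0p (by linarith)
        gcongr
      · have hB' : ∀ y ∈ B, y ∉ al A l ∪ U \ al A l := by
          intro y hy hy'
          rcases mem_union.1 hy' with h1 | h1
          · exact disjoint_left.1 hdj h1 hy
          · exact hBU y hy (mem_sdiff.1 h1).1
        apply EE_disj
        · intro x y hx hy hx' hy'; exact absurd (mem_union_left _ hy) (hB' y hy')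
        · intro x y hx hy hx' hy'; exact absurd hx (hB' x hx')
    · have : {c : Cfg V | Ex h A U c l} ∩ {c : Cfg V | ¬ Gd c X A B D0 t} = ∅ := by
        rw [not_disjoint_iff] at hAB
        obtain ⟨x, hx1, hx2⟩ := hAB
        ext c
        simp only [Set.mem_inter_iff, Set.mem_ofPred_eq, Set.mem_empty_iff_false, iff_false, not_and, not_not]
        intro hE
        exact ⟨⟨x, hx1, x, hx2, SP_refl (hA hx1) (by have : 0 ≤ T * h := by positivity
                                                     linarith)⟩, hT2 c hE⟩
      rw [this]
      have : pr p (∅ : Set (Cfg V)) = 0 := by simp [pr]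
      rw [this]
      exact mul_nonneg (pr_nonneg _) (exp_pos _).le
  · intro l hv hD
    have hm := ppi_mem (p := p) hp1 hh A l
    refine (chernoff (U \ al A l) hm.2.1 hm.2.2 hθ).trans (exp_le_exp.2 ?_)
    have hcard : (X.card : ℝ) - 2 * K - D0 ≤ (U \ al A l).card := by
      have h1 : X.card ≤ (U \ al A l).card + (al A l).card + A.card + B.card := by
        calc X.card ≤ (((U \ al A l) ∪ al A l) ∪ A ∪ B).card := by
              refine card_le_card ?_
              intro x hx; rw [hU]; simp; tauto
          _ ≤ _ := by
              refine (card_union_le _ _).trans (Nat.add_le_add_right ((card_union_le _ _).trans (Nat.add_le_add_right (card_union_le _ _) _)) _)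
      rw [hAK, hBK] at h1
      have : (X.card : ℝ) ≤ (U \ al A l).card + (al A l).card + K + K := by exact_mod_cast h1
      linarith
    refine le_trans ?_ (Hs (Phi h A l) _ Phi_nonneg ((Phi_le hh hv).trans hD.le) hcard)
    have : exp (-θ) ≤ 1 := exp_le_one_iff.2 (by linarith)
    have h2 := mll (mlr hm.1 (show 0 ≤ 1 - exp (-θ) by linarith)) (Nat.cast_nonneg (α := ℝ) (U \ al A l).card)
    linarith
end
end
section
open Finset
variable {V : Type} [Fintype V] [DecidableEq V]
lemma exists_h {lam δ : ℝ} (hlam : 1 < lam) (hδ : 0 < δ) : ∃ l1 h : ℝ, 1 < l1 ∧ l1 < lam ∧ 0 < h ∧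
    h * (lam - 1) ≤ (1 + δ / 2) * log ((1 - exp (-h)) * l1 + exp (-h)) := by
  have hl : 0 < lam - 1 := by linarith
  have h1 : ∀ᶠ h : ℝ in nhdsWithin 0 (Set.Ioi 0), (1 + δ / 4) * ((1 + h) * (1 + h * (lam - 1))) < 1 + δ / 2 := by
    have : Tendsto (fun h : ℝ => (1 + δ / 4) * ((1 + h) * (1 + h * (lam - 1)))) (nhds 0) (nhds ((1 + δ / 4) * ((1 + 0) * (1 + 0 * (lam - 1))))) :=
      (Continuous.tendsto (by fun_prop) 0)
    exact (this.eventually_lt_const (by linarith)).filter_mono nhdsWithin_le_nhds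
  obtain ⟨h, h2, hh⟩ := (h1.and self_mem_nhdsWithin).exists
  have hh : 0 < h := hh
  obtain ⟨d, hd⟩ : ∃ d, d = (lam - 1) / (1 + δ / 4) := ⟨_, rfl⟩
  have hd0 : 0 < d := by rw [hd]; positivity
  have hdl : d * (1 + δ / 4) = lam - 1 := by rw [hd]; field_simp
  have hdlt : d < lam - 1 := by nlinarith
  refine ⟨1 + d, h, by linarith, by linarith, hh, ?_⟩
  obtain ⟨u, hu⟩ : ∃ u, u = (1 - exp (-h)) * d := ⟨_, rfl⟩
  have he : exp (-h) * (1 + h) ≤ 1 := by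
    have := add_one_le_exp h
    calc exp (-h) * (1 + h) ≤ exp (-h) * exp h := by gcongr; linarith
      _ = 1 := by rw [← exp_add]; simp
  have he2 := add_one_le_exp (-h)
  have hek : exp (-h) < 1 := exp_lt_one_iff.2 (by linarith)
  have hu0 : 0 < u := by rw [hu]; exact mul_pos (by linarith) hd0
  have huh : u ≤ h * (lam - 1) := by
    rw [hu]; exact mul_le_mul (by linarith) hdlt.le hd0.le hh.le
  have hu1 : h * d ≤ u * (1 + h) := by
    rw [hu]; nlinarith
  have hlog : u / (1 + u) ≤ log (1 + u) := by
    have := one_sub_inv_le_log_of_pos (show 0 < 1 + u by linarith)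
    have e : u / (1 + u) = 1 - (1 + u)⁻¹ := by field_simp; ring
    linarith
  rw [show (1 - exp (-h)) * (1 + d) + exp (-h) = 1 + u by rw [hu]; ring]
  have hfin : (1 + δ / 4) * ((1 + h) * (1 + u)) ≤ 1 + δ / 2 := by
    refine le_trans ?_ h2.le
    gcongr
  calc h * (lam - 1) = (1 + δ / 4) * (h * d) := by rw [← hdl]; ring
    _ ≤ (1 + δ / 4) * (u * (1 + h)) := by gcongr
    _ = (1 + δ / 4) * ((1 + h) * (1 + u)) * (u / (1 + u)) := by field_simp
    _ ≤ (1 + δ / 2) * (u / (1 + u)) := by gcongr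
    _ ≤ _ := by gcongr
lemma geo_small {c g a η : ℝ} (hc : 0 < c) (hg : 1 < g) (ha : 0 < a) (hη : 0 < η) :
    ∃ K : ℕ, 1 ≤ K ∧ ∀ T : ℕ, exp (-(a * K)) + ∑ i ∈ range T, exp (-(c * (K * g ^ i))) ≤ η := by
  obtain ⟨r, hr⟩ : ∃ r, r = exp (-(c * (g - 1))) := ⟨_, rfl⟩
  have hr0 : 0 < r := hr ▸ exp_pos _
  have hr1 : r < 1 := by rw [hr]; exact exp_lt_one_iff.2 (by have := mul_pos hc (sub_pos.2 hg); linarith)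
  have hlim : Tendsto (fun K : ℕ => exp (-(a * K)) + exp (-(c * K)) * (1 - r)⁻¹) atTop (nhds (0 + 0 * (1 - r)⁻¹)) := by
    refine Tendsto.add ?_ (Tendsto.mul_const _ ?_) <;> refine tendsto_exp_neg_atTop_nhds_zero.comp (tendsto_natCast_atTop_atTop.const_mul_atTop (by assumption))
  obtain ⟨K, h1, hK⟩ := ((hlim.eventually_lt_const (show 0 + 0 * (1 - r)⁻¹ < η by simpa using hη)).and (eventually_ge_atTop 1)).exists
  refine ⟨K, hK, fun T => le_trans ?_ h1.le⟩
  have hK' : (1:ℝ) ≤ K := by exact_mod_cast hK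
  have h2 : ∀ i : ℕ, exp (-(c * (K * g ^ i))) ≤ exp (-(c * K)) * r ^ i := by
    intro i
    rw [hr, ← exp_nat_mul, ← exp_add]
    apply exp_le_exp.2
    have hb := one_add_mul_le_pow (show -2 ≤ g - 1 by linarith) i
    rw [add_sub_cancel] at hb
    have h3 : c * (K * (1 + i * (g - 1))) ≤ c * (K * g ^ i) := by gcongr
    have h4 : 0 ≤ c * ((K - 1) * (i * (g - 1))) := by
      have : 0 ≤ g - 1 := by linarith
      have : (0:ℝ) ≤ K - 1 := by linarith
      positivity
    nlinarith
  have h5 : ∑ i ∈ range T, r ^ i ≤ (1 - r)⁻¹ := by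
    rw [← tsum_geometric_of_lt_one hr0.le hr1]
    exact (summable_geometric_of_lt_one hr0.le hr1).sum_le_tsum _ (fun _ _ => by positivity)
  calc _ ≤ exp (-(a * K)) + ∑ i ∈ range T, exp (-(c * K)) * r ^ i := by gcongr with i; exact h2 i
    _ ≤ _ := by rw [← mul_sum]; gcongr
set_option maxHeartbeats 1000000 in
theorem growth {p : ℕ → ℝ} [hp : ∀ n, Fact (0 ≤ p n ∧ p n ≤ 1)] {lam : ℝ} (hlam : 1 < lam)
    (hlim : Tendsto (fun n : ℕ => ((n : ℝ) + 2) * p n) atTop (nhds lam)) {δ : ℝ} (hδ : 0 < δ) :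
    ∃ δ0 > 0, ∀ η > 0, ∃ K : ℕ, 1 ≤ K ∧ ∀ᶠ n : ℕ in atTop, ∀ X A B : Finset (Fin (n+2)),
      (1 - δ0) * ((n : ℝ) + 2) ≤ X.card → A ⊆ X → B ⊆ X → A.card = K → B.card = K →
      pr (p n) {c | ¬ Gd c X A B (δ0 * ((n : ℝ) + 2)) ((1 + δ) * log ((n : ℝ) + 2) / (lam - 1) + 1)} ≤ η := by
  obtain ⟨l1, h, hl1, hl1', hh, hhl⟩ := exists_h hlam hδ
  have hl : 0 < lam - 1 := by linarith
  obtain ⟨l2, hl2, hl2'⟩ := exists_between hl1'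
  obtain ⟨κ, hκ⟩ : ∃ κ, κ = 1 - exp (-h) := ⟨_, rfl⟩
  have hκ0 : 0 < κ := by rw [hκ]; have : exp (-h) < 1 := exp_lt_one_iff.2 (by linarith)
                         linarith
  have hκ1 : κ < 1 := by rw [hκ]; linarith [exp_pos (-h)]
  obtain ⟨g, hg⟩ : ∃ g, g = κ * l1 + exp (-h) := ⟨_, rfl⟩
  have hg1 : 1 < g := by
    have : g = 1 + κ * (l1 - 1) := by rw [hg, hκ]; ring
    have h2 := mul_pos hκ0 (sub_pos.2 hl1)
    linarith
  rw [← hκ, ← hg] at hhl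
  have hlg : 0 < log g := log_pos hg1
  obtain ⟨θ, hθ⟩ : ∃ θ, θ = (l2 / l1 - 1) / 2 := ⟨_, rfl⟩
  have hθ0 : 0 < θ := by
    rw [hθ]; have : 1 < l2 / l1 := (one_lt_div (by linarith)).2 hl2
    linarith
  have hθ1 : 0 < l2 / (1 + θ) - l1 := by
    rw [sub_pos, lt_div_iff₀ (by linarith)]
    have : l2 = l1 * (1 + 2 * θ) := by rw [hθ]; field_simp; ring
    rw [this]; apply mul_lt_mul_of_pos_left _ (by linarith); linarith
  obtain ⟨c, hc⟩ : ∃ c, c = κ * (θ * (l2 / (1 + θ) - l1)) := ⟨_, rfl⟩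
  have hc0 : 0 < c := by rw [hc]; positivity
  -- δ0
  have hd1 : ∀ᶠ d : ℝ in nhdsWithin 0 (Set.Ioi 0), l2 < lam * (1 - 2 * d) / (1 + 2 * lam * d) := by
    have : Tendsto (fun d : ℝ => lam * (1 - 2 * d) / (1 + 2 * lam * d)) (nhds 0) (nhds (lam * (1 - 2 * 0) / (1 + 2 * lam * 0))) := by
      refine Tendsto.div (Continuous.tendsto (by fun_prop) 0) (Continuous.tendsto (by fun_prop) 0) (by norm_num)
    exact (this.eventually_const_lt (by simpa using hl2')).filter_mono nhdsWithin_le_nhds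
  obtain ⟨δ0, hδ1, hδ0⟩ := (hd1.and self_mem_nhdsWithin).exists
  have hδ0 : 0 < δ0 := hδ0
  have hδ01 : δ0 ≤ 1 := by
    by_contra hcon
    push Not at hcon
    have : lam * (1 - 2 * δ0) / (1 + 2 * lam * δ0) ≤ 0 := by
      apply div_nonpos_of_nonpos_of_nonneg
      · nlinarith
      · positivity
    linarith
  refine ⟨δ0, hδ0, fun η hη => ?_⟩
  have ha : 0 < lam / 2 * (1 - exp (-1)) * δ0 := by
    have : exp (-1) < 1 := exp_lt_one_iff.2 (by norm_num)
    have : 0 < 1 - exp (-1) := by linarith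
    positivity
  obtain ⟨K, hK1, hK⟩ := geo_small hc0 hg1 ha hη
  refine ⟨K, hK1, ?_⟩
  have hlim2 : Tendsto (fun n : ℕ => ((n : ℝ) + 2) * p n * (1 - 2 * δ0 - 2 * K * ((n : ℝ) + 2)⁻¹) / (1 + 2 * lam * δ0)) atTop
      (nhds (lam * (1 - 2 * δ0 - 2 * K * 0) / (1 + 2 * lam * δ0))) := by
    refine Tendsto.div_const (hlim.mul (tendsto_const_nhds.sub (Tendsto.const_mul _ N_tendsto.inv_tendsto_atTop))) _
  have hev := hlim2.eventually_const_lt (show l2 < _ by simpa using hδ1)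
  filter_upwards [hev, (p_tendsto hlim).eventually_lt_const one_pos, hlim.eventually_lt_const (show lam < 2 * lam by linarith),
    hlim.eventually_const_lt (show lam / 2 < lam by linarith), logN_tendsto.eventually_ge_atTop (2 * (h * (lam - 1)) / δ)] with n hn1 hn2 hn3 hn4 hn5
  intro X A B hX hA hB hAK hBK
  obtain ⟨N, hN⟩ : ∃ N : ℝ, N = (n : ℝ) + 2 := ⟨_, rfl⟩
  have hN0 : 2 ≤ N := by rw [hN]; linarith [Nat.cast_nonneg (α := ℝ) n]
  rw [← hN] at hX hn1 hn3 hn4 hn5 ⊢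
  have hp0 := (hp n).out.1
  have hlN : 0 < log N := log_pos (by linarith)
  obtain ⟨T, hT⟩ : ∃ T : ℕ, T = ⌈log N / log g⌉₊ := ⟨_, rfl⟩
  have hT1 : log N ≤ T * log g := by
    rw [← div_le_iff₀ hlg, hT]; exact Nat.le_ceil _
  have hT2 : (T : ℝ) < log N / log g + 1 := by rw [hT]; exact Nat.ceil_lt_add_one (by positivity)
  have hgT : N ≤ g ^ T := by
    rw [← log_le_log_iff (by linarith) (by positivity), log_pow]; exact hT1
  have hK1' : (1:ℝ) ≤ K := by exact_mod_cast hK1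
  refine (growth_one (p := p n) hn2 hh hA hB hAK hBK (δ0 * N) _ (κ * l1) c g θ T ?_ hc0 hg (by positivity) hθ0.le (by positivity) ?_ ?_).trans (le_trans ?_ (hK T))
  · -- time
    have h1 : (T : ℝ) * h ≤ (1 + δ) * log N / (lam - 1) := by
      rw [le_div_iff₀ hl]
      rw [div_le_iff₀ hδ] at hn5
      calc (T : ℝ) * h * (lam - 1) = T * (h * (lam - 1)) := by ring
        _ ≤ (log N / log g + 1) * (h * (lam - 1)) := by gcongr
        _ = log N / log g * (h * (lam - 1)) + h * (lam - 1) := by ring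
        _ ≤ log N / log g * ((1 + δ / 2) * log g) + h * (lam - 1) := by gcongr
        _ = (1 + δ / 2) * log N + h * (lam - 1) := by field_simp
        _ ≤ _ := by linarith
    linarith
  · calc δ0 * N ≤ 1 * g ^ T := by gcongr
      _ ≤ _ := by gcongr
  · intro φ m hφ hφD hm
    rw [← hκ]
    obtain ⟨x, hx⟩ : ∃ x, x = p n * κ * φ := ⟨_, rfl⟩
    have hx0 : 0 ≤ x := by rw [hx]; positivity
    have hx1 : x ≤ 2 * lam * δ0 := by
      calc x ≤ p n * 1 * (δ0 * N) := by rw [hx]; gcongr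
        _ = (N * p n) * δ0 := by ring
        _ ≤ _ := by gcongr
    have hex : x / (1 + 2 * lam * δ0) ≤ 1 - exp (-x) := by
      have h1 : exp (-x) * (1 + x) ≤ 1 := by
        calc exp (-x) * (1 + x) ≤ exp (-x) * exp x := by gcongr; linarith [add_one_le_exp x]
          _ = 1 := by rw [← exp_add]; simp
      calc x / (1 + 2 * lam * δ0) ≤ x / (1 + x) := by gcongr
        _ ≤ 1 - exp (-x) := by rw [div_le_iff₀ (by linarith)]; linarith
    have het : θ / (1 + θ) ≤ 1 - exp (-θ) := by
      have h1 : exp (-θ) * (1 + θ) ≤ 1 := by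
        calc exp (-θ) * (1 + θ) ≤ exp (-θ) * exp θ := by gcongr; linarith [add_one_le_exp θ]
          _ = 1 := by rw [← exp_add]; simp
      rw [div_le_iff₀ (by linarith)]; linarith
    have hm' : N * (1 - 2 * δ0 - 2 * K * N⁻¹) ≤ m := by
      have : N * (1 - 2 * δ0 - 2 * K * N⁻¹) = (1 - δ0) * N - 2 * K - δ0 * N := by field_simp; ring
      linarith
    have hq : l2 * (κ * φ) ≤ m * (x / (1 + 2 * lam * δ0)) := by
      calc l2 * (κ * φ) ≤ (N * p n * (1 - 2 * δ0 - 2 * K * N⁻¹) / (1 + 2 * lam * δ0)) * (κ * φ) := by gcongr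
        _ = N * (1 - 2 * δ0 - 2 * K * N⁻¹) * (x / (1 + 2 * lam * δ0)) := by rw [hx]; ring
        _ ≤ _ := by gcongr
    have hm0 : 0 ≤ m := by
      refine le_trans ?_ hm'
      have h1 : 0 < N * p n * (1 - 2 * δ0 - 2 * K * N⁻¹) / (1 + 2 * lam * δ0) := lt_trans (by linarith) hn1
      rw [div_pos_iff_of_pos_right (by positivity)] at h1
      have h2 : 0 < 1 - 2 * δ0 - 2 * K * N⁻¹ := by
        by_contra hcon
        push Not at hcon
        have := mul_nonpos_of_nonneg_of_nonpos (show 0 ≤ N * p n by positivity) hcon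
        linarith
      positivity
    rw [← hx]
    have hbig : l2 * (κ * φ) * (θ / (1 + θ)) ≤ m * ((1 - exp (-x)) * (1 - exp (-θ))) := by
      rw [← mul_assoc m]
      have hl20 : 0 < l2 := by linarith
      refine mul_le_mul (hq.trans (mll hex hm0)) het (by positivity) ?_
      refine mul_nonneg hm0 (le_trans (by positivity) hex)
    have : c * φ = l2 * (κ * φ) * (θ / (1 + θ)) - θ * (κ * l1 * φ) := by rw [hc]; field_simp
    linarith
  · have : exp (-(p n * (1 - exp (-1)) * (δ0 * N * K))) ≤ exp (-(lam / 2 * (1 - exp (-1)) * δ0 * K)) := by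
      apply exp_le_exp.2
      have e1 : exp (-1) < 1 := exp_lt_one_iff.2 (by norm_num)
      have e2 : 0 < 1 - exp (-1) := by linarith
      have : lam / 2 * (1 - exp (-1)) * δ0 * K ≤ N * p n * (1 - exp (-1)) * δ0 * K := by gcongr
      linarith
    linarith
end
section
open Finset
variable {V : Type} [Fintype V] [DecidableEq V]
lemma SP_cons {c : Cfg V} {X : Finset V} {a y z : V} {t s : ℝ} (h : SP c X y z t) (ha : a ∉ X)
    (h1 : (c s(a, y)).1 = true) (h2 : (c s(a, y)).2 ≤ s) (hs : 0 ≤ s) : SP c (insert a X) a z (t + s) := by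
  obtain ⟨l, ⟨hn, hX, hh, hl⟩, h4, h5⟩ := h
  cases l with
  | nil => simp at hh
  | cons x l =>
    simp at hh; subst hh
    refine ⟨a :: x :: l, ⟨?_, ?_, by simp, by simpa using hl⟩, ?_, ?_⟩
    · rw [List.nodup_cons]; exact ⟨fun h => ha (hX a h), hn⟩
    · intro w hw; rw [List.mem_cons] at hw; rcases hw with rfl | hw
      · simp
      · exact mem_insert_of_mem (hX w hw)
    · intro e he
      rw [ledges_cons, List.mem_cons] at he; rcases he with rfl | he
      · exact h1
      · exact h4 e he
    · rw [ledges_cons, wts_cons, NNReal.coe_add]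
      have : (((c s(a, x)).2.toNNReal : ℝ≥0) : ℝ) ≤ s := by simp; exact ⟨h2, hs⟩
      linarith
def LN (c : Cfg V) (a : V) (R A : Finset V) : Prop := ∀ r ∈ R, r ∈ A ↔ c s(a, r) ∈ lev 1 1
def lstar (c : Cfg V) (R : Finset V) (a : V) (K : ℕ) : Prop := ∃ A ⊆ R, A.card = K ∧ ∀ r ∈ A, c s(a, r) ∈ lev 1 1
lemma det_LN {a : V} {R : Finset V} (ha : a ∉ R) (A : Finset V) : Det (EE {a} R) {c | LN c a R A} := by
  have : {c | LN c a R A} = (⋃ r ∈ R, {c | c s(a, r) ∈ (if r ∈ A then (lev 1 1)ᶜ else lev 1 1)})ᶜ := by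
    ext c; simp only [LN, Set.compl_iUnion, Set.mem_iInter, Set.mem_compl_iff, Set.mem_ofPred_eq]
    refine forall₂_congr fun r hr => ?_
    split_ifs with h <;> simp [h]
  rw [this]
  refine (Det.biUnion _ fun r hr => Det.mono (T := {s(a, r)}) ?_ ?_).compl
  · split_ifs
    · exact det_edge (lev_meas 1 1).compl _
    · exact det_edge (lev_meas 1 1) _
  · rintro e rfl; exact ⟨a, by simp, r, hr, by rintro rfl; exact ha hr, rfl⟩
lemma star_eq (R : Finset V) (a : V) (K : ℕ) :
    {c | lstar c R a K} = ⋃ A ∈ R.powerset.filter (fun A => K ≤ A.card), {c | LN c a R A} := by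
  classical
  ext c
  simp only [Set.mem_ofPred_eq, Set.mem_iUnion, mem_filter, mem_powerset, exists_prop]
  constructor
  · rintro ⟨A, h1, h2, h3⟩
    refine ⟨R.filter (fun r => c s(a, r) ∈ lev 1 1), ⟨filter_subset _ _, ?_⟩, fun r hr => by simp [hr]⟩
    rw [← h2]; exact card_le_card fun r hr => by simp [h1 hr, h3 r hr]
  · rintro ⟨A, ⟨h1, h2⟩, h3⟩
    obtain ⟨A', h4, h5⟩ := exists_subset_card_eq h2
    exact ⟨A', h4.trans h1, h5, fun r hr => (h3 r (h1 (h4 hr))).1 (h4 hr)⟩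
lemma det_star {a : V} {R : Finset V} (ha : a ∉ R) (K : ℕ) : Det (EE {a} R) {c | lstar c R a K} := by
  rw [star_eq]; exact Det.biUnion _ fun A _ => det_LN ha A
lemma LN_disj (a : V) (R : Finset V) (s : Finset (Finset V)) (hs : ∀ A ∈ s, A ⊆ R) :
    (s : Set (Finset V)).PairwiseDisjoint fun A => {c | LN c a R A} := by
  intro A hA B hB hAB
  rw [Function.onFun, Set.disjoint_left]
  intro c h1 h2
  apply hAB
  ext x
  exact ⟨fun h => (h2 x (hs A hA h)).2 ((h1 x (hs A hA h)).1 h), fun h => (h1 x (hs B hB h)).2 ((h2 x (hs B hB h)).1 h)⟩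
lemma det_Gd (X A B : Finset V) (D0 t : ℝ) : Det (EE X X) {c | Gd c X A B D0 t} := by
  have : {c | Gd c X A B D0 t} = (⋃ x ∈ A, ⋃ y ∈ B, {c | SP c X x y t}) ∩
      (⋃ T : {T : Finset V // T ⊆ X ∧ D0 ≤ T.card}, (⋃ y ∈ T.1, (⋃ x ∈ A, {c | SP c X x y t})ᶜ)ᶜ) := by
    ext c; simp [Gd, and_assoc]
  rw [this]
  refine Det.inter (Det.biUnion _ fun x _ => Det.biUnion _ fun y _ => det_SP _ _ _ _) (Det.iUnion fun T => ?_)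
  exact (Det.biUnion _ fun y _ => (Det.biUnion _ fun x _ => det_SP _ _ _ _).compl).compl
def Big (c : Cfg V) (X : Finset V) (a : V) (D0 t : ℝ) : Prop := ∃ T ⊆ X, D0 ≤ T.card ∧ ∀ y ∈ T, SP c X a y t
def Bad (c : Cfg V) (X : Finset V) (a b : V) (D0 tl t : ℝ) (k : ℕ) : Prop :=
  SP c X a b tl ∨ SPk c X a b t k ∨ ¬ (SP c X a b t ∧ Big c X a D0 t)
lemma det_Bad (X : Finset V) (a b : V) (D0 tl t : ℝ) (k : ℕ) : Det (EE X X) {c | Bad c X a b D0 tl t k} := by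
  have : {c | Bad c X a b D0 tl t k} = (({c | SP c X a b tl}ᶜ ∩ {c | SPk c X a b t k}ᶜ) ∩ 
      ({c | SP c X a b t} ∩ ⋃ T : {T : Finset V // T ⊆ X ∧ D0 ≤ T.card}, (⋃ y ∈ T.1, {c | SP c X a y t}ᶜ)ᶜ))ᶜ := by
    ext c
    have : Big c X a D0 t ↔ c ∈ ⋃ T : {T : Finset V // T ⊆ X ∧ D0 ≤ T.card}, (⋃ y ∈ T.1, {c | SP c X a y t}ᶜ)ᶜ := by
      simp [Big, and_assoc]
    simp only [Bad, this, Set.mem_compl_iff, Set.mem_inter_iff, Set.mem_ofPred_eq]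
    tauto
  rw [this]
  refine Det.compl (((det_SP _ _ _ _).compl.inter (det_SPk _ _ _ _ _).compl).inter ((det_SP _ _ _ _).inter (Det.iUnion fun T => ?_)))
  exact (Det.biUnion _ fun y _ => (det_SP _ _ _ _).compl).compl
section
variable {p : ℝ} [hp : Fact (0 ≤ p ∧ p ≤ 1)]
lemma pr_star_ge {a : V} (m : ℕ) : ∀ (K : ℕ) (R : Finset V), a ∉ R → K * m ≤ R.card →
    (1 - exp (-(p * (1 - exp (-1)) * m))) ^ K ≤ pr p {c | lstar c R a K}
  | 0, R, ha, hR => by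
    have : {c | lstar c R a 0} = Set.univ := by
      ext c; simp only [Set.mem_ofPred_eq, Set.mem_univ, iff_true]
      exact ⟨∅, by simp, by simp, by simp⟩
    rw [this]; simp [pr]
  | K + 1, R, ha, hR => by
    obtain ⟨R2, h1, h2⟩ := exists_subset_card_eq (show m ≤ R.card by nlinarith)
    have ha2 : a ∉ R2 := fun h => ha (h1 h)
    have ha1 : a ∉ R \ R2 := fun h => ha (mem_sdiff.1 h).1
    have ih := pr_star_ge m K (R \ R2) ha1 (by
      rw [card_sdiff_of_subset h1, h2]; rw [add_mul, one_mul] at hR; omega)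
    have hn := pr_nolight (p := p) (A := {a}) (B := R2) (by simpa using ha2)
    rw [h2, card_singleton, Nat.cast_one, one_mul] at hn
    have hd := det_nolight (A := {a}) (B := R2) (by simpa using ha2)
    have hc : pr p {c | ∀ d ∈ ({a} : Finset V) ×ˢ R2, c s(d.1, d.2) ∈ (lev 1 1)ᶜ}ᶜ = 
        1 - pr p {c | ∀ d ∈ ({a} : Finset V) ×ˢ R2, c s(d.1, d.2) ∈ (lev 1 1)ᶜ} := probReal_compl_eq_one_sub hd.1
    have hprod := pr_indep (p := p) (det_star ha1 K) hd.compl (by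
      apply EE_disj
      · intro x y hx hy hx' hy'; exact absurd hy' (mem_sdiff.1 hy).2
      · intro x y hx hy hx' hy'; simp at hx; subst hx; exact absurd hx' ha2)
    have hsub : {c | lstar c (R \ R2) a K} ∩ {c | ∀ d ∈ ({a} : Finset V) ×ˢ R2, c s(d.1, d.2) ∈ (lev 1 1)ᶜ}ᶜ ⊆
        {c | lstar c R a (K + 1)} := by
      rintro c ⟨⟨A, hA1, hA2, hA3⟩, h⟩
      simp only [Set.mem_compl_iff, Set.mem_ofPred_eq, not_forall, not_not] at h
      obtain ⟨⟨a', r⟩, hd, hl⟩ := h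
      simp at hd hl
      obtain ⟨hr, rfl⟩ := hd
      refine ⟨insert r A, insert_subset (h1 hr) (hA1.trans sdiff_subset), ?_, ?_⟩
      · rw [card_insert_of_notMem, hA2]
        intro h; exact (mem_sdiff.1 (hA1 h)).2 hr
      · intro x hx; rw [mem_insert] at hx; rcases hx with rfl | hx
        · exact hl
        · exact hA3 x hx
    refine le_trans ?_ (pr_mono hsub)
    rw [hprod, hc, pow_succ]
    have h0 : 0 ≤ 1 - exp (-(p * (1 - exp (-1)) * m)) := by
      have e2 : exp (-1) ≤ 1 := exp_le_one_iff.2 (by norm_num)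
      have : 0 ≤ p * (1 - exp (-1)) * m := mul_nonneg (mul_nonneg hp.out.1 (by linarith)) (Nat.cast_nonneg _)
      have := exp_le_one_iff.2 (show -(p * (1 - exp (-1)) * m) ≤ 0 by linarith)
      linarith
    exact mul_le_mul ih (by linarith) h0 (pr_nonneg _)
lemma star_link {X R : Finset V} {a b : V} (hab : a ≠ b) (ha : a ∈ X) (hb : b ∈ X) (hR : R ⊆ X) (haR : a ∉ R) (hbR : b ∉ R)
    {K : ℕ} {D0 t η : ℝ} (ht : 0 ≤ t)
    (H : ∀ A B : Finset V, A ⊆ (X.erase a).erase b → B ⊆ (X.erase a).erase b → A.card = K → B.card = K →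
      pr p {c | ¬ Gd c ((X.erase a).erase b) A B D0 t} ≤ η) :
    pr p ({c | lstar c R a K} ∩ {c | lstar c R b K} ∩ {c | ¬ (SP c X a b (t + 2) ∧ Big c X a D0 (t + 2))}) ≤
      η * (pr p {c | lstar c R a K} * pr p {c | lstar c R b K}) := by
  classical
  obtain ⟨P, hP⟩ : ∃ P, P = R.powerset.filter (fun A => K ≤ A.card) := ⟨_, rfl⟩
  obtain ⟨Y, hY⟩ : ∃ Y, Y = (X.erase a).erase b := ⟨_, rfl⟩
  rw [← hY] at H
  have hPR : ∀ A ∈ P, A ⊆ R := fun A hA => by rw [hP, mem_filter, mem_powerset] at hA; exact hA.1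
  have hRY : R ⊆ Y := by
    intro x hx; rw [hY]; simp only [mem_erase]
    exact ⟨by rintro rfl; exact hbR hx, by rintro rfl; exact haR hx, hR hx⟩
  have haY : a ∉ Y := by rw [hY]; simp
  have hbY : b ∉ Y := by rw [hY]; simp
  have hbY' : b ∉ insert a Y := by simp [hbY, hab.symm]
  have hYX : insert a Y ⊆ X := by
    intro x hx; rw [hY] at hx; simp only [mem_insert, mem_erase] at hx
    rcases hx with rfl | hx
    · exact ha
    · exact hx.2.2
  have hsa : pr p {c | lstar c R a K} = ∑ A ∈ P, pr p {c | LN c a R A} := by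
    rw [star_eq, ← hP]; exact pr_biUnion P _ (fun A _ => (det_LN haR A).1) (LN_disj a R P hPR)
  have hsb : pr p {c | lstar c R b K} = ∑ A ∈ P, pr p {c | LN c b R A} := by
    rw [star_eq, ← hP]; exact pr_biUnion P _ (fun A _ => (det_LN hbR A).1) (LN_disj b R P hPR)
  have hex : ∀ A ∈ P, ∃ A' ⊆ A, A'.card = K := fun A hA => by
    rw [hP, mem_filter] at hA; exact exists_subset_card_eq hA.2
  choose! f hf1 hf2 using hex
  have hsub : {c | lstar c R a K} ∩ {c | lstar c R b K} ∩ {c | ¬ (SP c X a b (t + 2) ∧ Big c X a D0 (t + 2))} ⊆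
      ⋃ A ∈ P, ⋃ B ∈ P, ({c | LN c a R A} ∩ ({c | LN c b R B} ∩ {c | Gd c Y (f A) (f B) D0 t}ᶜ)) := by
    rw [star_eq, star_eq, ← hP]
    rintro c ⟨⟨h1, h2⟩, h3⟩
    obtain ⟨A, hA, h1⟩ := Set.mem_iUnion₂.1 h1
    obtain ⟨B, hB, h2⟩ := Set.mem_iUnion₂.1 h2
    refine Set.mem_iUnion₂.2 ⟨A, hA, Set.mem_iUnion₂.2 ⟨B, hB, h1, h2, fun hG => h3 ?_⟩⟩
    have hlA : ∀ x ∈ f A, c s(a, x) ∈ lev 1 1 := fun x hx => (h1 x (hPR A hA (hf1 A hA hx))).1 (hf1 A hA hx)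
    have hlB : ∀ x ∈ f B, c s(b, x) ∈ lev 1 1 := fun x hx => (h2 x (hPR B hB (hf1 B hB hx))).1 (hf1 B hB hx)
    have hc1 : ∀ x ∈ f A, ∀ y, SP c Y x y t → SP c (insert a Y) a y (t + 1) := fun x hx y hp =>
      SP_cons hp haY (hlA x hx).1.1 (by have := (hlA x hx).1.2; simpa using this) zero_le_one
    obtain ⟨⟨x, hx, y, hy, hp⟩, T, hT, hD, hT2⟩ := hG
    refine ⟨?_, T, (hT.trans (subset_insert _ _)).trans hYX, hD, fun y hy => ?_⟩
    · have h5 := SP_snoc (hc1 x hx y hp) hbY' (z := b) (s := 1) (by have := (hlB y hy).1.1; rwa [Sym2.eq_swap] at this)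
        (by have := (hlB y hy).1.2; rw [Sym2.eq_swap] at this; simpa using this) zero_le_one
      exact SP_mono h5 (insert_subset hb hYX) (by linarith)
    · obtain ⟨x, hx, hp⟩ := hT2 y hy
      exact SP_mono (hc1 x hx y hp) hYX (by linarith)
  refine (pr_mono hsub).trans ((pr_biUnion_le _ _).trans ?_)
  rw [hsa, hsb, sum_mul_sum, mul_sum]
  refine sum_le_sum fun A hA => (pr_biUnion_le _ _).trans ?_
  rw [mul_sum]
  refine sum_le_sum fun B hB => ?_
  rw [pr_indep (det_LN haR A) ((det_LN hbR B).inter2 (det_Gd Y (f A) (f B) D0 t).compl), pr_indep (det_LN hbR B) (det_Gd Y (f A) (f B) D0 t).compl]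
  · have := H (f A) (f B) ((hf1 A hA).trans ((hPR A hA).trans hRY)) ((hf1 B hB).trans ((hPR B hB).trans hRY)) (hf2 A hA) (hf2 B hB)
    have h1 := pr_nonneg (p := p) {c | LN c a R A}
    have h2 := pr_nonneg (p := p) {c | LN c b R B}
    calc _ ≤ pr p {c | LN c a R A} * (pr p {c | LN c b R B} * η) := by
          refine mll (mll this h2) h1
      _ = _ := by ring
  · apply EE_disj
    · intro x y hx hy hx' hy'; simp at hx; subst hx; exact absurd hx' hbY
    · intro x y hx hy hx' hy'; simp at hx; subst hx; exact absurd hx' hbY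
  · rw [Set.disjoint_union_right]
    constructor
    · apply EE_disj
      · intro x y hx hy hx' hy'; simp at hx hx'; exact absurd (hx.symm.trans hx') hab
      · intro x y hx hy hx' hy'; simp at hx hy'; subst hx; exact absurd hx' haR
    · apply EE_disj
      · intro x y hx hy hx' hy'; simp at hx; subst hx; exact absurd hx' haY
      · intro x y hx hy hx' hy'; simp at hx; subst hx; exact absurd hx' haY
end
set_option maxHeartbeats 1000000 in
theorem bad_small {p : ℕ → ℝ} [hp : ∀ n, Fact (0 ≤ p n ∧ p n ≤ 1)] {lam : ℝ} (hlam : 1 < lam)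
    (hlim : Tendsto (fun n : ℕ => ((n : ℝ) + 2) * p n) atTop (nhds lam)) {ε : ℝ} (hε : 0 < ε) (hε1 : ε < 1) :
    ∃ δ0 > 0, ∃ tu : ℕ → ℝ, ∀ η > 0, ∃ K : ℕ, 1 ≤ K ∧ ∀ δ1 > 0, ∃ s0 > 0, ∀ᶠ n : ℕ in atTop, ∀ (X R : Finset (Fin (n+2))) (a b : Fin (n+2)) (k : ℕ),
      (1 - δ0 / 2) * ((n : ℝ) + 2) ≤ X.card → δ1 * ((n : ℝ) + 2) ≤ R.card → a ≠ b → a ∈ X → b ∈ X → R ⊆ X → a ∉ R → b ∉ R →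
      (k : ℝ) ≤ (1 - ε) * lam / (lam - 1) * log ((n : ℝ) + 2) →
      s0 ≤ pr (p n) {c : Cfg _ | lstar c R a K} ∧
      pr (p n) ({c : Cfg _ | lstar c R a K} ∩ {c : Cfg _ | lstar c R b K} ∩
        {c : Cfg _ | Bad c X a b (δ0 * ((n : ℝ) + 2)) ((1 - ε) * log ((n : ℝ) + 2) / (lam - 1)) (tu n) k}) ≤
      η * (pr (p n) {c : Cfg _ | lstar c R a K} * pr (p n) {c : Cfg _ | lstar c R b K}) := by
  obtain ⟨δ, hδ, Hh⟩ := short_hops hlam hlim hε hε1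
  obtain ⟨δ0, hδ0, Hg⟩ := growth hlam hlim hδ
  refine ⟨δ0, hδ0, fun n => (1 + δ) * log ((n : ℝ) + 2) / (lam - 1) + 3, fun η hη => ?_⟩
  obtain ⟨K, hK, Hg⟩ := Hg (η / 3) (by positivity)
  refine ⟨K, hK, fun δ1 hδ1 => ?_⟩
  have hK' : (0:ℝ) < K := by exact_mod_cast hK
  have e1 : exp (-1) < 1 := exp_lt_one_iff.2 (by norm_num)
  obtain ⟨s0, hs0⟩ : ∃ s0, s0 = (1 - exp (-((1 - exp (-1)) * (lam * δ1 / (4 * K))))) ^ K := ⟨_, rfl⟩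
  have hbase : 0 < 1 - exp (-((1 - exp (-1)) * (lam * δ1 / (4 * K)))) := by
    rw [sub_pos, exp_lt_one_iff]
    have : 0 < (1 - exp (-1)) * (lam * δ1 / (4 * K)) := mul_pos (by linarith) (by positivity)
    linarith
  have hs00 : 0 < s0 := by rw [hs0]; positivity
  refine ⟨s0, hs00, ?_⟩
  filter_upwards [Hg, Hh (η / 3 * (s0 * s0)) (by positivity), short_low hlam hlim hε hε1 (η := η / 3 * (s0 * s0)) (by positivity),
    hlim.eventually_const_lt (show lam / 2 < lam by linarith), N_tendsto.eventually_ge_atTop (2 * K / δ1), N_tendsto.eventually_ge_atTop (4 / δ0)] with n h1 h2 h3 h4 h5 h6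
  intro X R a b k hX hR hab ha hb hRX haR hbR hk
  have hn0 := Nat.cast_nonneg (α := ℝ) n
  obtain ⟨N, hN⟩ : ∃ N : ℝ, N = (n : ℝ) + 2 := ⟨_, rfl⟩
  rw [← hN] at hX hR hk h4 h5 h6 ⊢
  rw [← hN] at h1 h2 h3
  have hN1 : 2 ≤ N := by linarith
  have hst : ∀ a : Fin (n+2), a ∉ R → s0 ≤ pr (p n) {c : Cfg _ | lstar c R a K} := by
    intro a ha
    obtain ⟨m, hm⟩ : ∃ m : ℕ, m = ⌊δ1 * N / K⌋₊ := ⟨_, rfl⟩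
    have hm1 : (m : ℝ) ≤ δ1 * N / K := by rw [hm]; exact Nat.floor_le (by positivity)
    have hm2 : δ1 * N / K - 1 < m := by rw [hm]; exact Nat.sub_one_lt_floor _
    have hm3 : δ1 * N / (2 * K) ≤ m := by
      rw [div_le_iff₀ hδ1] at h5
      have : 1 ≤ δ1 * N / (2 * K) := by rw [le_div_iff₀ (by positivity)]; linarith
      have : δ1 * N / K = 2 * (δ1 * N / (2 * K)) := by field_simp
      linarith
    refine le_trans ?_ (pr_star_ge (p := p n) (a := a) m K R ha ?_)
    · rw [hs0]
      refine pow_le_pow_left₀ hbase.le (sub_le_sub_left (exp_le_exp.2 (neg_le_neg ?_)) _) _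
      have h0 := (hp n).out.1
      have : lam * δ1 / (4 * K) ≤ p n * m := by
        calc lam * δ1 / (4 * K) = lam / 2 * (δ1 / (2 * K)) := by field_simp; norm_num
          _ ≤ N * p n * (δ1 / (2 * K)) := by gcongr
          _ = p n * (δ1 * N / (2 * K)) := by ring
          _ ≤ _ := by gcongr
      have := mll this (show 0 ≤ 1 - exp (-1) by linarith)
      linarith
    · have : (K : ℝ) * m ≤ R.card := by
        rw [le_div_iff₀ hK'] at hm1; linarith
      exact_mod_cast this
  have hsa := hst a haR
  have hsb := hst b hbR
  refine ⟨hsa, ?_⟩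
  have hss : s0 * s0 ≤ pr (p n) {c : Cfg _ | lstar c R a K} * pr (p n) {c : Cfg _ | lstar c R b K} :=
    mul_le_mul hsa hsb hs00.le (pr_nonneg _)
  obtain ⟨Q, hQ⟩ : ∃ Q, Q = pr (p n) {c : Cfg _ | lstar c R a K} * pr (p n) {c : Cfg _ | lstar c R b K} := ⟨_, rfl⟩
  rw [← hQ] at hss ⊢
  obtain ⟨t, ht⟩ : ∃ t, t = (1 + δ) * log N / (lam - 1) + 1 := ⟨_, rfl⟩
  have hlN : 0 < log N := log_pos (by linarith)
  have ht0 : 0 ≤ t := by rw [ht]; have : 0 < lam - 1 := by linarith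
                         positivity
  have hlink := star_link (p := p n) hab ha hb hRX haR hbR (K := K) (D0 := δ0 * N) (t := t) (η := η / 3) ht0 (by
    intro A B hA hB hAK hBK
    rw [ht]
    refine h1 _ A B ?_ hA hB hAK hBK
    have : X.card ≤ ((X.erase a).erase b).card + 2 := by
      have := card_erase_add_one ha
      have := card_erase_add_one (s := X.erase a) (a := b) (by simp [hb, hab.symm])
      omega
    have : (X.card : ℝ) ≤ ((X.erase a).erase b).card + 2 := by exact_mod_cast this
    rw [div_le_iff₀ hδ0] at h6
    linarith)
  have ht3 : (1 + δ) * log N / (lam - 1) + 3 = t + 2 := by rw [ht]; ring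
  have e2 := h2 X a b k hab hk
  have e3 := h3 X a b hab
  rw [ht3] at e2 ⊢
  rw [← hQ] at hlink
  have hfin : ({c : Cfg _ | lstar c R a K} ∩ {c : Cfg _ | lstar c R b K} ∩
        {c : Cfg _ | Bad c X a b (δ0 * N) ((1 - ε) * log N / (lam - 1)) (t + 2) k}) ⊆
      ({c | SP c X a b ((1 - ε) * log N / (lam - 1))} ∪ {c | SPk c X a b (t + 2) k}) ∪
      ({c : Cfg _ | lstar c R a K} ∩ {c : Cfg _ | lstar c R b K} ∩ {c : Cfg _ | ¬ (SP c X a b (t + 2) ∧ Big c X a (δ0 * N) (t + 2))}) := by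
    rintro c ⟨hs, h | h | h⟩
    · exact Or.inl (Or.inl h)
    · exact Or.inl (Or.inr h)
    · exact Or.inr ⟨hs, h⟩
  refine (pr_mono hfin).trans ((pr_union_le _ _).trans ?_)
  have := pr_union_le (p := p n) {c | SP c X a b ((1 - ε) * log N / (lam - 1))} {c | SPk c X a b (t + 2) k}
  have := mll hss (show 0 ≤ η / 3 by positivity)
  linarith
end
section
open Finset
variable {V : Type} [Fintype V] [DecidableEq V]
lemma sm_bound {p : ℝ} [hp : Fact (0 ≤ p ∧ p ≤ 1)] {ι : Type*} (s : Finset ι) (E : ι → Set (Cfg V)) (B : ι → ι → Set (Cfg V))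
    (hE : ∀ i ∈ s, MeasurableSet (E i)) (hB : ∀ i j, MeasurableSet (B i j)) {m η : ℝ} (hm : m = ∑ i ∈ s, pr p (E i)) (hm0 : 0 < m)
    (h1 : ∑ i ∈ s, ∑ j ∈ s, pr p (E i ∩ E j) ≤ (1 + η) * m ^ 2)
    (h2 : ∑ i ∈ s, ∑ j ∈ s, pr p (E i ∩ E j ∩ B i j) ≤ η * m ^ 2) :
    pr p {c | ∀ i ∈ s, ∀ j ∈ s, c ∈ E i → c ∈ E j → c ∈ B i j} ≤ 4 * η := by
  let u : Set (Cfg V) → Cfg V → ℝ := fun A => A.indicator 1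
  have ui : ∀ A, MeasurableSet A → Integrable (u A) (PP V p) := fun A hA =>
    (integrable_const (1:ℝ)).indicator hA
  have ue : ∀ A, MeasurableSet A → ∫ c, u A c ∂(PP V p) = pr p A := fun A hA => integral_indicator_one hA
  have um : ∀ A B c, u A c * u B c = u (A ∩ B) c := fun A B c => by
    by_cases h : c ∈ A <;> by_cases h' : c ∈ B <;> simp [u, h, h']
  let f : Cfg V → ℝ := fun c => (∑ i ∈ s, ∑ j ∈ s, u (E i ∩ E j) c) - 2 * m * (∑ i ∈ s, u (E i) c) + m ^ 2
    + ∑ i ∈ s, ∑ j ∈ s, u (E i ∩ E j ∩ B i j) c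
  have f1 : ∀ c, f c = ((∑ i ∈ s, u (E i) c) - m) ^ 2 + ∑ i ∈ s, ∑ j ∈ s, u (E i ∩ E j ∩ B i j) c := by
    intro c
    have : (∑ i ∈ s, u (E i) c) * (∑ i ∈ s, u (E i) c) = ∑ i ∈ s, ∑ j ∈ s, u (E i ∩ E j) c := by
      rw [sum_mul_sum]; simp_rw [um]
    simp only [f]; rw [← this]; ring
  have i1 : Integrable (fun c => ∑ i ∈ s, ∑ j ∈ s, u (E i ∩ E j) c) (PP V p) :=
    integrable_finsetSum _ fun i hi => integrable_finsetSum _ fun j hj => ui _ ((hE i hi).inter (hE j hj))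
  have i2 : Integrable (fun c => ∑ i ∈ s, ∑ j ∈ s, u (E i ∩ E j ∩ B i j) c) (PP V p) :=
    integrable_finsetSum _ fun i hi => integrable_finsetSum _ fun j hj => ui _ (((hE i hi).inter (hE j hj)).inter (hB i j))
  have i3 : Integrable (fun c => ∑ i ∈ s, u (E i) c) (PP V p) :=
    integrable_finsetSum _ fun i hi => ui _ (hE i hi)
  have i4 : Integrable (fun c => (∑ i ∈ s, ∑ j ∈ s, u (E i ∩ E j) c) - 2 * m * (∑ i ∈ s, u (E i) c)) (PP V p) := i1.sub (i3.const_mul _)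
  have i5 : Integrable (fun c => (∑ i ∈ s, ∑ j ∈ s, u (E i ∩ E j) c) - 2 * m * (∑ i ∈ s, u (E i) c) + m ^ 2) (PP V p) := i4.add (integrable_const _)
  have fi : Integrable f (PP V p) := i5.add i2
  have fe : ∫ c, f c ∂(PP V p) = (∑ i ∈ s, ∑ j ∈ s, pr p (E i ∩ E j)) - 2 * m * m + m ^ 2 + ∑ i ∈ s, ∑ j ∈ s, pr p (E i ∩ E j ∩ B i j) := by
    simp only [f]
    rw [integral_add i5 i2, integral_add i4 (integrable_const _),
      integral_sub i1 (i3.const_mul _), integral_const_mul, integral_const]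
    rw [integral_finsetSum _ fun i hi => integrable_finsetSum _ fun j hj => ui _ ((hE i hi).inter (hE j hj)),
      integral_finsetSum _ fun i hi => integrable_finsetSum _ fun j hj => ui _ (((hE i hi).inter (hE j hj)).inter (hB i j)),
      integral_finsetSum _ fun i hi => ui _ (hE i hi)]
    have a1 : ∀ i ∈ s, ∫ c, ∑ j ∈ s, u (E i ∩ E j) c ∂(PP V p) = ∑ j ∈ s, pr p (E i ∩ E j) := fun i hi => by
      rw [integral_finsetSum _ fun j hj => ui _ ((hE i hi).inter (hE j hj))]
      exact sum_congr rfl fun j hj => ue _ ((hE i hi).inter (hE j hj))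
    have a2 : ∀ i ∈ s, ∫ c, ∑ j ∈ s, u (E i ∩ E j ∩ B i j) c ∂(PP V p) = ∑ j ∈ s, pr p (E i ∩ E j ∩ B i j) := fun i hi => by
      rw [integral_finsetSum _ fun j hj => ui _ (((hE i hi).inter (hE j hj)).inter (hB i j))]
      exact sum_congr rfl fun j hj => ue _ (((hE i hi).inter (hE j hj)).inter (hB i j))
    rw [sum_congr rfl a1, sum_congr rfl a2, sum_congr rfl fun i hi => ue _ (hE i hi), ← hm]
    simp
  have mk := mul_meas_ge_le_integral_of_nonneg (μ := PP V p) (f := f) (ae_of_all _ fun c => by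
    rw [f1]; exact add_nonneg (sq_nonneg _) (sum_nonneg fun i hi => sum_nonneg fun j hj =>
      Set.indicator_nonneg (fun _ _ => zero_le_one) _)) fi (m ^ 2 / 2)
  have hsub : pr p {c | ∀ i ∈ s, ∀ j ∈ s, c ∈ E i → c ∈ E j → c ∈ B i j} ≤ (PP V p).real {c | m ^ 2 / 2 ≤ f c} := by
    refine pr_mono fun c hc => ?_
    have hZ : ∑ i ∈ s, ∑ j ∈ s, u (E i ∩ E j ∩ B i j) c = (∑ i ∈ s, u (E i) c) * (∑ i ∈ s, u (E i) c) := by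
      rw [sum_mul_sum]
      refine sum_congr rfl fun i hi => sum_congr rfl fun j hj => ?_
      rw [um]
      by_cases h : c ∈ E i ∩ E j
      · simp only [u]; rw [Set.indicator_of_mem h, Set.indicator_of_mem (show c ∈ E i ∩ E j ∩ B i j from ⟨h, hc i hi j hj h.1 h.2⟩)]
      · simp only [u]; rw [Set.indicator_of_notMem h, Set.indicator_of_notMem fun h' => h h'.1]
    show m ^ 2 / 2 ≤ f c
    rw [f1, hZ]
    nlinarith [sq_nonneg (2 * (∑ i ∈ s, u (E i) c) - m)]
  have : m ^ 2 / 2 * pr p {c | ∀ i ∈ s, ∀ j ∈ s, c ∈ E i → c ∈ E j → c ∈ B i j} ≤ 2 * η * m ^ 2 := by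
    calc _ ≤ _ := mll hsub (by positivity)
      _ ≤ _ := mk
      _ ≤ _ := by rw [fe]; linarith
  have hm2 : 0 < m ^ 2 := by positivity
  nlinarith
def Fq (c : Cfg V) (w : ℝ) (q : List V) (S : Finset V) : Prop :=
  (∀ T ⊆ S, T.Nonempty → T ≠ S → ∃ x ∈ T, ∃ y ∈ S \ T, adj (bb c) x y) ∧
  (∃ lv : V → ℕ, (∀ i (hi : i < q.length), lv q[i] = i) ∧
    ∀ x ∈ S, ∀ y ∈ S, adj (bb c) x y → lv x < lv y → ∃ i, q[i]? = some x ∧ q[i+1]? = some y) ∧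
  (∀ e ∈ ledges q, (c e).1 = true) ∧ w ≤ wts c (ledges q)
def qok (k : ℕ) (S : Finset V) (r : V) (q : List V) : Prop :=
  q.Nodup ∧ q.length = k + 1 ∧ (∀ x ∈ q, x ∈ S) ∧ q.getLast? = some r
def InS (c : Cfg V) (k : ℕ) (w : ℝ) (S : Finset V) (r : V) : Prop := ∃ q, qok k S r q ∧ Fq c w q S
lemma det_Fq {S : Finset V} {q : List V} (hn : q.Nodup) (hX : ∀ x ∈ q, x ∈ S) (w : ℝ) : Det (EE S S) {c : Cfg V | Fq c w q S} := by
  refine (det_b (fun b => ∀ T ⊆ S, T.Nonempty → T ≠ S → ∃ x ∈ T, ∃ y ∈ S \ T, adj b x y) ?_).inter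
    ((det_b (fun b => ∃ lv : V → ℕ, (∀ i (hi : i < q.length), lv q[i] = i) ∧
    ∀ x ∈ S, ∀ y ∈ S, adj b x y → lv x < lv y → ∃ i, q[i]? = some x ∧ q[i+1]? = some y) ?_).inter ?_)
  · intro b b' hb h T hT h1 h2
    obtain ⟨x, hx, y, hy, ha⟩ := h T hT h1 h2
    exact ⟨x, hx, y, hy, adj_congr hb (hT hx) (mem_sdiff.1 hy).1 ha⟩
  · rintro b b' hb ⟨lv, h1, h2⟩
    exact ⟨lv, h1, fun x hx y hy ha => h2 x hx y hy (adj_congr (fun e he => (hb e he).symm) hx hy ha)⟩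
  · refine ⟨?_, fun c c' hc h => ?_⟩
    · refine MeasurableSet.inter ?_ ?_
      · have : {c : Cfg V | ∀ e ∈ ledges q, (c e).1 = true} = ⋂ e ∈ (ledges q).toFinset, {c : Cfg V | c e ∈ {z : Bool × ℝ | z.1 = true}} := by
          ext c; simp
        change MeasurableSet {c : Cfg V | ∀ e ∈ ledges q, (c e).1 = true}
        rw [this]; exact measurableSet_biInter _ fun e _ => (det_edge meas_true e).1
      · exact measurableSet_le measurable_const (meas_wts _).coe_nnreal_real
    · have he : ∀ e ∈ ledges q, c e = c' e := fun e he => hc e (ledges_EE hn hX e he)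
      refine ⟨fun e h' => he e h' ▸ h.1 e h', ?_⟩
      have : wts c' (ledges q) = wts c (ledges q) := by
        unfold wts; congr 1; exact List.map_congr_left fun e h' => by rw [he e h']
      rw [this]; exact h.2
lemma det_InS (k : ℕ) (w : ℝ) (S : Finset V) (r : V) : Det (EE S S) {c | InS c k w S r} := by
  have : {c | InS c k w S r} = ⋃ q : List V, {c | qok k S r q ∧ Fq c w q S} := by
    ext c; simp [InS]
  rw [this]
  refine Det.iUnion fun q => ?_
  by_cases h : qok k S r q
  · simp only [h, true_and]; exact det_Fq h.1 h.2.2.1 w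
  · simp only [h, false_and]; exact Det.ofEmpty
def Exit (b : Sym2 V → Bool) (S U : Finset V) (r a : V) : Prop :=
  adj b r a ∧ ∀ x ∈ S, ∀ y ∈ U, adj b x y → x = r ∧ y = a
lemma det_Exit {S U : Finset V} {r a : V} (hr : r ∈ S) (ha : a ∈ U) : Det (EE S U) {c | Exit (bb c) S U r a} :=
  det_b (fun b => Exit b S U r a) fun b b' hb h => ⟨adj_congr hb hr ha h.1, fun x hx y hy hxy =>
    h.2 x hx y hy (adj_congr (fun e he => (hb e he).symm) hx hy hxy)⟩
lemma pr_Exit {p : ℝ} [hp : Fact (0 ≤ p ∧ p ≤ 1)] {S U : Finset V} (h : Disjoint S U) {r a : V} (hr : r ∈ S) (ha : a ∈ U) :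
    pr p {c | Exit (bb c) S U r a} = p * (1 - p) ^ (S.card * U.card - 1) := by
  have := pr_pairs (p := p) (S ×ˢ U) (pair_inj h) (fun d => if d = (r, a) then {z | z.1 = true} else {z | ¬ z.1 = true})
  have hm : (r, a) ∈ S ×ˢ U := mk_mem_product hr ha
  have hne : ∀ x ∈ S, ∀ y ∈ U, x ≠ y := fun x hx y hy he => disjoint_left.1 h hx (he ▸ hy)
  rw [← mul_prod_erase _ _ hm, if_pos rfl, BE_true, prod_congr rfl (fun d hd => by
    rw [if_neg (ne_of_mem_erase hd), BE_false]), prod_const, card_erase_of_mem hm, card_product] at this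
  rw [← this]; congr 1; ext c
  simp only [Set.mem_ofPred_eq, Exit]
  constructor
  · rintro ⟨h1, h2⟩ ⟨x, y⟩ hd
    rw [mem_product] at hd
    split_ifs with he
    · rw [Prod.mk.injEq] at he; obtain ⟨rfl, rfl⟩ := he; exact h1.2
    · intro hz
      obtain ⟨rfl, rfl⟩ := h2 x hd.1 y hd.2 ⟨hne _ hd.1 _ hd.2, hz⟩
      exact he rfl
  · intro H
    refine ⟨⟨hne _ hr _ ha, by simpa [bb] using H _ hm⟩, fun x hx y hy hxy => ?_⟩
    have := H (x, y) (mk_mem_product hx hy)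
    by_contra hcon
    rw [if_neg (by rw [Prod.mk.injEq]; exact hcon)] at this
    exact this hxy.2
def Es (c : Cfg V) (R : Finset V) (K k : ℕ) (w : ℝ) (S : Finset V) (r a : V) : Prop :=
  a ∉ S ∧ InS c k w S r ∧ Exit (bb c) S (univ \ S) r a ∧ lstar c R a K
end
section
open Finset
variable {V : Type} [Fintype V] [DecidableEq V]
section
variable {c : Cfg V} {R W : Finset V} {K k : ℕ} {w : ℝ} {S S' : Finset V} {r r' a a' : V}
lemma Es.r_mem (h : Es c R K k w S r a) : r ∈ S := by
  obtain ⟨_, ⟨q, hq, _⟩, _⟩ := h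
  exact hq.2.2.1 r (List.mem_of_getLast? hq.2.2.2)
lemma Es.a_notin (hK : 1 ≤ K) (hWR : Disjoint W R) (h : Es c R K k w S r a) (h' : Es c R K k w S' r' a')
    (hS' : S' ⊆ W) (ha : a ∈ W) (ha' : a' ∈ W) : a ∉ S' := by
  intro haS
  obtain ⟨A, hA, hc, h1⟩ := h.2.2.2
  obtain ⟨z, hz⟩ := card_pos.1 (hc ▸ hK)
  have hzR := hA hz
  have hzW : z ∉ W := fun hw => disjoint_left.1 hWR hw hzR
  have := h'.2.2.1.2 a haS z (mem_sdiff.2 ⟨mem_univ _, fun hz => hzW (hS' hz)⟩)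
    ⟨fun he => hzW (he ▸ ha), (h1 z hz).1.1⟩
  exact hzW (this.2 ▸ ha')
lemma Es.sub (hK : 1 ≤ K) (hWR : Disjoint W R) (h : Es c R K k w S r a) (h' : Es c R K k w S' r' a')
    (hS' : S' ⊆ W) (ha : a ∈ W) (ha' : a' ∈ W) (hne : ¬ Disjoint S S') : S' ⊆ S := by
  by_contra hcon
  obtain ⟨q, hq, hF⟩ := h'.2.1
  obtain ⟨x, hx, y, hy, hxy⟩ := hF.1 (S ∩ S') inter_subset_right (not_disjoint_iff_nonempty_inter.1 hne)
    (fun he => hcon (inter_eq_right.1 he))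
  simp only [Finset.mem_inter, Finset.mem_sdiff, not_and] at hx hy
  have := h.2.2.1.2 x hx.1 y (mem_sdiff.2 ⟨mem_univ _, fun hyS => hy.2 hyS hy.1⟩) hxy
  exact h.a_notin hK hWR h' hS' ha ha' (this.2 ▸ hy.1)
lemma Es.eq (h : Es c R K k w S r a) (h' : Es c R K k w S r' a') : r = r' ∧ a = a' :=
  h'.2.2.1.2 r h.r_mem a (mem_sdiff.2 ⟨mem_univ _, h.1⟩) h.2.2.1.1
end
section
variable {p : ℝ} [hp : Fact (0 ≤ p ∧ p ≤ 1)]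
def gS (p : ℝ) (k : ℕ) (w : ℝ) (S : Finset V) (r : V) : ℝ :=
  pr p {c | InS c k w S r} * (p * (1 - p) ^ (S.card * (univ \ S).card - 1))
lemma gS_nonneg (k : ℕ) (w : ℝ) (S : Finset V) (r : V) : 0 ≤ gS p k w S r :=
  mul_nonneg (pr_nonneg _) (mul_nonneg hp.out.1 (pow_nonneg (by linarith [hp.out.2]) _))
lemma meas_Es (R : Finset V) (K k : ℕ) (w : ℝ) (S : Finset V) (r a : V) (haR : a ∉ R) : MeasurableSet {c | Es c R K k w S r a} := by
  by_cases h : a ∉ S ∧ r ∈ S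
  · have : {c | Es c R K k w S r a} = {c | InS c k w S r} ∩ ({c | Exit (bb c) S (univ \ S) r a} ∩ {c | lstar c R a K}) := by
      ext c; simp [Es, h.1]
    rw [this]
    exact (det_InS k w S r).1.inter ((det_Exit h.2 (by simpa using h.1)).1.inter (det_star haR K).1)
  · have : {c | Es c R K k w S r a} = ∅ := by
      ext c; simp only [Set.mem_ofPred_eq, Set.mem_empty_iff_false, iff_false]
      exact fun h' => h ⟨h'.1, h'.r_mem⟩
    rw [this]; exact MeasurableSet.empty
lemma pr_Es {R W : Finset V} (hWR : Disjoint W R) (K k : ℕ) (w : ℝ) {S : Finset V} {r a : V} (hS : S ⊆ W) (hr : r ∈ S) (ha : a ∈ W) (haS : a ∉ S) :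
    pr p {c | Es c R K k w S r a} = gS p k w S r * pr p {c | lstar c R a K} := by
  have haR : a ∉ R := disjoint_left.1 hWR ha
  have hSR : ∀ x ∈ S, x ∉ R := fun x hx => disjoint_left.1 hWR (hS hx)
  have hd : Disjoint S (univ \ S) := disjoint_sdiff
  have : {c | Es c R K k w S r a} = {c | InS c k w S r} ∩ {c | Exit (bb c) S (univ \ S) r a} ∩ {c | lstar c R a K} := by
    ext c; simp [Es, haS, and_assoc]
  rw [this, pr_indep ((det_InS k w S r).inter2 (det_Exit hr (by simpa using haS))) (det_star haR K), pr_indep (det_InS k w S r) (det_Exit hr (by simpa using haS)),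
    pr_Exit hd hr (by simpa using haS), gS]
  · exact EE_disj (by grind) (by grind)
  · rw [Set.disjoint_union_left]
    exact ⟨EE_disj (by grind) (by grind), EE_disj (by grind) (by grind)⟩
lemma pr_pair {R W : Finset V} (hWR : Disjoint W R) (K k L : ℕ) (w : ℝ) {S S' : Finset V} {r r' a a' : V} (hS : S ⊆ W) (hS' : S' ⊆ W)
    (hSL : S.card ≤ L) (hSL' : S'.card ≤ L) (hr : r ∈ S) (hr' : r' ∈ S') (ha : a ∈ W) (ha' : a' ∈ W)
    (haS : a ∉ S) (haS' : a ∉ S') (haS2 : a' ∉ S) (haS2' : a' ∉ S') (hdis : Disjoint S S') (Q : Set (Cfg V))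
    (hQ : Det (EE (univ \ (S ∪ S')) (univ \ (S ∪ S'))) Q) :
    (1 - p) ^ (2 * L ^ 2) * pr p ({c | Es c R K k w S r a} ∩ {c | Es c R K k w S' r' a'} ∩ Q) ≤
      gS p k w S r * gS p k w S' r' * pr p ({c | lstar c R a K} ∩ {c | lstar c R a' K} ∩ Q) := by
  obtain ⟨U, hU⟩ : ∃ U, U = univ \ (S ∪ S') := ⟨_, rfl⟩
  rw [← hU] at hQ
  have memU : ∀ x, x ∈ U ↔ x ∉ S ∧ x ∉ S' := by intro x; rw [hU]; simp
  have haR : a ∉ R := disjoint_left.1 hWR ha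
  have haR' : a' ∉ R := disjoint_left.1 hWR ha'
  have hd := disjoint_left.1 hdis
  have hRU : ∀ x ∈ R, x ∈ U := fun x hx => (memU x).2 ⟨fun h => disjoint_left.1 hWR (hS h) hx, fun h => disjoint_left.1 hWR (hS' h) hx⟩
  have haU : a ∈ U := (memU a).2 ⟨haS, haS'⟩
  have haU' : a' ∈ U := (memU a').2 ⟨haS2, haS2'⟩
  have hst : Det (EE U U) ({c | lstar c R a K} ∩ {c | lstar c R a' K} ∩ Q) :=
    (((det_star haR K).mono (EE_mono (by simpa using haU) hRU)).inter ((det_star haR' K).mono (EE_mono (by simpa using haU') hRU))).inter hQ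
  have hSU : Disjoint S U := disjoint_left.2 fun x hx hx' => ((memU x).1 hx').1 hx
  have hSU' : Disjoint S' U := disjoint_left.2 fun x hx hx' => ((memU x).1 hx').2 hx
  have dI := det_InS (V := V) k w S r
  have dI' := det_InS (V := V) k w S' r'
  have dX := det_Exit (V := V) (S := S) (U := U) hr haU
  have dX' := det_Exit (V := V) (S := S') (U := U) hr' haU'
  have hsub : {c | Es c R K k w S r a} ∩ {c | Es c R K k w S' r' a'} ∩ Q ⊆
      ({c | InS c k w S r} ∩ {c | Exit (bb c) S U r a}) ∩ (({c | InS c k w S' r'} ∩ {c | Exit (bb c) S' U r' a'}) ∩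
      ({c | lstar c R a K} ∩ {c | lstar c R a' K} ∩ Q)) := by
    rintro c ⟨⟨h1, h2⟩, h3⟩
    exact ⟨⟨h1.2.1, h1.2.2.1.1, fun x hx y hy => h1.2.2.1.2 x hx y (by simpa using ((memU y).1 hy).1)⟩,
      ⟨h2.2.1, h2.2.2.1.1, fun x hx y hy => h2.2.2.1.2 x hx y (by simpa using ((memU y).1 hy).2)⟩, ⟨h1.2.2.2, h2.2.2.2⟩, h3⟩
  have hUS : U.card + S'.card = (univ \ S).card := by
    rw [← card_union_of_disjoint hSU'.symm]; congr 1; ext x; have := memU x; have := @hd x; simp; tauto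
  have hUS' : U.card + S.card = (univ \ S').card := by
    rw [← card_union_of_disjoint hSU.symm]; congr 1; ext x; have := memU x; have := @hd x; simp; tauto
  have hs1 : 1 ≤ S.card * U.card := Nat.mul_pos (card_pos.2 ⟨r, hr⟩) (card_pos.2 ⟨a, haU⟩)
  have hs1' : 1 ≤ S'.card * U.card := Nat.mul_pos (card_pos.2 ⟨r', hr'⟩) (card_pos.2 ⟨a, haU⟩)
  have e1 : S.card * (univ \ S).card - 1 = (S.card * U.card - 1) + S.card * S'.card := by
    rw [← hUS, mul_add]; omega
  have e2 : S'.card * (univ \ S').card - 1 = (S'.card * U.card - 1) + S.card * S'.card := by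
    rw [← hUS', mul_add, mul_comm S'.card S.card]; omega
  have h0 : 0 ≤ 1 - p := by linarith [hp.out.2]
  have h1 : 1 - p ≤ 1 := by linarith [hp.out.1]
  have hρ : (1 - p) ^ (2 * L ^ 2) ≤ (1 - p) ^ (S.card * S'.card) * (1 - p) ^ (S.card * S'.card) := by
    rw [← pow_add]; refine pow_le_pow_of_le_one h0 h1 ?_
    have : S.card * S'.card ≤ L * L := Nat.mul_le_mul hSL hSL'
    rw [pow_two]; omega
  have hmain := pr_mono (p := p) hsub
  rw [pr_indep (dI.inter2 dX) ((dI'.inter2 dX').inter2 hst), pr_indep (dI'.inter2 dX') hst, pr_indep dI dX, pr_indep dI' dX', pr_Exit hSU hr haU, pr_Exit hSU' hr' haU'] at hmain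
  · rw [gS, gS, e1, e2, pow_add, pow_add]
    have hp0 := hp.out.1
    calc _ ≤ _ := mul_le_mul hρ hmain (pr_nonneg _) (by positivity)
      _ = _ := by ring
  · exact EE_disj (by grind) (by grind)
  · exact EE_disj (by grind) (by grind)
  · rw [Set.disjoint_union_left]
    exact ⟨EE_disj (by grind) (by grind), EE_disj (by grind) (by grind)⟩
  · rw [Set.disjoint_union_left, Set.disjoint_union_right, Set.disjoint_union_right, Set.disjoint_union_right, Set.disjoint_union_right]
    exact ⟨⟨⟨EE_disj (by grind) (by grind), EE_disj (by grind) (by grind)⟩, EE_disj (by grind) (by grind)⟩, 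
      ⟨EE_disj (by grind) (by grind), EE_disj (by grind) (by grind)⟩, EE_disj (by grind) (by grind)⟩
end
end
section
open Finset
variable {V : Type} [Fintype V] [DecidableEq V]
def Ix (W : Finset V) (L : ℕ) : Finset (Finset V × V) := by
  classical exact univ.filter fun x => x.1 ⊆ W ∧ x.1.card ≤ L ∧ x.2 ∈ x.1
lemma mem_Ix {W : Finset V} {L : ℕ} {x : Finset V × V} : x ∈ Ix W L ↔ x.1 ⊆ W ∧ x.1.card ≤ L ∧ x.2 ∈ x.1 := by simp [Ix]
lemma G_le_m {p : ℝ} [hp : Fact (0 ≤ p ∧ p ≤ 1)] {R W : Finset V} (hWR : Disjoint W R) {K k L : ℕ} {w s0 : ℝ} (hs0 : 0 ≤ s0)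
    (hst : ∀ a ∈ W, s0 ≤ pr p {c | lstar c R a K}) :
    (∑ x ∈ Ix W L, gS p k w x.1 x.2) * (s0 * ((W.card : ℝ) - L)) ≤ ∑ x ∈ Ix W L, ∑ a ∈ W, pr p {c | Es c R K k w x.1 x.2 a} := by
  rw [Finset.sum_mul]
  refine Finset.sum_le_sum fun x hx => ?_
  have h1 := mem_Ix.1 hx
  calc gS p k w x.1 x.2 * (s0 * ((W.card : ℝ) - L)) ≤ gS p k w x.1 x.2 * (s0 * ((W \ x.1).card : ℝ)) := by
        refine mll (mll ?_ hs0) (gS_nonneg _ _ _ _)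
        rw [Finset.card_sdiff_of_subset h1.1, Nat.cast_sub (Finset.card_le_card h1.1)]
        have : (x.1.card : ℝ) ≤ L := by exact_mod_cast h1.2.1
        linarith
    _ = ∑ a ∈ W \ x.1, gS p k w x.1 x.2 * s0 := by rw [Finset.sum_const, nsmul_eq_mul]; ring
    _ ≤ ∑ a ∈ W \ x.1, pr p {c | Es c R K k w x.1 x.2 a} := by
        refine Finset.sum_le_sum fun a ha => ?_
        rw [Finset.mem_sdiff] at ha
        rw [pr_Es hWR K k w h1.1 h1.2.2 ha.1 ha.2]
        exact mll (hst a ha.1) (gS_nonneg _ _ _ _)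
    _ ≤ _ := Finset.sum_le_sum_of_subset_of_nonneg Finset.sdiff_subset fun _ _ _ => pr_nonneg _
def GoodPair (c : Cfg V) (R W : Finset V) (K k L : ℕ) (w : ℝ) (Bf : Finset V → V → V → Set (Cfg V)) : Prop :=
  ∃ S r a S' r' a', Es c R K k w S r a ∧ Es c R K k w S' r' a' ∧ Disjoint S S' ∧ a ≠ a' ∧ a ∉ S' ∧ a' ∉ S ∧ c ∉ Bf (univ \ (S ∪ S')) a a'
theorem tent_pairs {p : ℝ} [hp : Fact (0 ≤ p ∧ p ≤ 1)] {R W : Finset V} (hWR : Disjoint W R) {K k L : ℕ} (hK : 1 ≤ K) {w s0 η m : ℝ} (hη : 0 < η) (hη1 : η ≤ 1)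
    (hs0 : 0 ≤ s0) {Bf : Finset V → V → V → Set (Cfg V)} (hBf : ∀ U a b, Det (EE U U) (Bf U a b))
    (hst : ∀ a ∈ W, s0 ≤ pr p {c | lstar c R a K})
    (hbad : ∀ S S' a a', S ⊆ W → S' ⊆ W → S.card ≤ L → S'.card ≤ L → a ∈ W → a' ∈ W → a ≠ a' → a ∉ S → a ∉ S' → a' ∉ S → a' ∉ S' →
      pr p ({c | lstar c R a K} ∩ {c | lstar c R a' K} ∩ Bf (univ \ (S ∪ S')) a a') ≤
        η * (pr p {c | lstar c R a K} * pr p {c | lstar c R a' K}))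
    (hρ : 1 ≤ (1 + η) * (1 - p) ^ (2 * L ^ 2)) (hW : 1 + η ≤ η * (s0 * ((W.card : ℝ) - L)))
    (hmd : m = ∑ x ∈ Ix W L, ∑ a ∈ W, pr p {c | Es c R K k w x.1 x.2 a}) (hm : 1 ≤ η * m) :
    pr p {c | ¬ GoodPair c R W K k L w Bf} ≤ 16 * η := by
  classical
  let s : Finset ((Finset V × V) × V) := Ix W L ×ˢ W
  let E : (Finset V × V) × V → Set (Cfg V) := fun i => {c | Es c R K k w i.1.1 i.1.2 i.2}
  let g : (Finset V × V) × V → ℝ := fun i => gS p k w i.1.1 i.1.2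
  let Cond : (Finset V × V) × V → (Finset V × V) × V → Prop := fun i j => Disjoint i.1.1 j.1.1 ∧ i.2 ≠ j.2 ∧ i.2 ∉ j.1.1 ∧ j.2 ∉ i.1.1
  let B : (Finset V × V) × V → (Finset V × V) × V → Set (Cfg V) := fun i j => if Cond i j then Bf (univ \ (i.1.1 ∪ j.1.1)) i.2 j.2 else Set.univ
  have hms : ∀ i ∈ s, i.1.1 ⊆ W ∧ i.1.1.card ≤ L ∧ i.1.2 ∈ i.1.1 ∧ i.2 ∈ W := fun i hi => by
    have h := mem_product.1 hi
    have h1 := mem_Ix.1 h.1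
    exact ⟨h1.1, h1.2.1, h1.2.2, h.2⟩
  have hWR' : ∀ a ∈ W, a ∉ R := fun a ha => disjoint_left.1 hWR ha
  have hm' : m = ∑ i ∈ s, pr p (E i) := by rw [hmd, sum_product]
  have hm0 : 0 < m := by by_contra hcon; push Not at hcon; nlinarith
  have hE : ∀ i ∈ s, MeasurableSet (E i) := fun i hi => meas_Es R K k w _ _ _ (hWR' _ (hms i hi).2.2.2)
  have hB : ∀ i j, MeasurableSet (B i j) := fun i j => by
    simp only [B]; split_ifs
    · exact (hBf _ _ _).1
    · exact MeasurableSet.univ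
  have g0 : ∀ i, 0 ≤ g i := fun i => gS_nonneg _ _ _ _
  have e0 : ∀ i, 0 ≤ pr p (E i) := fun i => pr_nonneg _
  have key : ∀ i ∈ s, ∀ j ∈ s, (pr p (E i ∩ E j) ≤ (1 + η) * (pr p (E i) * pr p (E j)) + (if j.2 = i.2 then (1 + η) * (pr p (E i) * g j) else 0) + (if i = j then pr p (E i) else 0)) ∧
      (pr p (E i ∩ E j ∩ B i j) ≤ (1 + η) * (η * (pr p (E i) * pr p (E j))) + (if j.2 = i.2 then (1 + η) * (pr p (E i) * g j) else 0) + (if i = j then pr p (E i) else 0)) := by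
    intro i hi j hj
    obtain ⟨⟨S, r⟩, a⟩ := i
    obtain ⟨⟨S', r'⟩, a'⟩ := j
    obtain ⟨i1, i2, i3, i4⟩ := hms _ hi
    obtain ⟨j1, j2, j3, j4⟩ := hms _ hj
    simp only at i1 i2 i3 i4 j1 j2 j3 j4
    have n1 : 0 ≤ (1 + η) * (pr p (E ((S, r), a)) * pr p (E ((S', r'), a'))) := mul_nonneg (by linarith) (mul_nonneg (e0 _) (e0 _))
    have n2 : 0 ≤ (1 + η) * (η * (pr p (E ((S, r), a)) * pr p (E ((S', r'), a')))) := mul_nonneg (by linarith) (mul_nonneg hη.le (mul_nonneg (e0 _) (e0 _)))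
    have n3 : 0 ≤ (if a' = a then (1 + η) * (pr p (E ((S, r), a)) * g ((S', r'), a')) else 0) := by
      split_ifs
      · exact mul_nonneg (by linarith) (mul_nonneg (e0 _) (g0 _))
      · exact le_rfl
    have n4 : 0 ≤ (if (((S, r), a) : (Finset V × V) × V) = ((S', r'), a') then pr p (E ((S, r), a)) else 0) := by
      split_ifs
      · exact e0 _
      · exact le_rfl
    have mB : pr p (E ((S, r), a) ∩ E ((S', r'), a') ∩ B ((S, r), a) ((S', r'), a')) ≤ pr p (E ((S, r), a) ∩ E ((S', r'), a')) := pr_mono Set.inter_subset_left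
    by_cases hemp : E ((S, r), a) ∩ E ((S', r'), a') = ∅
    · have h0 : pr p (E ((S, r), a) ∩ E ((S', r'), a')) = 0 := by rw [hemp]; simp [pr]
      rw [h0] at mB ⊢
      exact ⟨by linarith, by linarith⟩
    obtain ⟨c, hc1, hc2⟩ := Set.nonempty_iff_ne_empty.2 hemp
    have a1 : a ∉ S' := Es.a_notin hK hWR hc1 hc2 j1 i4 j4
    have a2 : a' ∉ S := Es.a_notin hK hWR hc2 hc1 i1 j4 i4
    by_cases hdis : Disjoint S S'
    · have hpair := fun Q hQ => pr_pair (p := p) hWR K k L w i1 j1 i2 j2 i3 j3 i4 j4 hc1.1 a1 a2 hc2.1 hdis Q hQ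
      have hpair' : ∀ Q, Det (EE (univ \ (S ∪ S')) (univ \ (S ∪ S'))) Q → pr p (E ((S, r), a) ∩ E ((S', r'), a') ∩ Q) ≤
          (1 + η) * (gS p k w S r * gS p k w S' r' * pr p ({c | lstar c R a K} ∩ {c | lstar c R a' K} ∩ Q)) := by
        intro Q hQ
        have h1 := hpair Q hQ
        have h2 := pr_nonneg (p := p) (E ((S, r), a) ∩ E ((S', r'), a') ∩ Q)
        calc _ ≤ (1 + η) * (1 - p) ^ (2 * L ^ 2) * pr p (E ((S, r), a) ∩ E ((S', r'), a') ∩ Q) := by nlinarith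
          _ ≤ _ := by rw [mul_assoc]; exact mll h1 (by linarith)
      have hu := hpair' Set.univ Det.univ'
      simp only [Set.inter_univ] at hu
      have ei : pr p (E ((S, r), a)) = gS p k w S r * pr p {c | lstar c R a K} := pr_Es hWR K k w i1 i3 i4 hc1.1
      have ej : pr p (E ((S', r'), a')) = gS p k w S' r' * pr p {c | lstar c R a' K} := pr_Es hWR K k w j1 j3 j4 hc2.1
      have gg : 0 ≤ gS p k w S r * gS p k w S' r' := mul_nonneg (gS_nonneg _ _ _ _) (gS_nonneg _ _ _ _)
      by_cases haa : a' = a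
      · subst haa
        rw [Set.inter_self] at hu
        have : pr p (E ((S, r), a') ∩ E ((S', r'), a')) ≤ (if a' = a' then (1 + η) * (pr p (E ((S, r), a')) * g ((S', r'), a')) else 0) := by
          rw [if_pos rfl, ei]; refine hu.trans (le_of_eq ?_); simp only [g]; ring
        exact ⟨by linarith, by linarith⟩
      · have hb := hbad S S' a a' i1 j1 i2 j2 i4 j4 (Ne.symm haa) hc1.1 a1 a2 hc2.1
        have hBe : B ((S, r), a) ((S', r'), a') = Bf (univ \ (S ∪ S')) a a' := if_pos ⟨hdis, Ne.symm haa, a1, a2⟩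
        have hind : pr p ({c | lstar c R a K} ∩ {c | lstar c R a' K}) = pr p {c | lstar c R a K} * pr p {c | lstar c R a' K} := by
          have q1 := hWR' a i4
          have q2 := hWR' a' j4
          exact pr_indep (det_star q1 K) (det_star q2 K) (EE_disj (by grind) (by grind))
        rw [hind] at hu
        have hv := hpair' _ (hBf (univ \ (S ∪ S')) a a')
        have hv' : (1 + η) * (gS p k w S r * gS p k w S' r' * pr p ({c | lstar c R a K} ∩ {c | lstar c R a' K} ∩ Bf (univ \ (S ∪ S')) a a')) ≤
          (1 + η) * (gS p k w S r * gS p k w S' r' * (η * (pr p {c | lstar c R a K} * pr p {c | lstar c R a' K}))) :=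
          mll (mll hb gg) (by linarith)
        rw [hBe]
        have x1 : (1 + η) * (pr p (E ((S, r), a)) * pr p (E ((S', r'), a'))) = (1 + η) * (gS p k w S r * gS p k w S' r' * (pr p {c | lstar c R a K} * pr p {c | lstar c R a' K})) := by rw [ei, ej]; ring
        have x2 : (1 + η) * (η * (pr p (E ((S, r), a)) * pr p (E ((S', r'), a')))) = (1 + η) * (gS p k w S r * gS p k w S' r' * (η * (pr p {c | lstar c R a K} * pr p {c | lstar c R a' K}))) := by rw [ei, ej]; ring
        exact ⟨by linarith, by linarith⟩
    · have hSS : S = S' := Finset.Subset.antisymm (Es.sub hK hWR hc2 hc1 i1 j4 i4 fun h => hdis h.symm) (Es.sub hK hWR hc1 hc2 j1 i4 j4 hdis)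
      subst hSS
      obtain ⟨rfl, rfl⟩ := Es.eq hc1 hc2
      have : pr p (E ((S, r), a) ∩ E ((S, r), a)) ≤ (if (((S, r), a) : (Finset V × V) × V) = ((S, r), a) then pr p (E ((S, r), a)) else 0) := by
        rw [if_pos rfl, Set.inter_self]
      exact ⟨by linarith, by linarith⟩
  obtain ⟨G, hG⟩ : ∃ G, G = ∑ x ∈ Ix W L, gS p k w x.1 x.2 := ⟨_, rfl⟩
  have hGm : G * (s0 * ((W.card : ℝ) - L)) ≤ m := by
    rw [hmd, hG]; exact G_le_m hWR hs0 hst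
  have hG0 : 0 ≤ G := hG ▸ sum_nonneg fun x _ => gS_nonneg _ _ _ _
  have hGm' : (1 + η) * G ≤ η * m := by
    calc (1 + η) * G ≤ (η * (s0 * ((W.card : ℝ) - L))) * G := mlr hW hG0
      _ = η * (G * (s0 * ((W.card : ℝ) - L))) := by ring
      _ ≤ _ := mll hGm hη.le
  have s1 : ∑ i ∈ s, ∑ j ∈ s, pr p (E i) * pr p (E j) = m ^ 2 := by rw [← sum_mul_sum, ← hm', pow_two]
  have s1' : ∀ t : ℝ, ∑ i ∈ s, ∑ j ∈ s, t * (pr p (E i) * pr p (E j)) = t * m ^ 2 := fun t => by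
    rw [← s1]; simp only [mul_sum]
  have s2 : ∑ i ∈ s, ∑ j ∈ s, (if j.2 = i.2 then (1 + η) * (pr p (E i) * g j) else 0) = m * ((1 + η) * G) := by
    rw [hm', sum_mul]
    refine sum_congr rfl fun i hi => ?_
    rw [sum_product, hG, mul_sum, mul_sum]
    refine sum_congr rfl fun x hx => ?_
    simp only [g]
    rw [sum_ite_eq' W i.2, if_pos (hms i hi).2.2.2]; ring
  have s3 : ∑ i ∈ s, ∑ j ∈ s, (if i = j then pr p (E i) else 0) = m := by
    rw [hm']
    refine sum_congr rfl fun i hi => ?_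
    rw [sum_ite_eq s i, if_pos hi]
  have m1 : m ≤ η * m ^ 2 := by nlinarith
  have m2 : m * ((1 + η) * G) ≤ η * m ^ 2 := by nlinarith
  have m3 : η * (η * m ^ 2) ≤ η * m ^ 2 := by nlinarith [mul_nonneg hη.le (sq_nonneg m)]
  have := sm_bound (p := p) s E B hE hB (η := 4 * η) hm' hm0 ?_ ?_
  · refine (pr_mono fun c hc => ?_).trans (this.trans (by linarith))
    intro i hi j hj h1 h2
    by_contra hcon
    simp only [B] at hcon
    split_ifs at hcon with h
    · exact hc ⟨_, _, _, _, _, _, h1, h2, h.1, h.2.1, h.2.2.1, h.2.2.2, hcon⟩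
    · simp at hcon
  · refine (sum_le_sum fun i hi => sum_le_sum fun j hj => (key i hi j hj).1).trans ?_
    simp only [sum_add_distrib]
    rw [s2, s3, s1' (1 + η)]; linarith
  · refine (sum_le_sum fun i hi => sum_le_sum fun j hj => (key i hi j hj).2).trans ?_
    simp only [sum_add_distrib, ← mul_assoc (1 + η) η]
    rw [s2, s3, s1' ((1 + η) * η)]
    linarith
end
section
open Finset
variable {V : Type} [Fintype V] [DecidableEq V]
lemma mem_ledges_iff {e : Sym2 V} : ∀ {l : List V}, e ∈ ledges l ↔ ∃ i x y, l[i]? = some x ∧ l[i+1]? = some y ∧ e = s(x, y)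
  | [] => by simp
  | [x] => by simp
  | x :: y :: l => by
    rw [ledges_cons, List.mem_cons, mem_ledges_iff (l := y :: l)]
    constructor
    · rintro (rfl | ⟨i, a, b, h1, h2, h3⟩)
      · exact ⟨0, x, y, by simp⟩
      · exact ⟨i + 1, a, b, by simpa using h1, by simpa using h2, h3⟩
    · rintro ⟨i, a, b, h1, h2, h3⟩
      cases i with
      | zero => left; simp at h1 h2; subst h1 h2; exact h3
      | succ i => right; exact ⟨i, a, b, by simpa using h1, by simpa using h2, h3⟩
lemma Fq_unique {c : Cfg V} {w : ℝ} {S : Finset V} {k : ℕ} {q q' : List V} {r a : V} (hq : qok k S r q) (hq' : qok k S r q')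
    (ha : q.head? = some a) (ha' : q'.head? = some a) (h : Fq c w q S) (h' : Fq c w q' S) : q' = q := by
  obtain ⟨lv, hlv, hst⟩ := h.2.1
  have hl := hq.2.1
  have hl' := hq'.2.1
  have g0 : q'[0] = a := by rw [List.head?_eq_getElem?, List.getElem?_eq_getElem (by omega)] at ha'; simpa using ha'
  have f0 : q[0] = a := by rw [List.head?_eq_getElem?, List.getElem?_eq_getElem (by omega)] at ha; simpa using ha
  have gk : q'[k] = r := by
    have := hq'.2.2.2; rw [List.getLast?_eq_getElem?, hl', Nat.add_sub_cancel, List.getElem?_eq_getElem (by omega)] at this; simpa using this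
  have fk : q[k] = r := by
    have := hq.2.2.2; rw [List.getLast?_eq_getElem?, hl, Nat.add_sub_cancel, List.getElem?_eq_getElem (by omega)] at this; simpa using this
  have hstep : ∀ i (hi : i < k), lv q'[i] < lv q'[i+1] → q[lv q'[i]]? = some q'[i] ∧ lv q'[i+1] = lv q'[i] + 1 := by
    intro i hi hlt
    have hne : q'[i] ≠ q'[i+1] := fun he => by
      have := (hq'.1.getElem_inj_iff (hi := by omega) (hj := by omega)).1 he; omega
    obtain ⟨j, h1, h2⟩ := hst q'[i] (hq'.2.2.1 _ (List.getElem_mem _)) q'[i+1] (hq'.2.2.1 _ (List.getElem_mem _))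
      ⟨hne, h'.2.2.1 _ (mem_ledges_iff.2 ⟨i, _, _, List.getElem?_eq_getElem (by omega), List.getElem?_eq_getElem (by omega), rfl⟩)⟩ hlt
    obtain ⟨hj, e1⟩ := List.getElem?_eq_some_iff.1 h1
    obtain ⟨hj2, e2⟩ := List.getElem?_eq_some_iff.1 h2
    have l1 := hlv j hj; have l2 := hlv (j+1) hj2
    rw [e1] at l1; rw [e2] at l2
    rw [l1]; exact ⟨h1, l2⟩
  have up : ∀ i (hi : i < k + 1), lv q'[i] ≤ i := by
    intro i
    induction i with
    | zero => intro hi; rw [g0, ← f0, hlv 0]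
    | succ i ih =>
      intro hi
      have := ih (by omega)
      by_contra hcon
      have := (hstep i (by omega) (by omega)).2
      omega
  have dn : ∀ j i (hi : i < k + 1), i + j = k → i ≤ lv q'[i] := by
    intro j
    induction j with
    | zero => intro i hi hij; have : i = k := by omega
              subst this; rw [gk, ← fk, hlv i]
    | succ j ih =>
      intro i hi hij
      have h1 := ih (i + 1) (by omega) (by omega)
      by_contra hcon
      have := (hstep i (by omega) (by omega)).2
      omega
  have hi' : ∀ i (hi : i < k + 1), lv q'[i] = i := fun i hi => le_antisymm (up i hi) (dn (k - i) i hi (by omega))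
  refine List.ext_getElem (by omega) fun i h1 h2 => ?_
  by_cases hik : i = k
  · subst hik; rw [gk, fk]
  · have := (hstep i (by omega) (by rw [hi' i (by omega), hi' (i+1) (by omega)]; omega)).1
    rw [hi' i (by omega), List.getElem?_eq_getElem h2] at this
    simpa using this.symm
section
variable {p : ℝ} [hp : Fact (0 ≤ p ∧ p ≤ 1)]
def Evq (c : Cfg V) (M : ℕ) (w : ℝ) (W : Finset V) (q : List V) : Prop :=
  (((∀ e ∈ ledges q, (c e).1 = true) ∧ w ≤ wts c (ledges q)) ∧
  (∀ x ∈ q, ∀ y ∈ q, adj (bb c) x y → s(x, y) ∈ ledges q)) ∧ Peel (bb c) M q (W \ q.toFinset)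
lemma Evq_sub {c : Cfg V} {M : ℕ} {w : ℝ} {W : Finset V} {q : List V} (hn : q.Nodup) (hW : ∀ x ∈ q, x ∈ W) (hne : q ≠ [])
    (h : Evq c M w W q) : ∃ S, q.toFinset ⊆ S ∧ S ⊆ W ∧ S.card ≤ (M + 1) * q.length ∧ Fq c w q S ∧ NoE (bb c) S (W \ S) := by
  obtain ⟨⟨⟨h1, h2⟩, h3⟩, h4⟩ := h
  obtain ⟨T, hT, hcl, lv, hlv, hlv2⟩ := peel_out hn disjoint_sdiff h4
  refine ⟨q.toFinset ∪ T, subset_union_left, ?_, ?_, ⟨?_, ⟨lv, hlv, ?_⟩, h1, h2⟩, ?_⟩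
  · refine Finset.union_subset (fun x hx => hW x (by simpa using hx)) (hcl.1.trans Finset.sdiff_subset)
  · refine (card_union_le _ _).trans ?_
    have := List.toFinset_card_le q
    rw [add_mul]; omega
  · intro X hX hXne hXS
    by_cases hA : ∃ x ∈ q, x ∈ X
    · by_cases hB : ∃ y ∈ q, y ∉ X
      · have : ∃ i x y, q[i]? = some x ∧ q[i+1]? = some y ∧ ¬ (x ∈ X ↔ y ∈ X) := by
          by_contra hcon
          push Not at hcon
          have hall : ∀ i (hi : i < q.length), q[i] ∈ X ↔ q[0]'(List.length_pos_iff.2 hne) ∈ X := by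
            intro i
            induction i with
            | zero => intro _; rfl
            | succ i ih =>
              intro hi
              rw [← ih (by omega)]
              exact (hcon i _ _ (List.getElem?_eq_getElem (by omega)) (List.getElem?_eq_getElem hi)).symm
          obtain ⟨x, hx, hxX⟩ := hA
          obtain ⟨y, hy, hyX⟩ := hB
          obtain ⟨i, hi, rfl⟩ := List.getElem_of_mem hx
          obtain ⟨j, hj, rfl⟩ := List.getElem_of_mem hy
          exact hyX ((hall j hj).2 ((hall i hi).1 hxX))
        obtain ⟨i, x, y, hx, hy, hxy⟩ := this
        have hadj : adj (bb c) x y := by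
          refine ⟨fun he => hxy (by rw [he]), h1 _ (mem_ledges_iff.2 ⟨i, x, y, hx, hy, rfl⟩)⟩
        have hxS : x ∈ q.toFinset ∪ T := by simp [List.mem_of_getElem? hx]
        have hyS : y ∈ q.toFinset ∪ T := by simp [List.mem_of_getElem? hy]
        by_cases hxX : x ∈ X
        · exact ⟨x, hxX, y, Finset.mem_sdiff.2 ⟨hyS, by tauto⟩, hadj⟩
        · exact ⟨y, by tauto, x, Finset.mem_sdiff.2 ⟨hxS, hxX⟩, hadj.symm⟩
      · push Not at hB
        obtain ⟨x, hx, y, hy, hxy⟩ := hcl.2.1 ((q.toFinset ∪ T) \ X) (by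
          intro z hz; simp only [Finset.mem_sdiff, Finset.mem_union, List.mem_toFinset] at hz
          rcases hz.1 with h | h
          · exact absurd (hB z h) hz.2
          · exact h) (sdiff_nonempty.2 fun h => hXS (Finset.Subset.antisymm hX h))
        exact ⟨y, by simp only [Finset.mem_sdiff, not_and, not_not] at hy; exact hy.2 hy.1, x, hx, hxy.symm⟩
    · push Not at hA
      obtain ⟨x, hx, y, hy, hxy⟩ := hcl.2.1 X (fun z hz => by
        have := hX hz; simp only [Finset.mem_union, List.mem_toFinset] at this
        exact this.resolve_left fun h => hA z h hz) hXne
      exact ⟨x, hx, y, hy, hxy⟩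
  · intro x hx y hy hxy hlt
    obtain ⟨hxq, hyq⟩ := hlv2 x hx y hy hxy hlt.ne
    obtain ⟨i, x', y', e1, e2, e3⟩ := mem_ledges_iff.1 (h3 x hxq y hyq hxy)
    obtain ⟨hi, f1⟩ := List.getElem?_eq_some_iff.1 e1
    obtain ⟨hi2, f2⟩ := List.getElem?_eq_some_iff.1 e2
    rcases Sym2.eq_iff.1 e3 with ⟨rfl, rfl⟩ | ⟨rfl, rfl⟩
    · exact ⟨i, e1, e2⟩
    · have g1 := hlv i hi; have g2 := hlv (i+1) hi2
      rw [f1] at g1; rw [f2] at g2; omega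
  · have := hcl.2.2
    rwa [sdiff_sdiff_left, sup_eq_union] at this
lemma pr_Evq_le {M : ℕ} {w : ℝ} {W : Finset V} {q : List V} (hn : q.Nodup) (hW : ∀ x ∈ q, x ∈ W) (hne : q ≠ []) :
    pr p {c | Evq c M w W q} ≤ ∑ S ∈ W.powerset.filter (fun S => S.card ≤ (M + 1) * q.length), 
      if q.toFinset ⊆ S then pr p {c | Fq c w q S} * (1 - p) ^ (S.card * (W \ S).card) else 0 := by
  rw [← sum_filter]
  have hsub : {c | Evq c M w W q} ⊆ ⋃ S ∈ (W.powerset.filter (fun S => S.card ≤ (M + 1) * q.length)).filter (fun S => q.toFinset ⊆ S),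
      ({c | Fq c w q S} ∩ {c | NoE (bb c) S (W \ S)}) := fun c hc => by
    obtain ⟨S, h1, h2, h3, h4, h5⟩ := Evq_sub hn hW hne hc
    exact Set.mem_iUnion₂.2 ⟨S, mem_filter.2 ⟨mem_filter.2 ⟨mem_powerset.2 h2, h3⟩, h1⟩, h4, h5⟩
  refine (pr_mono hsub).trans ((pr_biUnion_le _ _).trans (sum_le_sum fun S hS => le_of_eq ?_))
  have hqS := (mem_filter.1 hS).2
  rw [pr_indep (det_Fq hn (fun x hx => hqS (by simpa using hx)) w) (det_NoE _ _) (EE_disj (fun x y h1 h2 h3 h4 => absurd h2 (mem_sdiff.1 h4).2) (fun x y h1 h2 h3 h4 => absurd h1 (mem_sdiff.1 h3).2)), pr_NoE disjoint_sdiff]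
end
end
section
open Finset
variable {V : Type} [Fintype V] [DecidableEq V]
section
variable {p : ℝ} [hp : Fact (0 ≤ p ∧ p ≤ 1)]
lemma pr_Evq_ge {M k : ℕ} {x w θ : ℝ} (hx0 : 0 ≤ x)
    (hx : ∀ (U : Finset V) (v : V), v ∉ U → x ≤ pr p {c : Cfg V | ∃ T, T.card ≤ M ∧ Cl (bb c) {v} U T})
    (hθ : 0 ≤ θ) (hw : (1 / (1 + θ)) ^ k * exp (θ * w) ≤ 1 / 2) {W : Finset V} {q : List V} (hn : q.Nodup) (hl : q.length = k + 1) :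
    p ^ k / 2 * (1 - p) ^ ((k + 1) ^ 2) * (x * (1 - p) ^ (M * (k + 1))) ^ (k + 1) ≤ pr p {c : Cfg V | Evq c M w W q} := by
  have hp0 := hp.out.1
  have hp1 : 0 ≤ 1 - p := by linarith [hp.out.2]
  obtain ⟨Q, hQ⟩ : ∃ Q, Q = q.toFinset := ⟨_, rfl⟩
  have hQc : Q.card = k + 1 := by rw [hQ, List.toFinset_card_of_nodup hn, hl]
  let T1 := (ledges q).toFinset
  let T2 : Finset (Sym2 V) := ((Q ×ˢ Q).filter fun d => d.1 ≠ d.2 ∧ s(d.1, d.2) ∉ ledges q).image fun d => s(d.1, d.2)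
  have hT1c : T1.card = k := by rw [List.toFinset_card_of_nodup (ledges_nodup hn), ledges_length, hl]; rfl
  have hT2c : T2.card ≤ (k + 1) ^ 2 := by
    refine card_image_le.trans ((card_filter_le _ _).trans ?_)
    rw [card_product, hQc, pow_two]
  have d1 : Det (T1 : Set (Sym2 V)) {c : Cfg V | (∀ e ∈ ledges q, (c e).1 = true) ∧ w ≤ wts c (ledges q)} := by
    refine ⟨MeasurableSet.inter ?_ (measurableSet_le measurable_const (meas_wts _).coe_nnreal_real), fun c c' hc h => ?_⟩
    · have : {c : Cfg V | ∀ e ∈ ledges q, (c e).1 = true} = ⋂ e ∈ (ledges q).toFinset, {c : Cfg V | c e ∈ {z : Bool × ℝ | z.1 = true}} := by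
        ext c; simp
      change MeasurableSet {c : Cfg V | ∀ e ∈ ledges q, (c e).1 = true}
      rw [this]; exact measurableSet_biInter _ fun e _ => (det_edge meas_true e).1
    · have he : ∀ e ∈ ledges q, c e = c' e := fun e he => hc e (by simpa [T1] using he)
      refine ⟨fun e h' => he e h' ▸ h.1 e h', ?_⟩
      have : wts c' (ledges q) = wts c (ledges q) := by
        unfold wts; congr 1; exact List.map_congr_left fun e h' => by rw [he e h']
      rw [this]; exact h.2
  have a2 : {c : Cfg V | ∀ x ∈ q, ∀ y ∈ q, adj (bb c) x y → s(x, y) ∈ ledges q} = {c : Cfg V | ∀ e ∈ T2, c e ∈ {z : Bool × ℝ | ¬ z.1 = true}} := by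
    ext c
    simp only [Set.mem_ofPred_eq, T2, mem_image, mem_filter, mem_product, hQ, List.mem_toFinset, Prod.exists, adj, bb]
    constructor
    · rintro h e ⟨x, y, ⟨⟨hx, hy⟩, hne, hnl⟩, rfl⟩ ht
      exact hnl (h x hx y hy ⟨hne, ht⟩)
    · intro h x hx y hy ha
      by_contra hcon
      exact h s(x, y) ⟨x, y, ⟨⟨hx, hy⟩, ha.1, hcon⟩, rfl⟩ ha.2
  have d2 : Det (T2 : Set (Sym2 V)) {c : Cfg V | ∀ x ∈ q, ∀ y ∈ q, adj (bb c) x y → s(x, y) ∈ ledges q} := by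
    rw [a2]
    exact det_b (fun b => ∀ e ∈ T2, ¬ b e = true) fun b b' hb h e he => by rw [← hb e he]; exact h e he
  have d3 := det_Peel (V := V) M q (W \ q.toFinset)
  have p1 : p ^ k / 2 ≤ pr p {c : Cfg V | (∀ e ∈ ledges q, (c e).1 = true) ∧ w ≤ wts c (ledges q)} := by
    have h1 := pr_edges (p := p) T1 (fun _ => {z : Bool × ℝ | z.1 = true})
    rw [prod_const, BE_true, hT1c] at h1
    have h2 := pr_laplace (p := p) T1 hθ w
    rw [hT1c] at h2
    have h3 : {c : Cfg V | ∀ e ∈ T1, c e ∈ {z : Bool × ℝ | z.1 = true}} ⊆ {c : Cfg V | (∀ e ∈ ledges q, (c e).1 = true) ∧ w ≤ wts c (ledges q)} ∪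
        {c : Cfg V | (∀ e ∈ T1, (c e).1 = true) ∧ ∑ e ∈ T1, (c e).2 ≤ w} := by
      intro c hc
      have hc' : ∀ e ∈ T1, (c e).1 = true := hc
      by_cases h : w ≤ wts c (ledges q)
      · left; exact ⟨fun e he => hc' e (by simpa [T1] using he), h⟩
      · right; exact ⟨hc', (wts_ge c (ledges_nodup hn)).trans (le_of_lt (not_le.1 h))⟩
    have h4 := (pr_mono (p := p) h3).trans (pr_union_le _ _)
    rw [h1] at h4
    have h5 : (p / (1 + θ)) ^ k * exp (θ * w) ≤ p ^ k * (1 / 2) := by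
      rw [div_pow, div_eq_mul_one_div, ← one_div_pow, mul_assoc]
      exact mll hw (by positivity)
    linarith
  have p2 : (1 - p) ^ ((k + 1) ^ 2) ≤ pr p {c : Cfg V | ∀ x ∈ q, ∀ y ∈ q, adj (bb c) x y → s(x, y) ∈ ledges q} := by
    rw [a2, pr_edges, prod_const, BE_false]
    exact pow_le_pow_of_le_one hp1 (by linarith) hT2c
  have p3 := pr_Peel (p := p) M hx0 hx (k + 1) q (W \ q.toFinset) hl.le hn disjoint_sdiff
  rw [hl] at p3
  have hT1 : ∀ e ∈ T1, e ∈ EE Q Q := fun e he => ledges_EE hn (fun x hx => by rw [hQ]; simpa using hx) e (by simpa [T1] using he)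
  have hT2 : ∀ e ∈ T2, e ∈ EE Q Q := fun e he => by
    simp only [T2, mem_image, mem_filter, mem_product, Prod.exists] at he
    obtain ⟨x, y, ⟨⟨hx, hy⟩, hne, _⟩, rfl⟩ := he
    exact ⟨x, hx, y, hy, hne, rfl⟩
  have e : {c : Cfg V | Evq c M w W q} = ({c : Cfg V | (∀ e ∈ ledges q, (c e).1 = true) ∧ w ≤ wts c (ledges q)} ∩
    {c : Cfg V | ∀ x ∈ q, ∀ y ∈ q, adj (bb c) x y → s(x, y) ∈ ledges q}) ∩ {c : Cfg V | Peel (bb c) M q (W \ q.toFinset)} := rfl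
  rw [e, pr_indep (d1.inter2 d2) d3, pr_indep d1 d2]
  · exact mul_le_mul (mul_le_mul p1 p2 (by positivity) (pr_nonneg _)) p3 (by positivity) (mul_nonneg (pr_nonneg _) (pr_nonneg _))
  · rw [Set.disjoint_left]
    intro e h1 h2
    simp only [T2, coe_image, Set.mem_image, mem_coe, mem_filter, Prod.exists] at h2
    obtain ⟨x, y, ⟨_, _, h⟩, rfl⟩ := h2
    exact h (by simpa [T1] using h1)
  · refine Disjoint.mono_left (b := EE Q Q) (Set.union_subset hT1 hT2) ?_
    rw [hQ]
    exact EE_disj (fun x y h1 h2 h3 h4 => absurd h2 (mem_sdiff.1 h4).2) (fun x y h1 h2 h3 h4 => absurd h1 (mem_sdiff.1 h3).2)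
def qf {W : Finset V} {k : ℕ} (f : Fin (k + 1) ↪ W) : List V := List.ofFn fun i => (f i : V)
lemma mult_le {W S : Finset V} {k : ℕ} {w : ℝ} :
    ∑ f : Fin (k + 1) ↪ W, (if (qf f).toFinset ⊆ S then pr p {c | Fq c w (qf f) S} else 0) ≤ S.card * ∑ r ∈ S, pr p {c | InS c k w S r} := by
  classical
  rw [← sum_filter]
  have hn : ∀ f : Fin (k + 1) ↪ W, (qf f).Nodup := fun f => List.nodup_ofFn.2 fun i j h => f.injective (Subtype.ext h)
  have hl : ∀ f : Fin (k + 1) ↪ W, (qf f).length = k + 1 := fun f => by simp [qf]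
  have hinj : ∀ f g : Fin (k + 1) ↪ W, qf f = qf g → f = g := fun f g h => by
    have := List.ofFn_injective h
    ext i; exact congrFun this i
  have hh : ∀ f : Fin (k + 1) ↪ W, (qf f).head? = some (f 0 : V) := fun f => by simp [qf, List.ofFn_succ]
  have hlast : ∀ f : Fin (k + 1) ↪ W, (qf f).getLast? = some (f (Fin.last k) : V) := fun f => by
    rw [List.getLast?_eq_getElem?, List.getElem?_eq_getElem (by rw [hl f]; omega)]; simp only [qf, List.getElem_ofFn, List.length_ofFn]; rfl
  rw [← sum_fiberwise_of_maps_to (t := S ×ˢ S) (g := fun f : Fin (k + 1) ↪ W => ((f (Fin.last k) : V), (f 0 : V)))]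
  · rw [sum_product, mul_sum]
    refine sum_le_sum fun r hr => ?_
    rw [← nsmul_eq_mul]
    refine sum_le_card_nsmul _ _ _ fun a ha => ?_
    have hok : ∀ f ∈ (univ.filter fun f : Fin (k + 1) ↪ W => (qf f).toFinset ⊆ S).filter (fun f => ((f (Fin.last k) : V), (f 0 : V)) = (r, a)),
        qok k S r (qf f) ∧ (qf f).head? = some a := fun f hf => by
      simp only [mem_filter, mem_univ, true_and, Prod.mk.injEq] at hf
      exact ⟨⟨hn f, hl f, fun x hx => hf.1 (by simpa using hx), by rw [hlast, hf.2.1]⟩, by rw [hh, hf.2.2]⟩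
    refine sum_pr_le _ _ (fun f hf => (det_Fq (hn f) (hok f hf).1.2.2.1 w).1) ?_ _ fun f hf c hc => ⟨_, (hok f hf).1, hc⟩
    intro f hf g hg hne
    refine Set.disjoint_left.2 fun c h1 h2 => hne (hinj _ _ ?_)
    exact Fq_unique (hok g hg).1 (hok f hf).1 (hok g hg).2 (hok f hf).2 h2 h1
  · intro f hf
    simp only [mem_filter, mem_univ, true_and] at hf
    exact mk_mem_product (hf (List.mem_toFinset.2 (List.mem_ofFn.2 ⟨_, rfl⟩))) (hf (List.mem_toFinset.2 (List.mem_ofFn.2 ⟨_, rfl⟩)))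
lemma G_lower {R W : Finset V} (hWR : Disjoint W R) (hWRc : W ∪ R = univ) {M k : ℕ} {x w θ : ℝ} (hx0 : 0 ≤ x)
    (hx : ∀ (U : Finset V) (v : V), v ∉ U → x ≤ pr p {c | ∃ T, T.card ≤ M ∧ Cl (bb c) {v} U T})
    (hθ : 0 ≤ θ) (hw : (1 / (1 + θ)) ^ k * exp (θ * w) ≤ 1 / 2) (hk : k ≤ W.card) :
    (((W.card : ℝ) - k) * p * x * (1 - p) ^ ((M + 1) * R.card + (M + 1) * (k + 1))) ^ (k + 1) ≤
      2 * ((M + 1) * (k + 1) : ℕ) * ∑ y ∈ Ix W ((M + 1) * (k + 1)), gS p k w y.1 y.2 := by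
  classical
  have hp0 := hp.out.1
  have hp1 : 0 ≤ 1 - p := by linarith [hp.out.2]
  obtain ⟨L, hL⟩ : ∃ L, L = (M + 1) * (k + 1) := ⟨_, rfl⟩
  rw [← hL]
  obtain ⟨z, hz⟩ : ∃ z, z = p ^ k / 2 * (1 - p) ^ ((k + 1) ^ 2) * (x * (1 - p) ^ (M * (k + 1))) ^ (k + 1) := ⟨_, rfl⟩
  have hz0 : 0 ≤ z := by rw [hz]; positivity
  have hn : ∀ f : Fin (k + 1) ↪ W, (qf f).Nodup := fun f => List.nodup_ofFn.2 fun i j h => f.injective (Subtype.ext h)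
  have hl : ∀ f : Fin (k + 1) ↪ W, (qf f).length = k + 1 := fun f => by simp [qf]
  have hqW : ∀ f : Fin (k + 1) ↪ W, ∀ x ∈ qf f, x ∈ W := fun f x hx => by
    simp only [qf, List.mem_ofFn] at hx; obtain ⟨i, rfl⟩ := hx; exact (f i).2
  have s1 : ((W.card : ℝ) - k) ^ (k + 1) * z ≤ ∑ f : Fin (k + 1) ↪ W, pr p {c | Evq c M w W (qf f)} := by
    have h1 : ∑ f : Fin (k + 1) ↪ W, z ≤ ∑ f : Fin (k + 1) ↪ W, pr p {c | Evq c M w W (qf f)} :=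
      sum_le_sum fun f _ => hz ▸ pr_Evq_ge hx0 hx hθ hw (hn f) (hl f)
    refine le_trans ?_ h1
    rw [sum_const, nsmul_eq_mul, card_univ, Fintype.card_embedding_eq, Fintype.card_coe, Fintype.card_fin]
    refine mlr ?_ hz0
    have := Nat.pow_sub_le_descFactorial W.card (k + 1)
    have h2 : W.card + 1 - (k + 1) = W.card - k := by omega
    rw [h2] at this
    rw [← Nat.cast_sub hk]
    exact_mod_cast this
  obtain ⟨PS, hPS⟩ : ∃ PS, PS = W.powerset.filter (fun S => S.card ≤ L) := ⟨_, rfl⟩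
  have hIx : ∀ h : Finset V → V → ℝ, ∑ y ∈ Ix W L, h y.1 y.2 = ∑ S ∈ PS, ∑ r ∈ S, h S r := fun h =>
    sum_finset_product' _ _ _ fun y => by rw [mem_Ix, hPS, mem_filter, mem_powerset, and_assoc]
  have s2 : ∑ f : Fin (k + 1) ↪ W, pr p {c | Evq c M w W (qf f)} ≤ ∑ S ∈ PS, (1 - p) ^ (S.card * (W \ S).card) * (L * ∑ r ∈ S, pr p {c | InS c k w S r}) := by
    have h1 : ∀ f : Fin (k + 1) ↪ W, pr p {c | Evq c M w W (qf f)} ≤ ∑ S ∈ PS, (1 - p) ^ (S.card * (W \ S).card) *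
        (if (qf f).toFinset ⊆ S then pr p {c | Fq c w (qf f) S} else 0) := fun f => by
      refine (pr_Evq_le (hn f) (hqW f) (fun h => by have := hl f; rw [h] at this; simp at this)).trans (le_of_eq ?_)
      rw [hl f, ← hL, ← hPS]
      refine sum_congr rfl fun S _ => ?_
      split_ifs
      · ring
      · simp
    refine (sum_le_sum fun f _ => h1 f).trans ?_
    rw [sum_comm]
    refine sum_le_sum fun S hS => ?_
    rw [← mul_sum]
    refine mll (mult_le.trans ?_) (by positivity)
    refine mlr ?_ (sum_nonneg fun _ _ => pr_nonneg _)
    rw [hPS] at hS; exact_mod_cast (mem_filter.1 hS).2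
  have s3 : p * (1 - p) ^ (L * R.card) * ∑ S ∈ PS, (1 - p) ^ (S.card * (W \ S).card) * (L * ∑ r ∈ S, pr p {c | InS c k w S r}) ≤
      L * ∑ y ∈ Ix W L, gS p k w y.1 y.2 := by
    rw [hIx (fun S r => gS p k w S r), mul_sum, mul_sum]
    refine sum_le_sum fun S hS => ?_
    rw [mul_sum, mul_sum, mul_sum, mul_sum]
    refine sum_le_sum fun r hr => ?_
    rw [hPS, mem_filter, mem_powerset] at hS
    have hc : (univ \ S).card = (W \ S).card + R.card := by
      rw [← hWRc, ← card_union_of_disjoint (hWR.mono_left sdiff_subset)]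
      congr 1; ext v
      have : v ∈ R → v ∉ S := fun h h' => disjoint_left.1 hWR (hS.1 h') h
      simp only [Finset.mem_sdiff, Finset.mem_union]; tauto
    have hpw : (1 - p) ^ (L * R.card) * (1 - p) ^ (S.card * (W \ S).card) ≤ (1 - p) ^ (S.card * (univ \ S).card - 1) := by
      rw [← pow_add]; refine pow_le_pow_of_le_one hp1 (by linarith) ?_
      have := Nat.mul_le_mul_right R.card hS.2
      rw [hc, mul_add]; omega
    have hI := pr_nonneg (p := p) {c | InS c k w S r}
    have hL0 := Nat.cast_nonneg (α := ℝ) L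
    calc _ = (L * (pr p {c | InS c k w S r} * p)) * ((1 - p) ^ (L * R.card) * (1 - p) ^ (S.card * (W \ S).card)) := by ring
      _ ≤ (L * (pr p {c | InS c k w S r} * p)) * (1 - p) ^ (S.card * (univ \ S).card - 1) := mll hpw (by positivity)
      _ = _ := by rw [gS]; ring
  have s4 := mll (s1.trans s2) (show 0 ≤ p * (1 - p) ^ (L * R.card) by positivity)
  have s5 := s4.trans s3
  have e : (((W.card : ℝ) - k) * p * x * (1 - p) ^ ((M + 1) * R.card + L)) ^ (k + 1) = 2 * (p * (1 - p) ^ (L * R.card) * (((W.card : ℝ) - k) ^ (k + 1) * z)) := by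
    rw [hz, hL]
    have e1 : ((M + 1) * R.card + (M + 1) * (k + 1)) * (k + 1) = (M + 1) * (k + 1) * R.card + (k + 1) ^ 2 + M * (k + 1) * (k + 1) := by ring
    rw [mul_pow, mul_pow, mul_pow, mul_pow, ← pow_mul, ← pow_mul, e1, pow_add (1 - p) ((M + 1) * (k + 1) * R.card + (k + 1) ^ 2), pow_add (1 - p) ((M + 1) * (k + 1) * R.card), pow_succ p k]; ring
  rw [e]; linarith
end
end
section
open Finset
def kn (δ mu : ℝ) (n : ℕ) : ℕ := ⌊(1 - δ) * log ((n : ℝ) + 2) / log (1 / mu)⌋₊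
lemma kn_tendsto {δ mu : ℝ} (hδ : δ < 1) (hmu : mu ∈ Set.Ioo (0 : ℝ) 1) : Tendsto (kn δ mu) atTop atTop := by
  have : 0 < log (1 / mu) := log_pos (one_lt_one_div hmu.1 hmu.2)
  exact tendsto_nat_floor_atTop.comp ((logN_tendsto.const_mul_atTop (by linarith)).atTop_div_const this)
lemma logdiv (j : ℕ) : Tendsto (fun n : ℕ => log ((n : ℝ) + 2) ^ j / ((n : ℝ) + 2)) atTop (nhds 0) := by
  simpa [Function.comp_def] using (Real.tendsto_pow_log_div_mul_add_atTop 1 0 j one_ne_zero).comp N_tendsto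
lemma theta_ex {δ : ℝ} (h0 : 0 < δ) (h1 : δ < 1) : ∃ θ > 0, exp (θ * (1 - δ)) < 1 + θ := by
  refine ⟨δ / 2, by positivity, ?_⟩
  by_contra! h
  have h2 := Real.one_sub_le_exp_neg (δ / 2 * (1 - δ))
  have h3 : 0 < 1 - δ / 2 * (1 - δ) := by nlinarith
  have h4 := mul_le_mul h h2 h3.le (exp_pos _).le
  rw [← exp_add, add_neg_cancel, exp_zero] at h4
  nlinarith [mul_pos h0 h0, mul_pos (mul_pos h0 h0) h0]
variable {p : ℕ → ℝ} [hp : ∀ n, Fact (0 ≤ p n ∧ p n ≤ 1)]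
def BfN (δ0 ε lam : ℝ) (tu : ℕ → ℝ) (n : ℕ) (U : Finset (Fin (n + 2))) (a b : Fin (n + 2)) : Set (Cfg (Fin (n + 2))) :=
  {c | Bad c U a b (δ0 * ((n:ℝ) + 2)) ((1 - ε) * log ((n:ℝ) + 2) / (lam - 1)) (tu n) ⌊(1 - ε) * lam / (lam - 1) * log ((n:ℝ) + 2)⌋₊}
set_option maxHeartbeats 1000000 in
lemma good_pairs {lam : ℝ} (hlam : 1 < lam) (hlim : Tendsto (fun n : ℕ => ((n : ℝ) + 2) * p n) atTop (nhds lam))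
    {mu : ℝ} (hmu : mu ∈ Set.Ioo (0 : ℝ) 1) (hdual : mu * exp (-mu) = lam * exp (-lam))
    {ε δ : ℝ} (hε : 0 < ε) (hε1 : ε < 1) (hδ : 0 < δ) (hδ1 : δ < 1) :
    ∃ δ0 > 0, ∃ tu : ℕ → ℝ, ∀ η > 0, η ≤ 1 → ∀ᶠ n in atTop,
      pr (p n) {c : Cfg (Fin (n + 2)) | ¬ ∃ R W K L, GoodPair c R W K (kn δ mu n) L ((1 - δ) * kn δ mu n) (BfN δ0 ε lam tu n)} ≤ 16 * η := by
  obtain ⟨δ0, hδ0, tu, H⟩ := bad_small hlam hlim hε hε1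
  refine ⟨δ0, hδ0, tu, fun η hη hη1 => ?_⟩
  obtain ⟨K, hK, H⟩ := H η hη
  obtain ⟨l0, hl0⟩ : ∃ l0, l0 = log (1 / mu) := ⟨_, rfl⟩
  have hl0p : 0 < l0 := hl0 ▸ log_pos (one_lt_one_div hmu.1 hmu.2)
  have hmul : mu = exp (-l0) := by rw [hl0, one_div, log_inv, neg_neg, exp_log hmu.1]
  obtain ⟨β, hβ⟩ : ∃ β, β = exp (-(l0 * (1 + δ))) := ⟨_, rfl⟩
  have hβ0 : 0 < β := hβ ▸ exp_pos _
  have hβm : β < mu := by rw [hβ, hmul]; exact exp_lt_exp.2 (by nlinarith)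
  have hlam0 : 0 < lam := by linarith
  obtain ⟨x, hx⟩ : ∃ x, x = (β + mu) / 2 / lam := ⟨_, rfl⟩
  have hx0 : 0 < x := by rw [hx]; have := hmu.1; positivity
  have hxl : β < lam * x := by rw [hx, mul_div_cancel₀ _ hlam0.ne']; linarith
  obtain ⟨-, M, hM⟩ := small_clusters hlam hlim hmu hdual hx0.le (show x < mu / lam by rw [hx]; gcongr; linarith)
  obtain ⟨δ1, hd1, hd1h, hd1p⟩ : ∃ δ1 : ℝ, β < (1 - δ1 - 0) * lam * x * exp (-(lam / (1 - 0) * ((M + 1) * (δ1 + 0)))) ∧ δ1 < 1 / 2 ∧ 0 < δ1 := by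
    have hc : Continuous fun δ1 : ℝ => (1 - δ1 - 0) * lam * x * exp (-(lam / (1 - 0) * ((M + 1) * (δ1 + 0)))) := by fun_prop
    have h1 := hc.continuousAt (x := 0) |>.eventually_const_lt (show β < _ by simpa using hxl)
    have h2 := (h1.and (gt_mem_nhds (show (0:ℝ) < 1 / 2 by norm_num))).filter_mono (nhdsWithin_le_nhds (s := Set.Ioi 0))
    obtain ⟨y, hy, hy2⟩ := (h2.and self_mem_nhdsWithin).exists
    exact ⟨y, hy.1, hy.2, hy2⟩
  obtain ⟨s0, hs0, H⟩ := H δ1 hd1p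
  obtain ⟨θ, hθ, hθe⟩ := theta_ex hδ hδ1
  obtain ⟨C, hC⟩ : ∃ C, C = (1 - δ) / l0 + 2 := ⟨_, rfl⟩
  have hC0 : 0 < C := by rw [hC]; have : 0 < 1 - δ := by linarith
                         positivity
  obtain ⟨k, hk⟩ : ∃ k, k = kn δ mu := ⟨_, rfl⟩
  have hkt : Tendsto k atTop atTop := hk ▸ kn_tendsto hδ1 hmu
  have hlog : ∀ n : ℕ, 1 / 2 ≤ log ((n:ℝ) + 2) := fun n => by
    have := log_two_gt_d9
    have := log_le_log (by norm_num) (show (2:ℝ) ≤ n + 2 by linarith [Nat.cast_nonneg (α := ℝ) n])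
    linarith
  have hkf : ∀ n, (k n : ℝ) ≤ (1 - δ) * log ((n:ℝ) + 2) / l0 := fun n => by
    rw [hk, hl0]; refine Nat.floor_le (div_nonneg (mul_nonneg (by linarith) (by linarith [hlog n])) (hl0 ▸ hl0p.le))
  have hkC : ∀ n, (k n : ℝ) + 1 ≤ C * log ((n:ℝ) + 2) := fun n => by
    have h1 := hkf n
    have h2 := hlog n
    have e : C * log ((n:ℝ) + 2) = (1 - δ) * log ((n:ℝ) + 2) / l0 + 2 * log ((n:ℝ) + 2) := by rw [hC]; ring
    linarith
  have hNpos : ∀ n : ℕ, (0:ℝ) < (n:ℝ) + 2 := fun n => by positivity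
  have hkN : ∀ j : ℕ, Tendsto (fun n : ℕ => ((k n : ℝ) + 1) ^ j / ((n:ℝ) + 2)) atTop (nhds 0) := fun j => by
    have h1 := (logdiv j).const_mul (C ^ j)
    rw [mul_zero] at h1
    refine squeeze_zero (fun n => by have := hNpos n; positivity) (fun n => ?_) h1
    rw [← mul_div_assoc, ← mul_pow]
    have := hNpos n
    have := hkC n
    gcongr
  have hk1 : Tendsto (fun n : ℕ => ((k n : ℝ) + 1) / ((n:ℝ) + 2)) atTop (nhds 0) := by simpa using hkN 1
  have hr : Tendsto (fun n : ℕ => (⌈δ1 * ((n:ℝ) + 2)⌉₊ : ℝ) / ((n:ℝ) + 2)) atTop (nhds δ1) :=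
    (tendsto_nat_ceil_mul_div_atTop hd1p.le).comp N_tendsto
  have hp0 := p_tendsto hlim
  have t1 : Tendsto (fun n : ℕ => (1 - (⌈δ1 * ((n:ℝ) + 2)⌉₊ : ℝ) / ((n:ℝ) + 2) - ((k n : ℝ) + 1) / ((n:ℝ) + 2)) * (((n:ℝ) + 2) * p n) * x *
      exp (-((((n:ℝ) + 2) * p n) / (1 - p n) * ((M + 1) * ((⌈δ1 * ((n:ℝ) + 2)⌉₊ : ℝ) / ((n:ℝ) + 2) + ((k n : ℝ) + 1) / ((n:ℝ) + 2)))))) atTop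
      (nhds ((1 - δ1 - 0) * lam * x * exp (-(lam / (1 - 0) * ((M + 1) * (δ1 + 0)))))) := by
    refine (((tendsto_const_nhds.sub hr).sub hk1).mul hlim).mul_const x |>.mul ?_
    refine (continuous_exp.tendsto _).comp (Tendsto.neg ?_)
    exact (hlim.div (tendsto_const_nhds.sub hp0) (by norm_num)).mul ((hr.add hk1).const_mul _)
  have t2 : Tendsto (fun n : ℕ => (1 + η) * (1 - 2 * ((M:ℝ) + 1) ^ 2 * (((k n : ℝ) + 1) ^ 2 / ((n:ℝ) + 2)) * (((n:ℝ) + 2) * p n))) atTop (nhds ((1 + η) * (1 - 2 * ((M:ℝ) + 1) ^ 2 * 0 * lam))) :=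
    (tendsto_const_nhds.sub (((hkN 2).const_mul _).mul hlim)).const_mul _
  have t3 : Tendsto (fun n : ℕ => 1 - (⌈δ1 * ((n:ℝ) + 2)⌉₊ : ℝ) / ((n:ℝ) + 2) - (M + 1) * (((k n : ℝ) + 1) / ((n:ℝ) + 2))) atTop (nhds (1 - δ1 - (M + 1) * 0)) :=
    (tendsto_const_nhds.sub hr).sub (hk1.const_mul _)
  have t4 : Tendsto (fun n : ℕ => 2 * ((M:ℝ) + 1) * (((k n : ℝ) + 1) / ((n:ℝ) + 2))) atTop (nhds (2 * ((M:ℝ) + 1) * 0)) := hk1.const_mul _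
  have t5 : Tendsto (fun n : ℕ => (exp (θ * (1 - δ)) / (1 + θ)) ^ k n) atTop (nhds 0) :=
    (tendsto_pow_atTop_nhds_zero_of_lt_one (by positivity) ((div_lt_one (by positivity)).2 hθe)).comp hkt
  have t6 := ((tendsto_pow_mul_exp_neg_atTop_nhds_zero 1).comp (logN_tendsto.const_mul_atTop (show 0 < δ ^ 2 by positivity))).eventually_le_const
    (show 0 < δ ^ 2 * (η * s0 * β / (8 * (M + 1) * C)) by positivity)
  filter_upwards [hM, H, t1.eventually_const_lt hd1, t2.eventually_const_lt (show 1 < (1 + η) * (1 - 2 * ((M:ℝ) + 1) ^ 2 * 0 * lam) by simpa using hη), t3.eventually_const_le (show 1 / 4 < 1 - δ1 - ((M:ℝ) + 1) * 0 by linarith),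
    t4.eventually_le_const (show 2 * ((M:ℝ) + 1) * 0 < δ0 / 2 by linarith), t5.eventually_le_const (show (0:ℝ) < 1 / 2 by norm_num), t6, hp0.eventually_lt_const one_pos,
    N_tendsto.eventually_ge_atTop (4 * ((1 + η) / (η * s0)) + 8)] with n b0 b1 b2 b3 b4 b5 b6 b7 b8 b9
  have hpn := (hp n).out
  obtain ⟨N, hN⟩ : ∃ N : ℝ, N = (n:ℝ) + 2 := ⟨_, rfl⟩
  have hN0 : 0 < N := hN ▸ hNpos n
  have hkn := hkf n
  have hkC := hkC n
  rw [← hk]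
  rw [← hN] at b1 b2 b3 b4 b5 b9 hkn hkC
  obtain ⟨κ, hκ⟩ : ∃ κ, κ = k n := ⟨_, rfl⟩
  rw [← hκ] at b2 b3 b4 b5 b6 hkn hkC ⊢
  obtain ⟨ρ, hρ⟩ : ∃ ρ, ρ = ⌈δ1 * N⌉₊ := ⟨_, rfl⟩
  rw [← hρ] at b2 b4
  obtain ⟨L, hL⟩ : ∃ L, L = (M + 1) * (κ + 1) := ⟨_, rfl⟩
  have hLr : (L : ℝ) = (M + 1) * (κ + 1) := by rw [hL]; push_cast; ring
  have c4 : 1 / 4 * N ≤ N - ρ - L := by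
    have := mlr b4 hN0.le
    have e : (1 - (ρ:ℝ) / N - (M + 1) * ((κ + 1) / N)) * N = N - ρ - L := by rw [hLr]; field_simp
    linarith
  have hL0 : (0:ℝ) ≤ L := Nat.cast_nonneg _
  have hκL : (κ:ℝ) ≤ L := by exact_mod_cast hL ▸ (Nat.le_succ κ).trans (Nat.le_mul_of_pos_left _ (Nat.succ_pos M))
  obtain ⟨R, -, hR⟩ : ∃ R ⊆ (univ : Finset (Fin (n + 2))), R.card = ρ := exists_subset_card_eq (by
    rw [card_univ, Fintype.card_fin]
    have : (ρ : ℝ) ≤ ((n + 2 : ℕ) : ℝ) := by push_cast; linarith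
    exact_mod_cast this)
  obtain ⟨W, hW⟩ : ∃ W, W = univ \ R := ⟨_, rfl⟩
  have hWR : Disjoint W R := hW ▸ sdiff_disjoint
  have hWRc : W ∪ R = univ := by rw [hW]; exact sdiff_union_of_subset (subset_univ _)
  have hWc : (W.card : ℝ) = N - ρ := by
    have h1 := card_union_of_disjoint hWR
    rw [hWRc, card_univ, Fintype.card_fin, hR] at h1
    have : ((n + 2 : ℕ) : ℝ) = W.card + ρ := by exact_mod_cast h1
    push_cast at this; linarith
  have hq : 0 < (1 + η) / (η * s0) := by positivity
  have hRc : δ1 * N ≤ R.card := by rw [hR, hρ]; exact Nat.le_ceil _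
  have hst : ∀ a ∈ W, s0 ≤ pr (p n) {c : Cfg (Fin (n + 2)) | lstar c R a K} := fun a ha => by
    obtain ⟨b, hb, hba⟩ := exists_mem_ne (s := W) (by
      have : (1:ℝ) < W.card := by rw [hWc]; linarith
      exact_mod_cast this) a
    refine (b1 univ R a b 0 ?_ hRc hba.symm (mem_univ _) (mem_univ _) (subset_univ _)
      (disjoint_left.1 hWR ha) (disjoint_left.1 hWR hb) ?_).1
    · rw [card_univ, Fintype.card_fin]; push_cast; rw [← hN]; have := mul_pos hδ0 hN0; linarith
    · have := hlog n
      rw [← hN] at this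
      have : 0 < lam - 1 := by linarith
      have : 0 < 1 - ε := by linarith
      push_cast; positivity
  have hG := G_lower (p := p n) hWR hWRc (M := M) (k := κ) (w := (1 - δ) * κ) hx0.le b0 hθ.le (by
    refine le_trans (le_of_eq ?_) b6
    rw [div_pow, div_pow, one_pow, ← exp_nat_mul, ← mul_assoc, mul_comm (κ : ℝ)]; ring) (by
    have : (κ : ℝ) ≤ W.card := by rw [hWc]; linarith
    exact_mod_cast this)
  have hbr : β ≤ ((W.card : ℝ) - κ) * p n * x * (1 - p n) ^ ((M + 1) * R.card + (M + 1) * (κ + 1)) := by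
    refine b2.le.trans ?_
    have h1 := one_sub_pow_ge b8 ((M + 1) * R.card + (M + 1) * (κ + 1))
    have e1 : (N * p n / (1 - p n) * ((M + 1) * ((ρ:ℝ) / N + (κ + 1) / N))) = p n / (1 - p n) * (((M + 1) * R.card + (M + 1) * (κ + 1) : ℕ) : ℝ) := by
      rw [hR]; push_cast; field_simp
    rw [e1]
    have e2 : (1 - (ρ:ℝ) / N - (κ + 1) / N) * (N * p n) * x ≤ ((W.card : ℝ) - κ) * p n * x := by
      have : (1 - (ρ:ℝ) / N - (κ + 1) / N) * (N * p n) * x = ((W.card : ℝ) - κ - 1) * p n * x := by rw [hWc]; field_simp; ring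
      rw [this]
      refine mlr (mlr (by linarith) hpn.1) hx0.le
    refine mul_le_mul e2 h1 (exp_pos _).le ?_
    refine mul_nonneg (mul_nonneg ?_ hpn.1) hx0.le
    rw [hWc]; linarith
  have hG2 := (pow_le_pow_left₀ hβ0.le hbr (κ + 1)).trans hG
  rw [← hL] at hG2
  have hGm := G_le_m (p := p n) hWR (K := K) (k := κ) (L := L) (w := (1 - δ) * κ) hs0.le hst
  obtain ⟨G, hGd⟩ : ∃ G, G = ∑ y ∈ Ix W L, gS (p n) κ ((1 - δ) * κ) y.1 y.2 := ⟨_, rfl⟩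
  rw [← hGd] at hG2 hGm
  have hG0 : 0 ≤ G := hGd ▸ sum_nonneg fun _ _ => gS_nonneg _ _ _ _
  have hNβ : β * exp (δ ^ 2 * log N) ≤ N * β ^ (κ + 1) := by
    have e1 : N * β ^ (κ + 1) = β * exp (log N - l0 * (1 + δ) * κ) := by
      rw [exp_sub, exp_log hN0, pow_succ, hβ, ← exp_nat_mul, mul_neg, exp_neg]; field_simp
    rw [e1]
    refine mll (exp_le_exp.2 ?_) hβ0.le
    rw [le_div_iff₀ hl0p] at hkn
    have := mll hkn (show 0 ≤ 1 + δ by linarith)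
    have e2 : (1 + δ) * ((1 - δ) * log N) = log N - δ ^ 2 * log N := by ring
    linarith
  have hfin : 8 * (L:ℝ) ≤ η * s0 * (N * β ^ (κ + 1)) := by
    simp only [Function.comp, pow_one] at b7
    rw [← hN, mul_assoc, mul_le_mul_iff_right₀ (by positivity), exp_neg, ← div_eq_mul_inv, div_le_div_iff₀ (exp_pos _) (by positivity)] at b7
    have h1 : (L:ℝ) ≤ (M + 1) * (C * log N) := by rw [hLr]; gcongr
    have h2 := mll hNβ (show 0 ≤ η * s0 by positivity)
    linarith
  have hLp : (0:ℝ) < L := by rw [hLr]; positivity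
  refine le_trans (pr_mono fun c hc h => hc ⟨R, W, K, L, h⟩) (tent_pairs (p := p n) hWR hK hη hη1 hs0.le
    (fun U a b => det_Bad U a b _ _ _ _) hst ?_ ?_ ?_ rfl ?_)
  · intro S S' a a' hS hS' hSL hSL' ha ha' hne h1 h2 h3 h4
    have hk0 : (0:ℝ) ≤ (1 - ε) * lam / (lam - 1) * log N := by
      have := hlog n
      rw [← hN] at this
      have : 0 < lam - 1 := by linarith
      have : 0 < 1 - ε := by linarith
      positivity
    have := (b1 (Finset.univ \ (S ∪ S')) R a a' _ ?_ hRc hne (by simp [h1, h2]) (by simp [h3, h4]) ?_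
      (disjoint_left.1 hWR ha) (disjoint_left.1 hWR ha') (Nat.floor_le hk0)).2
    · rw [hN] at this; exact this
    · have h5 : (univ : Finset (Fin (n + 2))).card ≤ (univ \ (S ∪ S')).card + (S.card + S'.card) :=
        (card_le_card_sdiff_add_card (s := univ) (t := S ∪ S')).trans (Nat.add_le_add_left (card_union_le _ _) _)
      rw [card_univ, Fintype.card_fin] at h5
      have h6 : n + 2 ≤ (univ \ (S ∪ S')).card + (L + L) := by omega
      have h7 : (n:ℝ) + 2 ≤ (univ \ (S ∪ S')).card + (L + L) := by exact_mod_cast h6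
      have h8 := mlr b5 hN0.le
      have e : 2 * ((M:ℝ) + 1) * ((κ + 1) / N) * N = L + L := by rw [hLr]; field_simp; ring
      linarith
    · intro v hv
      have : v ∉ W := fun h => disjoint_left.1 hWR h hv
      simp only [Finset.mem_sdiff, Finset.mem_univ, Finset.mem_union, true_and, not_or]
      exact ⟨fun h => this (hS h), fun h => this (hS' h)⟩
  · refine b3.le.trans (mll ?_ (by linarith))
    refine le_trans ?_ (one_add_mul_le_pow (show -2 ≤ -p n by linarith) (2 * L ^ 2))
    refine le_of_eq ?_
    push_cast; rw [hLr]; field_simp; ring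
  · rw [hWc]
    have := mll (show (1 + η) / (η * s0) ≤ N - ρ - L by linarith) (show 0 ≤ η * s0 by positivity)
    rw [mul_div_cancel₀ _ (by positivity)] at this
    linarith
  · refine le_trans ?_ (mll hGm hη.le)
    rw [hWc]
    have h1 : G * (s0 * (1 / 4 * N)) ≤ G * (s0 * (N - ρ - L)) := by gcongr
    have h2 := mll hG2 (show 0 ≤ η * s0 * N by positivity)
    have h3 := mll h1 hη.le
    refine le_trans ?_ h3
    have : 8 * (L:ℝ) * 1 ≤ 8 * L * (η * (G * (s0 * (1 / 4 * N)))) := by linarith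
    exact le_of_mul_le_mul_left this (by positivity)
end
section
open Finset
variable {N : ℕ} {c : Cfg (Fin N)}
lemma eff_adj {u v : Fin N} (h : (theGraph c).Adj u v) : effWeight c u v = ((c s(u, v)).2.toNNReal : ℝ≥0∞) := if_pos h
lemma walk_of_fin : ∀ {k : ℕ} (q : Fin (k + 1) → Fin N) (u v : Fin N), q 0 = u → q (Fin.last k) = v → walkWeight (effWeight c) q ≠ ⊤ →
    ∃ w : (theGraph c).Walk u v, w.length = k ∧ (wts c w.edges : ℝ≥0∞) = walkWeight (effWeight c) q
  | 0, q, u, v, h0, h1, _ => by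
    obtain rfl : u = v := h0.symm.trans h1
    exact ⟨.nil, rfl, by simp [walkWeight, wts]⟩
  | k + 1, q, u, v, h0, hl, h => by
    have e : walkWeight (effWeight c) q = effWeight c u (q 1) + walkWeight (effWeight c) (fun i => q i.succ) := by
      rw [walkWeight, Fin.sum_univ_succ, ← h0]; rfl
    rw [e] at h ⊢
    obtain ⟨h1, h2⟩ := ENNReal.add_ne_top.1 h
    obtain ⟨w, hw, hw2⟩ := walk_of_fin (fun i => q i.succ) (q 1) v rfl hl h2
    have ha : (theGraph c).Adj u (q 1) := by
      by_contra h'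
      exact h1 (if_neg h')
    refine ⟨.cons ha w, by simp [hw], ?_⟩
    rw [SimpleGraph.Walk.edges_cons, wts_cons, ← hw2, eff_adj ha, ENNReal.coe_add]
lemma fin_of_walk {u v : Fin N} (w : (theGraph c).Walk u v) : ∃ k, ∃ q : Fin (k + 1) → Fin N, q 0 = u ∧ q (Fin.last _) = v ∧
    walkWeight (effWeight c) q = wts c w.edges := by
  induction w with
  | nil => exact ⟨0, fun _ => _, rfl, rfl, by rw [walkWeight]; simp [wts]⟩
  | @cons u v' v h w ih =>
    obtain ⟨k, q, h0, h1, h2⟩ := ih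
    refine ⟨k + 1, Fin.cons u q, rfl, h1, ?_⟩
    have e : walkWeight (effWeight c) (Fin.cons u q : Fin (k + 1 + 1) → Fin N) = effWeight c u (q 0) + walkWeight (effWeight c) q := by
      rw [walkWeight, Fin.sum_univ_succ]; rfl
    rw [SimpleGraph.Walk.edges_cons, wts_cons, e, h2, h0, eff_adj h, ENNReal.coe_add]
lemma mw_le {u v : Fin N} (w : (theGraph c).Walk u v) : minWeight (effWeight c) u v ≤ wts c w.edges := by
  obtain ⟨k, q, h0, h1, h2⟩ := fin_of_walk w
  rw [← h2]
  exact iInf_le_of_le _ (iInf_le_of_le q (iInf_le _ ⟨h0, h1⟩))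
lemma le_mw {u v : Fin N} {x : ℝ≥0∞} (h : ∀ w : (theGraph c).Walk u v, x ≤ wts c w.edges) : x ≤ minWeight (effWeight c) u v := by
  refine le_iInf fun k => le_iInf fun q => le_iInf fun hq => ?_
  by_cases ht : walkWeight (effWeight c) q = ⊤
  · rw [ht]; exact le_top
  · obtain ⟨w, -, hw⟩ := walk_of_fin q _ _ hq.1 hq.2 ht
    rw [← hw]
    exact h w
lemma min_hop {u v : Fin N} (hr : (theGraph c).Reachable u v) {x : ℝ} {m : ℕ} (h : ∀ w : (theGraph c).Walk u v, w.IsPath → x ≤ wts c w.edges)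
    (h2 : ∀ w : (theGraph c).Walk u v, w.IsPath → (∀ w' : (theGraph c).Walk u v, wts c w.edges ≤ wts c w'.edges) → m ≤ w.length) :
    x ≤ (minWeight (effWeight c) u v).toReal ∧ m ≤ hopCount (effWeight c) u v := by
  classical
  have hb : ∀ w : (theGraph c).Walk u v, wts c w.bypass.edges ≤ wts c w.edges := fun w => wts_sublist w.edges_bypass_sublist_edges
  obtain ⟨w0⟩ := id hr
  have hne : minWeight (effWeight c) u v ≠ ⊤ := ((mw_le w0).trans_lt ENNReal.coe_lt_top).ne
  constructor
  · rw [← ENNReal.ofReal_le_iff_le_toReal hne]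
    refine le_mw fun w => ?_
    rw [ENNReal.ofReal, ENNReal.coe_le_coe]
    exact Real.toNNReal_le_iff_le_coe.2 ((h _ w.bypass_isPath).trans (hb w))
  · haveI : DecidableRel (theGraph c).Adj := Classical.decRel _
    obtain ⟨P, -, hP⟩ := exists_min_image (univ : Finset ((theGraph c).Path u v)) (fun P => wts c P.1.edges) ⟨⟨_, w0.bypass_isPath⟩, mem_univ _⟩
    have hP' : ∀ w : (theGraph c).Walk u v, wts c P.1.edges ≤ wts c w.edges := fun w => (hP ⟨_, w.bypass_isPath⟩ (mem_univ _)).trans (hb w)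
    have hmin : minWeight (effWeight c) u v = wts c P.1.edges := le_antisymm (mw_le _) (le_mw fun w => ENNReal.coe_le_coe.2 (hP' w))
    obtain ⟨q, q0, q1, q2⟩ := Nat.sInf_mem (s := {k : ℕ | ∃ q : Fin (k + 1) → Fin N, q 0 = u ∧ q (Fin.last k) = v ∧ walkWeight (effWeight c) q = minWeight (effWeight c) u v})
      (by obtain ⟨k, q, h0, h1, h2⟩ := fin_of_walk P.1; exact ⟨k, q, h0, h1, h2.trans hmin.symm⟩)
    change m ≤ sInf _
    obtain ⟨w, hw, hw2⟩ := walk_of_fin q _ _ q0 q1 (by rw [q2]; exact hne)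
    have : wts c w.edges = wts c P.1.edges := ENNReal.coe_inj.1 (hw2.trans (q2.trans hmin))
    have h3 := h2 w.bypass w.bypass_isPath fun w' => (hb w).trans (this ▸ hP' w')
    exact h3.trans (w.length_bypass_le_length.trans hw.le)
lemma walk_of_list : ∀ {l : List (Fin N)} {a b : Fin N}, l.Nodup → l.head? = some a → l.getLast? = some b → (∀ e ∈ ledges l, (c e).1 = true) →
    ∃ w : (theGraph c).Walk a b, w.edges = ledges l
  | [], a, b, _, h, _, _ => by simp at h
  | [x], a, b, _, h, h', _ => by simp at h h'; subst h h'; exact ⟨.nil, by simp⟩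
  | x :: y :: l, a, b, hn, h, h', he => by
    simp only [List.head?_cons, Option.some.injEq] at h; subst h
    obtain ⟨w, hw⟩ := walk_of_list (a := y) (b := b) hn.of_cons rfl (by simpa using h') (fun e h => he e (by simp [h]))
    have : (theGraph c).Adj x y := ⟨fun h => by simp [h] at hn, he _ (by simp)⟩
    exact ⟨.cons this w, by simp [hw]⟩
lemma SP_of_walk {U : Finset (Fin N)} {a b : Fin N} {t : ℝ} (w : (theGraph c).Walk a b) (hw : w.IsPath) (hU : ∀ x ∈ w.support, x ∈ U)
    (ht : wts c w.edges ≤ t) : SPk c U a b t w.length := by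
  have e : ledges w.support = w.edges := SimpleGraph.Walk.edges_eq_zipWith_support.symm
  refine ⟨w.support, ⟨hw.support_nodup, hU, by cases w <;> simp, ?_⟩, ⟨fun e' he => ?_, by rw [e]; exact ht⟩, by simp⟩
  · rw [List.getLast?_eq_some_getLast w.support_ne_nil, w.getLast_support]
  · rw [e] at he
    induction e' with | _ x y => exact (w.adj_of_mem_edges he).2
variable {S : Finset (Fin N)} {r a : Fin N}
lemma Exit.split (hE : Exit (bb c) S (univ \ S) r a) {i j : Fin N} (hr : r ∈ S) (ha : a ∉ S) (hi : i ∈ S) (hj : j ∉ S) (w : (theGraph c).Walk i j) (hw : w.IsPath) :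
    ∃ (w1 : (theGraph c).Walk i a) (w2 : (theGraph c).Walk a j), w = w1.append w2 ∧ ∀ x ∈ w2.support, x ∉ S := by
  obtain ⟨d, hd, h1, h2⟩ := w.exists_boundary_dart S hi hj
  have ha' : a ∈ w.support := by
    rw [← (hE.2 _ h1 _ (by simpa using h2) d.adj).2]; exact w.dart_snd_mem_support_of_mem_darts hd
  refine ⟨w.takeUntil a ha', w.dropUntil a ha', (w.take_spec ha').symm, fun x hx hxS => ?_⟩
  have hr1 : r ∈ (w.takeUntil a ha').support := by
    obtain ⟨d, hd, h1, h2⟩ := (w.takeUntil a ha').exists_boundary_dart S hi ha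
    rw [← (hE.2 _ h1 _ (by simpa using h2) d.adj).1]; exact SimpleGraph.Walk.dart_fst_mem_support_of_mem_darts _ hd
  have hr2 : r ∈ (w.dropUntil a ha').support := by
    obtain ⟨d, hd, h1, h2⟩ := ((w.dropUntil a ha').takeUntil x hx).exists_boundary_dart (Sᶜ : Set (Fin N)) ha (by simpa using hxS)
    rw [← (hE.2 _ (by simpa using h2) _ (by simpa using h1) d.symm.adj).1]
    exact SimpleGraph.Walk.support_takeUntil_subset _ _ (SimpleGraph.Walk.dart_snd_mem_support_of_mem_darts _ hd)
  have hn := hw.support_nodup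
  rw [← w.take_spec ha', SimpleGraph.Walk.support_append, List.nodup_append] at hn
  rw [SimpleGraph.Walk.mem_support_iff] at hr2
  rcases hr2 with rfl | hr2
  · exact ha hr
  · exact hn.2.2 _ hr1 _ hr2 rfl
lemma seg {k : ℕ} {x : ℝ} {q : List (Fin N)} {i : Fin N} (hE : Exit (bb c) S (univ \ S) r a) (ha : a ∉ S) (hq : qok k S r q) (hF : Fq c x q S)
    (hi : q.head? = some i) (w : (theGraph c).Walk i a) : x ≤ wts c w.edges ∧ k ≤ w.length := by
  classical
  obtain ⟨hn, hl, hqS, hlast⟩ := hq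
  obtain ⟨-, ⟨lv, hlv, hlv2⟩, -, hx⟩ := hF
  have hg : ∀ {i y}, q[i]? = some y → lv y = i ∧ i < k + 1 := fun {i y} h => by
    obtain ⟨h1, rfl⟩ := List.getElem?_eq_some_iff.1 h
    exact ⟨hlv _ h1, hl ▸ h1⟩
  have hlr : lv r = k := (hg (i := k) (by rw [List.getLast?_eq_getElem?, hl] at hlast; simpa using hlast)).1
  have hli : lv i = 0 := (hg (i := 0) (by rw [← List.head?_eq_getElem?]; exact hi)).1
  have hiS : i ∈ S := hqS _ (List.mem_of_head? hi)
  have hsub : ledges q ⊆ w.edges := fun e he => by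
    obtain ⟨t, y, z, h1, h2, rfl⟩ := mem_ledges_iff.1 he
    have htk := (hg h2).2
    obtain ⟨d, hd, hd1, hd2⟩ := w.exists_boundary_dart {y | (if y ∈ S then lv y else k) ≤ t} (by simp [hiS, hli]) (by simp [ha]; omega)
    simp only [Set.mem_ofPred_eq] at hd1 hd2
    have h3 : d.fst ∈ S := by by_contra h; rw [if_neg h] at hd1; omega
    rw [if_pos h3] at hd1
    have h4 : d.snd ∈ S := by
      by_contra h
      rw [(hE.2 _ h3 _ (by simpa using h) d.adj).1, hlr] at hd1; omega
    rw [if_pos h4] at hd2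
    obtain ⟨t', h5, h6⟩ := hlv2 _ h3 _ h4 d.adj (by omega)
    have h7 := (hg h5).1
    have h8 := (hg h6).1
    obtain rfl : t' = t := by omega
    rw [h1] at h5; rw [h2] at h6
    rw [Option.some.inj h5, Option.some.inj h6]
    exact List.mem_map.2 ⟨d, hd, rfl⟩
  have hsp := (ledges_nodup hn).subperm hsub
  constructor
  · obtain ⟨l, hl1, hl2⟩ := hsp
    have e : wts c l = wts c (ledges q) := (hl1.map _).sum_eq
    refine hx.trans ?_
    rw [← e]; exact_mod_cast wts_sublist hl2
  · have := hsp.length_le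
    rw [ledges_length, hl, SimpleGraph.Walk.length_edges] at this
    omega
lemma Es.walk {R : Finset (Fin N)} {K k : ℕ} {x : ℝ} (h : Es c R K k x S r a) : ∃ i ∈ S, (theGraph c).Reachable i a ∧
    ∀ w : (theGraph c).Walk i a, x ≤ wts c w.edges ∧ k ≤ w.length := by
  obtain ⟨ha, ⟨q, hq, hF⟩, hE, -⟩ := h
  obtain ⟨i, hi⟩ : ∃ i, q.head? = some i := by
    have h2 := hq.2.1
    cases q with
    | nil => simp at h2
    | cons i q => exact ⟨i, rfl⟩
  obtain ⟨w, -⟩ := walk_of_list hq.1 hi hq.2.2.2 hF.2.2.1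
  exact ⟨i, hq.2.2.1 _ (List.mem_of_head? hi), w.reachable.trans (adj_iff.1 hE.1).reachable, seg hE ha hq hF hi⟩
lemma wts_rev {u v : Fin N} (w : (theGraph c).Walk u v) : wts c w.reverse.edges = wts c w.edges := by
  rw [SimpleGraph.Walk.edges_reverse]; exact ((List.reverse_perm _).map _).sum_eq
lemma good_det {R W : Finset (Fin N)} {K k L K0 : ℕ} {x D0 tl tu : ℝ} (h : GoodPair c R W K k L x fun U a b => {c | Bad c U a b D0 tl tu K0}) :
    ∃ i j, (theGraph c).Reachable i j ∧ D0 ≤ (reachS c {i}).card ∧ 2 * x + tl ≤ (minWeight (effWeight c) i j).toReal ∧ 2 * k + K0 ≤ hopCount (effWeight c) i j := by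
  obtain ⟨S, r, a, S', r', a', h1, h2, hSS, hne, haS', haS, hB⟩ := h
  simp only [Set.mem_ofPred_eq, Bad, not_or, not_not] at hB
  obtain ⟨hB1, hB2, ⟨l, hl, hl2⟩, T, hTU, hTD, hT⟩ := hB
  obtain ⟨i, hi, hia, hiw⟩ := h1.walk
  obtain ⟨j, hj, hja, hjw⟩ := h2.walk
  obtain ⟨wm, hwm⟩ := walk_of_list hl.1 hl.2.2.1 hl.2.2.2 hl2.1
  have hjS : j ∉ S := fun h => disjoint_left.1 hSS h hj
  have hdec : ∀ w : (theGraph c).Walk i j, w.IsPath → ∃ (w1 : (theGraph c).Walk i a) (w2 : (theGraph c).Walk a a') (w3 : (theGraph c).Walk j a'),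
      w2.IsPath ∧ (∀ y ∈ w2.support, y ∈ univ \ (S ∪ S')) ∧ wts c w.edges = wts c w1.edges + wts c w2.edges + wts c w3.edges ∧
      w.length = w1.length + w2.length + w3.length := fun w hw => by
    obtain ⟨w1, w2, rfl, hw2⟩ := h1.2.2.1.split h1.r_mem h1.1 hi hjS w hw
    have hp2 := hw.of_append_right
    obtain ⟨w3, w4, e, hw4⟩ := h2.2.2.1.split h2.r_mem h2.1 hj haS' w2.reverse hp2.reverse
    have hp4 : w4.IsPath := (e ▸ hp2.reverse).of_append_right
    have e2 : wts c w2.edges = wts c w3.edges + wts c w4.edges := by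
      rw [← wts_rev w2, e, SimpleGraph.Walk.edges_append, wts_append]
    have e3 : w2.length = w3.length + w4.length := by rw [← w2.length_reverse, e, SimpleGraph.Walk.length_append]
    refine ⟨w1, w4.reverse, w3, hp4.reverse, fun y hy => ?_, ?_, ?_⟩
    · rw [SimpleGraph.Walk.support_reverse, List.mem_reverse] at hy
      have : y ∈ w2.reverse.support := by rw [e, SimpleGraph.Walk.mem_support_append_iff]; exact Or.inr hy
      rw [SimpleGraph.Walk.support_reverse, List.mem_reverse] at this
      simp [hw2 y this, hw4 y hy]
    · rw [wts_rev, SimpleGraph.Walk.edges_append, wts_append, e2]; ring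
    · rw [SimpleGraph.Walk.length_append, SimpleGraph.Walk.length_reverse, e3]; ring
  have hlow : ∀ w2 : (theGraph c).Walk a a', w2.IsPath → (∀ y ∈ w2.support, y ∈ univ \ (S ∪ S')) → tl ≤ wts c w2.edges := fun w2 hw hU => by
    by_contra! h
    obtain ⟨l, h1, h2, -⟩ := SP_of_walk w2 hw hU h.le
    exact hB1 ⟨l, h1, h2⟩
  have haa := wm.reachable
  refine ⟨i, j, (hia.trans haa).trans hja.symm, hTD.trans ?_, min_hop ((hia.trans haa).trans hja.symm) (fun w hw => ?_) fun w hw hmin => ?_⟩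
  · refine Nat.cast_le.2 (card_le_card fun y hy => mem_reachS.2 ⟨i, by simp, ?_⟩)
    obtain ⟨l, hl, hl2⟩ := hT y hy
    obtain ⟨w, -⟩ := walk_of_list hl.1 hl.2.2.1 hl.2.2.2 hl2.1
    exact hia.trans w.reachable
  · obtain ⟨w1, w2, w3, hp, hU, e, -⟩ := hdec w hw
    have := (hiw w1).1
    have := (hjw w3).1
    have := hlow w2 hp hU
    rw [e]; push_cast; linarith
  · obtain ⟨w1, w2, w3, hp, hU, e, e'⟩ := hdec w hw
    have h3 := hmin ((w1.append wm).append w3.reverse)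
    rw [e, SimpleGraph.Walk.edges_append, SimpleGraph.Walk.edges_append, wts_append, wts_append, wts_rev] at h3
    have h4 : wts c w2.edges ≤ wts c wm.edges := by
      have := le_of_add_le_add_right h3
      exact le_of_add_le_add_left this
    have h5 : (wts c w2.edges : ℝ) ≤ tu := le_trans (by exact_mod_cast h4) (hwm ▸ hl2.2)
    have h6 : K0 < w2.length := by
      by_contra! h
      obtain ⟨l, h1, h2, h3⟩ := SP_of_walk w2 hp hU h5
      exact hB2 ⟨l, h1, h2, by omega⟩
    have := (hiw w1).2
    have := (hjw w3).2
    omega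
end
theorem long_paths
    (p : ℕ → ℝ) (hp : ∀ n, 0 ≤ p n ∧ p n ≤ 1)
    (lam : ℝ) (hlam : 1 < lam)
    (hlim : Tendsto (fun n : ℕ => ((n : ℝ) + 2) * p n) atTop (nhds lam))
    (mu : ℝ) (hmu : mu ∈ Set.Ioo (0 : ℝ) 1)
    (hdual : mu * Real.exp (-mu) = lam * Real.exp (-lam))
    (c d : ℝ)
    (hc : c = 1 / (lam - 1) + 2 / Real.log (1 / mu))
    (hd : d = lam / (lam - 1) + 2 / Real.log (1 / mu))
    (Ω : ℕ → Type) (mΩ : ∀ n, MeasurableSpace (Ω n)) (μ : ∀ n, Measure (Ω n))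
    (hμ : ∀ n, IsProbabilityMeasure (μ n))
    (Z : ∀ n, Sym2 (Fin (n + 2)) → Ω n → Bool × ℝ)
    (hZmeas : ∀ n e, Measurable (Z n e))
    (hindep : ∀ n, iIndepFun (Z n) (μ n))
    (hlaw : ∀ n e, (μ n).map (Z n e) = (bernoulliDist (p n)).prod expDist) :
    ∀ ε : ℝ, 0 < ε →
      Tendsto (fun n : ℕ =>
          μ n {ω | ∃ i j : Fin (n + 2),
            inLargestComponent (theGraph (fun e => Z n e ω)) i ∧
            inLargestComponent (theGraph (fun e => Z n e ω)) j ∧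
            (theGraph (fun e => Z n e ω)).Reachable i j ∧
            (1 - ε) * c * Real.log ((n : ℝ) + 2) ≤
              (minWeight (effWeight (fun e => Z n e ω)) i j).toReal ∧
            (1 - ε) * d * Real.log ((n : ℝ) + 2) ≤
              (hopCount (effWeight (fun e => Z n e ω)) i j : ℝ)})
        atTop (nhds 1) := by
  intro ε0 hε0
  haveI : ∀ n, Fact (0 ≤ p n ∧ p n ≤ 1) := fun n => ⟨hp n⟩
  obtain ⟨ε, hε, hε1, hεle⟩ : ∃ ε > 0, ε < 1 ∧ ε ≤ ε0 := ⟨min ε0 (1 / 2), by positivity, (min_le_right _ _).trans_lt (by norm_num), min_le_left _ _⟩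
  obtain ⟨Sg, hSg⟩ : ∃ Sg : ∀ n, Set (Cfg (Fin (n + 2))), Sg = fun n => {z | ∃ i j : Fin (n + 2), inLargestComponent (theGraph z) i ∧
            inLargestComponent (theGraph z) j ∧ (theGraph z).Reachable i j ∧
            (1 - ε0) * c * Real.log ((n : ℝ) + 2) ≤ (minWeight (effWeight z) i j).toReal ∧
            (1 - ε0) * d * Real.log ((n : ℝ) + 2) ≤ (hopCount (effWeight z) i j : ℝ)} := ⟨_, rfl⟩
  have hmain : Tendsto (fun n => pr (p n) (Sg n)ᶜ) atTop (nhds 0) := by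
    obtain ⟨δ0, hδ0, tu, H⟩ := good_pairs hlam hlim hmu hdual hε hε1 (δ := ε / 4) (by positivity) (by linarith)
    have hU := unique_giant p lam hlam hlim mu hmu hdual δ0 hδ0
    obtain ⟨l0, hl0⟩ : ∃ l0, l0 = log (1 / mu) := ⟨_, rfl⟩
    have hl0p : 0 < l0 := hl0 ▸ log_pos (one_lt_one_div hmu.1 hmu.2)
    have hlm : 0 < lam - 1 := by linarith
    rw [← hl0] at hc hd
    have hc0 : 0 ≤ c := by rw [hc]; positivity
    have hd0 : 0 ≤ d := by rw [hd]; positivity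
    have key : ∀ᶠ n in atTop, ∀ z : Cfg (Fin (n + 2)), (∃ R W K L, GoodPair z R W K (kn (ε / 4) mu n) L ((1 - ε / 4) * kn (ε / 4) mu n) (BfN δ0 ε lam tu n)) →
        (¬ ∃ u v, ¬ (theGraph z).Reachable u v ∧ δ0 * ((n:ℝ) + 2) ≤ (reachS z {u}).card ∧ δ0 * ((n:ℝ) + 2) ≤ (reachS z {v}).card) → z ∈ Sg n := by
      filter_upwards [logN_tendsto.eventually_ge_atTop (3 * l0 / ε)] with n hn z h1 h2
      obtain ⟨R, W, K, L, h1⟩ := h1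
      obtain ⟨i, j, hij, hD, hw, hh⟩ := good_det h1
      have hlarge : inLargestComponent (theGraph z) i := fun u => by
        rw [supp_ncard, supp_ncard]
        by_cases hr : (theGraph z).Reachable u i
        · rw [← supp_ncard, ← supp_ncard, SimpleGraph.ConnectedComponent.sound hr]
        · by_contra! h
          exact h2 ⟨u, i, hr, hD.trans (Nat.cast_le.2 h.le), hD⟩
      have hlj : inLargestComponent (theGraph z) j := by
        rw [inLargestComponent, ← SimpleGraph.ConnectedComponent.sound hij]; exact hlarge
      rw [hSg]
      obtain ⟨X, hX⟩ : ∃ X, X = log ((n:ℝ) + 2) := ⟨_, rfl⟩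
      rw [← hX] at hw hn
      have hX0 : 0 ≤ X := le_trans (by positivity) hn
      have hk : (1 - ε / 4) * X / l0 < kn (ε / 4) mu n + 1 := by rw [hX, hl0]; exact Nat.lt_floor_add_one _
      have hK := Nat.lt_floor_add_one ((1 - ε) * lam / (lam - 1) * log ((n:ℝ) + 2))
      have hh' : (2 * kn (ε / 4) mu n + ⌊(1 - ε) * lam / (lam - 1) * log ((n:ℝ) + 2)⌋₊ : ℝ) ≤ hopCount (effWeight z) i j := by exact_mod_cast hh
      rw [← hX] at hK hh'
      rw [div_le_iff₀ hε] at hn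
      obtain ⟨Y, hY⟩ : ∃ Y, Y = X / l0 := ⟨_, rfl⟩
      have hY3 : 3 ≤ Y * ε := by rw [hY, div_mul_eq_mul_div, le_div_iff₀ hl0p]; exact hn
      have e1 : (1 - ε / 4) * X / l0 = (1 - ε / 4) * Y := by rw [hY]; ring
      rw [e1] at hk
      have hY0 : 0 ≤ Y := by rw [hY]; positivity
      refine ⟨i, j, hlarge, hlj, hij, ?_, ?_⟩
      · rw [← hX]
        have e : (1 - ε) * c * X = (1 - ε) * X / (lam - 1) + 2 * ((1 - ε) * Y) := by rw [hc, hY]; ring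
        have h3 : (1 - ε0) * c * X ≤ (1 - ε) * c * X := by gcongr
        have h4 := mul_le_mul_of_nonneg_left hk.le (show 0 ≤ 1 - ε / 4 by linarith)
        have h5 : 0 ≤ ε * ε * Y := by positivity
        nlinarith
      · rw [← hX]
        have e : (1 - ε) * d * X = (1 - ε) * lam / (lam - 1) * X + 2 * ((1 - ε) * Y) := by rw [hd, hY]; ring
        have h3 : (1 - ε0) * d * X ≤ (1 - ε) * d * X := by gcongr
        nlinarith
    refine tendsto_order.2 ⟨fun a ha => Eventually.of_forall fun n => ha.trans_le (pr_nonneg _), fun a ha => ?_⟩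
    obtain ⟨η, hη⟩ : ∃ η, η = min 1 (a / 20) := ⟨_, rfl⟩
    have hη0 : 0 < η := by rw [hη]; positivity
    have hηa : η ≤ a / 20 := hη ▸ min_le_right _ _
    filter_upwards [key, H η hη0 (hη ▸ min_le_left _ _), hU.eventually_le_const hη0] with n k1 k2 k3
    refine lt_of_le_of_lt ((pr_mono ?_).trans ((pr_union_le _ _).trans (add_le_add k2 k3))) (by linarith)
    intro z hz
    by_contra h
    rw [Set.mem_union, not_or] at h
    exact hz (k1 z (not_not.1 h.1) h.2)
  have hPP : ∀ n, (μ n).map (fun ω e => Z n e ω) = PP (Fin (n + 2)) (p n) := fun n => by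
    rw [(iIndepFun_iff_map_fun_eq_pi_map fun e => (hZmeas n e).aemeasurable).1 (hindep n)]
    simp_rw [hlaw]; rfl
  have hz : Tendsto (fun n => PP (Fin (n + 2)) (p n) (Sg n)ᶜ) atTop (nhds 0) := by
    have := (ENNReal.continuous_ofReal.tendsto 0).comp hmain
    rw [ENNReal.ofReal_zero] at this
    refine this.congr fun n => ?_
    exact ofReal_measureReal
  have h1 := ENNReal.Tendsto.sub (tendsto_const_nhds (x := (1:ℝ≥0∞))) hz (Or.inl ENNReal.one_ne_top)
  rw [tsub_zero] at h1
  refine tendsto_of_tendsto_of_tendsto_of_le_of_le h1 tendsto_const_nhds (fun n => ?_) fun n => prob_le_one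
  have e : {ω | ∃ i j : Fin (n + 2), inLargestComponent (theGraph (fun e => Z n e ω)) i ∧ inLargestComponent (theGraph (fun e => Z n e ω)) j ∧
            (theGraph (fun e => Z n e ω)).Reachable i j ∧
            (1 - ε0) * c * Real.log ((n : ℝ) + 2) ≤ (minWeight (effWeight (fun e => Z n e ω)) i j).toReal ∧
            (1 - ε0) * d * Real.log ((n : ℝ) + 2) ≤ (hopCount (effWeight (fun e => Z n e ω)) i j : ℝ)} = (fun ω e => Z n e ω) ⁻¹' Sg n := by rw [hSg]; rfl
  rw [e]
  have h2 : μ n ((fun ω e => Z n e ω) ⁻¹' (Sg n)ᶜ) ≤ PP (Fin (n + 2)) (p n) (Sg n)ᶜ := by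
    rw [← hPP]; exact Measure.le_map_apply (measurable_pi_lambda _ (hZmeas n)).aemeasurable _
  have h3 : (1:ℝ≥0∞) ≤ μ n ((fun ω e => Z n e ω) ⁻¹' Sg n) + μ n ((fun ω e => Z n e ω) ⁻¹' (Sg n)ᶜ) := by
    rw [← measure_univ (μ := μ n), ← Set.union_compl_self ((fun ω e => Z n e ω) ⁻¹' Sg n)]
    exact measure_union_le _ _
  exact tsub_le_iff_right.2 (h3.trans (by gcongr))
end
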